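/- Let X be a smooth projective variety over an algebraically closed field, φ: X → X a separable morphism, and L an ample line bundle on X with φ*(L) ≅ L^{⊗d} for some d > 1. If the Kodaira dimension of X is ≥ 0, then X contains no positive dimensional closed subvariety with finite algebraic fundamental group. -/

import Mathlib

open AlgebraicGeometry CategoryTheory CategoryTheory.Limits Opposite

noncomputable section

universe u

/-- Restriction of sections of the structure sheaf, as a ring homomorphism. -/
def sres (X : Scheme.{u}) {V W : X.Opens} (h : V ≤ W) : Γ(X, W) →+* Γ(X, V) :=
  (X.presheaf.map (homOfLE h).op : Γ(X, W) ⟶ Γ(X, V)).hom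

lemma sres_sres (X : Scheme.{u}) {V W T : X.Opens} (h₁ : V ≤ W) (h₂ : W ≤ T) (a : Γ(X, T)) :
    sres X h₁ (sres X h₂ a) = sres X (h₁.trans h₂) a := by
  have : (homOfLE (h₁.trans h₂)).op = (homOfLE h₂).op ≫ (homOfLE h₁).op := rfl
  simp only [sres, this, Functor.map_comp]
  rfl

/-- A line bundle (invertible sheaf) on a scheme `X`, presented by an open cover and a
Čech `1`-cocycle of transition units. -/
structure LineBundle (X : Scheme.{u}) where
  ι : Type u
  U : ι → X.Opens
  covers : iSup U = ⊤
  t : ∀ i j, (Γ(X, U i ⊓ U j))ˣ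
  cocycle : ∀ i j l,
    Units.map (sres X (show U i ⊓ U j ⊓ U l ≤ U i ⊓ U j from inf_le_left)).toMonoidHom (t i j)
      * Units.map (sres X (show U i ⊓ U j ⊓ U l ≤ U j ⊓ U l from
          le_inf (inf_le_left.trans inf_le_right) inf_le_right)).toMonoidHom (t j l)
    = Units.map (sres X (show U i ⊓ U j ⊓ U l ≤ U i ⊓ U l from
          le_inf (inf_le_left.trans inf_le_left) inf_le_right)).toMonoidHom (t i l)

namespace LineBundle

variable {X Y : Scheme.{u}}

/-- The `n`-th tensor power of a line bundle. -/
def pow (L : LineBundle X) (n : ℕ) : LineBundle X where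
  ι := L.ι
  U := L.U
  covers := L.covers
  t i j := L.t i j ^ n
  cocycle i j l := by
    simp only [map_pow, ← mul_pow, L.cocycle i j l]

/-- The dual (inverse) of a line bundle. -/
def dual (L : LineBundle X) : LineBundle X where
  ι := L.ι
  U := L.U
  covers := L.covers
  t i j := (L.t i j)⁻¹
  cocycle i j l := by
    simp only [map_inv, ← mul_inv, L.cocycle i j l]

/-- The trivial line bundle. -/
def trivial (X : Scheme.{u}) : LineBundle X where
  ι := PUnit
  U _ := ⊤
  covers := by simp
  t _ _ := 1
  cocycle _ _ _ := by simp

lemma unit_sres_sres (X : Scheme.{u}) {V W T : X.Opens} (h₁ : V ≤ W) (h₂ : W ≤ T)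
    (u : (Γ(X, T))ˣ) :
    Units.map (sres X h₁).toMonoidHom (Units.map (sres X h₂).toMonoidHom u)
      = Units.map (sres X (h₁.trans h₂)).toMonoidHom u := by
  ext
  exact sres_sres X h₁ h₂ u

/-- The tensor product of two line bundles. -/
def tensor (L M : LineBundle X) : LineBundle X where
  ι := L.ι × M.ι
  U p := L.U p.1 ⊓ M.U p.2
  covers := by
    apply le_antisymm le_top
    have h : (⊤ : X.Opens) = (⨆ i, L.U i) ⊓ ⨆ j, M.U j := by
      rw [L.covers, M.covers, top_inf_eq]
    rw [h, iSup_inf_eq]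
    refine iSup_le fun i => ?_
    rw [inf_iSup_eq]
    exact iSup_le fun j => le_iSup_of_le (i, j) le_rfl
  t p q :=
    Units.map (sres X (show (L.U p.1 ⊓ M.U p.2) ⊓ (L.U q.1 ⊓ M.U q.2) ≤ L.U p.1 ⊓ L.U q.1 from
        le_inf (inf_le_left.trans inf_le_left) (inf_le_right.trans inf_le_left))).toMonoidHom
      (L.t p.1 q.1) *
    Units.map (sres X (show (L.U p.1 ⊓ M.U p.2) ⊓ (L.U q.1 ⊓ M.U q.2) ≤ M.U p.2 ⊓ M.U q.2 from
        le_inf (inf_le_left.trans inf_le_right) (inf_le_right.trans inf_le_right))).toMonoidHom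
      (M.t p.2 q.2)
  cocycle p q r := by
    simp only [map_mul, unit_sres_sres]
    have hL := congrArg (Units.map (sres X (show
        (L.U p.1 ⊓ M.U p.2) ⊓ (L.U q.1 ⊓ M.U q.2) ⊓ (L.U r.1 ⊓ M.U r.2) ≤
          L.U p.1 ⊓ L.U q.1 ⊓ L.U r.1 from
        le_inf (le_inf (inf_le_left.trans (inf_le_left.trans inf_le_left))
          (inf_le_left.trans (inf_le_right.trans inf_le_left)))
          (inf_le_right.trans inf_le_left))).toMonoidHom) (L.cocycle p.1 q.1 r.1)
    have hM := congrArg (Units.map (sres X (show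
        (L.U p.1 ⊓ M.U p.2) ⊓ (L.U q.1 ⊓ M.U q.2) ⊓ (L.U r.1 ⊓ M.U r.2) ≤
          M.U p.2 ⊓ M.U q.2 ⊓ M.U r.2 from
        le_inf (le_inf (inf_le_left.trans (inf_le_left.trans inf_le_right))
          (inf_le_left.trans (inf_le_right.trans inf_le_right)))
          (inf_le_right.trans inf_le_right))).toMonoidHom) (M.cocycle p.2 q.2 r.2)
    simp only [map_mul, unit_sres_sres] at hL hM
    rw [mul_mul_mul_comm, hL, hM]

lemma preimage_mono (f : X ⟶ Y) {U U' : Y.Opens} (h : U ≤ U') : f ⁻¹ᵁ U ≤ f ⁻¹ᵁ U' :=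
  fun _ hx => h hx

lemma unit_sres_appLE (f : X ⟶ Y) {U : Y.Opens} {V V' : X.Opens} (e : V ≤ f ⁻¹ᵁ U)
    (h : V' ≤ V) (u : (Γ(Y, U))ˣ) :
    Units.map (sres X h).toMonoidHom (Units.map (f.appLE U V e).hom.toMonoidHom u)
      = Units.map (f.appLE U V' (h.trans e)).hom.toMonoidHom u := by
  ext
  show sres X h (f.appLE U V e u) = f.appLE U V' (h.trans e) u
  rw [show f.appLE U V' (h.trans e)
      = f.appLE U V e ≫ X.presheaf.map (homOfLE h).op from (f.appLE_map e (homOfLE h).op).symm]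
  rfl

lemma unit_appLE_sres (f : X ⟶ Y) {U U' : Y.Opens} {V : X.Opens} (e : V ≤ f ⁻¹ᵁ U)
    (h : U ≤ U') (u : (Γ(Y, U'))ˣ) :
    Units.map (f.appLE U V e).hom.toMonoidHom (Units.map (sres Y h).toMonoidHom u)
      = Units.map (f.appLE U' V (e.trans (preimage_mono f h))).hom.toMonoidHom u := by
  ext
  show f.appLE U V e (sres Y h u) = f.appLE U' V _ u
  rw [show f.appLE U' V (e.trans (preimage_mono f h))
      = Y.presheaf.map (homOfLE h).op ≫ f.appLE U V e from (f.map_appLE e (homOfLE h).op).symm]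
  rfl

lemma preimage_inf (f : X ⟶ Y) (U V : Y.Opens) :
    f ⁻¹ᵁ (U ⊓ V) = f ⁻¹ᵁ U ⊓ f ⁻¹ᵁ V := by
  ext x; simp

set_option maxHeartbeats 1000000 in
/-- The pullback of a line bundle along a morphism of schemes. -/
def pullbackLB (f : X ⟶ Y) (L : LineBundle Y) : LineBundle X where
  ι := L.ι
  U i := f ⁻¹ᵁ L.U i
  covers := by
    have : (⨆ i, f ⁻¹ᵁ L.U i) = f ⁻¹ᵁ (⨆ i, L.U i) := by
      ext x
      simp [TopologicalSpace.Opens.mem_iSup]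
    rw [this, L.covers]
    rfl
  t i j :=
    Units.map (f.appLE (L.U i ⊓ L.U j) (f ⁻¹ᵁ L.U i ⊓ f ⁻¹ᵁ L.U j)
      (preimage_inf f (L.U i) (L.U j)).ge).hom.toMonoidHom (L.t i j)
  cocycle i j l := by
    have key := congrArg (Units.map (f.appLE (L.U i ⊓ L.U j ⊓ L.U l)
        (f ⁻¹ᵁ L.U i ⊓ f ⁻¹ᵁ L.U j ⊓ f ⁻¹ᵁ L.U l)
        (le_of_eq (show f ⁻¹ᵁ L.U i ⊓ f ⁻¹ᵁ L.U j ⊓ f ⁻¹ᵁ L.U l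
            = f ⁻¹ᵁ (L.U i ⊓ L.U j ⊓ L.U l) by
          rw [preimage_inf, preimage_inf]))).hom.toMonoidHom)
      (L.cocycle i j l)
    rw [map_mul] at key
    rw [unit_sres_appLE, unit_sres_appLE, unit_sres_appLE]
    rw [unit_appLE_sres, unit_appLE_sres, unit_appLE_sres] at key
    exact key

/-- A global section of a line bundle: compatible local sections with respect to the
transition cocycle. -/
@[ext]
structure GlobalSec {X : Scheme.{u}} (L : LineBundle X) where
  s : ∀ i, Γ(X, L.U i)
  compat : ∀ i j, sres X (inf_le_left : L.U i ⊓ L.U j ≤ L.U i) (s i)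
    = (L.t i j : Γ(X, L.U i ⊓ L.U j)) * sres X inf_le_right (s j)

/-- The open locus where a global section of a line bundle does not vanish. -/
def GlobalSec.locus {X : Scheme.{u}} {L : LineBundle X} (σ : GlobalSec L) : X.Opens :=
  ⨆ i, X.basicOpen (σ.s i)

/-- A line bundle `L` on a scheme `X` is ample if `X` is quasi-compact and every point has
an affine neighbourhood of the form `X_s` for a global section `s` of some positive tensor
power of `L`. -/
def IsAmple {X : Scheme.{u}} (L : LineBundle X) : Prop :=
  CompactSpace X ∧ ∀ x : X, ∃ (m : ℕ) (_ : 0 < m) (σ : GlobalSec (L.pow m)),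
    x ∈ σ.locus ∧ IsAffineOpen σ.locus

/-- Two line bundles are isomorphic iff on a common refinement of their trivialising covers
their transition cocycles differ by a coboundary. -/
def EquivLB {X : Scheme.{u}} (L M : LineBundle X) : Prop :=
  ∃ (κ : Type u) (V : κ → X.Opens) (_ : iSup V = ⊤) (a : κ → L.ι) (b : κ → M.ι)
    (ha : ∀ c, V c ≤ L.U (a c)) (hb : ∀ c, V c ≤ M.U (b c)) (s : ∀ c, (Γ(X, V c))ˣ),
    ∀ c c' : κ,
      Units.map (sres X (le_inf ((inf_le_left.trans (ha c)))
          (inf_le_right.trans (ha c')) : V c ⊓ V c' ≤ L.U (a c) ⊓ L.U (a c'))).toMonoidHom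
          (L.t (a c) (a c'))
        * Units.map (sres X (inf_le_right : V c ⊓ V c' ≤ V c')).toMonoidHom (s c')
      = Units.map (sres X (inf_le_left : V c ⊓ V c' ≤ V c)).toMonoidHom (s c)
        * Units.map (sres X (le_inf ((inf_le_left.trans (hb c)))
            (inf_le_right.trans (hb c')))).toMonoidHom (M.t (b c) (b c'))

/-- The canonical algebra map `k → Γ(X, U)` for a scheme `X` over `Spec k`. -/
def toSections {k : Type u} [Field k] {X : Scheme.{u}} (sX : X ⟶ Spec (CommRingCat.of k))
    (U : X.Opens) : k →+* Γ(X, U) :=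
  ((sres X (le_top : U ≤ ⊤)).comp
    ((sX.appTop.hom : Γ(Spec (CommRingCat.of k), ⊤) →+* Γ(X, ⊤)))).comp
    ((Scheme.ΓSpecIso (CommRingCat.of k)).inv : CommRingCat.of k ⟶ _).hom

lemma sres_toSections {k : Type u} [Field k] {X : Scheme.{u}}
    (sX : X ⟶ Spec (CommRingCat.of k)) {V U : X.Opens} (h : V ≤ U) (c : k) :
    sres X h (toSections sX U c) = toSections sX V c := by
  simp only [toSections, RingHom.comp_apply, sres_sres]

/-- The space of global sections of a line bundle on a scheme over `k`, as a `k`-submodule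
of the product of the local section spaces. -/
def secSubmodule {k : Type u} [Field k] {X : Scheme.{u}} (sX : X ⟶ Spec (CommRingCat.of k))
    (L : LineBundle X) :
    letI : ∀ i, Module k Γ(X, L.U i) := fun i => (toSections sX (L.U i)).toModule
    Submodule k (∀ i, Γ(X, L.U i)) :=
  letI : ∀ i, Module k Γ(X, L.U i) := fun i => (toSections sX (L.U i)).toModule
  { carrier := {s | ∀ i j, sres X (inf_le_left : L.U i ⊓ L.U j ≤ L.U i) (s i)
      = (L.t i j : Γ(X, L.U i ⊓ L.U j)) * sres X inf_le_right (s j)}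
    add_mem' := by
      intro s r hs hr i j
      simp only [Pi.add_apply, map_add, hs i j, hr i j, mul_add]
    zero_mem' := by
      intro i j
      simp
    smul_mem' := by
      intro c s hs i j
      show sres X _ (toSections sX (L.U i) c * s i)
        = (L.t i j : Γ(X, L.U i ⊓ L.U j)) * sres X _ (toSections sX (L.U j) c * s j)
      rw [map_mul, map_mul, hs i j, sres_toSections, sres_toSections]
      ring }

/-- The dimension `h⁰(X, L)` of the space of global sections of a line bundle on a scheme
over a field `k`. -/
def h0 {k : Type u} [Field k] {X : Scheme.{u}} (sX : X ⟶ Spec (CommRingCat.of k))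
    (L : LineBundle X) : ℕ :=
  letI : ∀ i, Module k Γ(X, L.U i) := fun i => (toSections sX (L.U i)).toModule
  Module.finrank k (secSubmodule sX L)

lemma sres_appLE (f : X ⟶ Y) {U : Y.Opens} {V V' : X.Opens} (e : V ≤ f ⁻¹ᵁ U)
    (h : V' ≤ V) (a : Γ(Y, U)) :
    sres X h (f.appLE U V e a) = f.appLE U V' (h.trans e) a := by
  rw [show f.appLE U V' (h.trans e)
      = f.appLE U V e ≫ X.presheaf.map (homOfLE h).op from (f.appLE_map e (homOfLE h).op).symm]
  rfl

lemma appLE_sres (f : X ⟶ Y) {U U' : Y.Opens} {V : X.Opens} (e : V ≤ f ⁻¹ᵁ U)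
    (h : U ≤ U') (a : Γ(Y, U')) :
    f.appLE U V e (sres Y h a) = f.appLE U' V (e.trans (preimage_mono f h)) a := by
  rw [show f.appLE U' V (e.trans (preimage_mono f h))
      = Y.presheaf.map (homOfLE h).op ≫ f.appLE U V e from (f.map_appLE e (homOfLE h).op).symm]
  rfl

/-- Pullback of global sections of a line bundle. -/
def pullbackSec (f : X ⟶ Y) (L : LineBundle Y) (σ : GlobalSec L) :
    GlobalSec (pullbackLB f L) where
  s i := f.app (L.U i) (σ.s i)
  compat i j := by
    have key := congrArg (f.appLE (L.U i ⊓ L.U j)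
      (f ⁻¹ᵁ L.U i ⊓ f ⁻¹ᵁ L.U j) (preimage_inf f (L.U i) (L.U j)).ge) (σ.compat i j)
    rw [map_mul, appLE_sres, appLE_sres] at key
    exact key

end LineBundle

attribute [local instance] MvPolynomial.gradedAlgebra

/-- Projective `N`-space over `k`, as the `Proj` of the polynomial ring in `N + 1`
variables with its standard grading. -/
def ProjSpace (k : Type u) [Field k] (N : ℕ) : Scheme.{u} :=
  Proj (MvPolynomial.homogeneousSubmodule (Fin (N + 1)) k)

/-- The inclusion of `k` into the degree-zero part of the polynomial ring. -/
def degreeZeroInclusion (k : Type u) [Field k] (N : ℕ) :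
    k →+* (MvPolynomial.homogeneousSubmodule (Fin (N + 1)) k 0) where
  toFun c := ⟨MvPolynomial.C c, by
    simp [MvPolynomial.mem_homogeneousSubmodule, MvPolynomial.isHomogeneous_C]⟩
  map_one' := by ext; simp
  map_mul' x y := by ext; simp
  map_zero' := by ext; simp
  map_add' x y := by ext; simp

/-- The structure morphism of projective space over `k`. -/
def ProjSpace.str (k : Type u) [Field k] (N : ℕ) :
    ProjSpace k N ⟶ Spec (CommRingCat.of k) :=
  Proj.toSpecZero _ ≫ Spec.map (CommRingCat.ofHom (degreeZeroInclusion k N))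

/-- A scheme over `k` is a projective variety if it is integral and admits a closed
immersion into some projective space over `k`, compatibly with the structure morphisms. -/
def IsProjectiveVariety {k : Type u} [Field k] {X : Scheme.{u}}
    (sX : X ⟶ Spec (CommRingCat.of k)) : Prop :=
  IsIntegral X ∧ ∃ (N : ℕ) (ι : X ⟶ ProjSpace k N),
    IsClosedImmersion ι ∧ ι ≫ ProjSpace.str k N = sX
set_option maxHeartbeats 2000000 in
open LineBundle in
/-- `ω` is a canonical line bundle on the `g`-dimensional smooth variety `X` over `k`:
on its trivialising cover the module of Kähler differentials is free of rank `g`, and the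
transition cocycle of `ω` is given by the determinants of the base-change matrices of the
corresponding bases of differentials, i.e. `ω ≅ det Ω¹_{X/k}`. -/
def IsCanonicalBundle {k : Type u} [Field k] {X : Scheme.{u}}
    (sX : X ⟶ Spec (CommRingCat.of k)) (g : ℕ) (ω : LineBundle X) : Prop :=
  letI : ∀ U : X.Opens, Algebra k Γ(X, U) := fun U => (toSections sX U).toAlgebra
  ∃ e : ∀ i : ω.ι, Module.Basis (Fin g) Γ(X, ω.U i) (Ω[Γ(X, ω.U i)⁄k]),
    ∀ i j : ω.ι,
      letI : Algebra Γ(X, ω.U i) Γ(X, ω.U i ⊓ ω.U j) :=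
        (sres X (inf_le_left : ω.U i ⊓ ω.U j ≤ ω.U i)).toAlgebra
      letI : Algebra Γ(X, ω.U j) Γ(X, ω.U i ⊓ ω.U j) :=
        (sres X (inf_le_right : ω.U i ⊓ ω.U j ≤ ω.U j)).toAlgebra
      haveI : IsScalarTower k Γ(X, ω.U i) Γ(X, ω.U i ⊓ ω.U j) :=
        IsScalarTower.of_algebraMap_eq fun c => (sres_toSections sX _ c).symm
      haveI : IsScalarTower k Γ(X, ω.U j) Γ(X, ω.U i ⊓ ω.U j) :=
        IsScalarTower.of_algebraMap_eq fun c => (sres_toSections sX _ c).symm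
      haveI : SMulCommClass k Γ(X, ω.U i) Γ(X, ω.U i ⊓ ω.U j) :=
        ⟨fun c a b => by
          simp only [Algebra.smul_def, ← mul_assoc, mul_comm]⟩
      haveI : SMulCommClass k Γ(X, ω.U j) Γ(X, ω.U i ⊓ ω.U j) :=
        ⟨fun c a b => by
          simp only [Algebra.smul_def, ← mul_assoc, mul_comm]⟩
      ∃ M : Matrix (Fin g) (Fin g) Γ(X, ω.U i ⊓ ω.U j),
        (∀ a : Fin g,
          KaehlerDifferential.map k k Γ(X, ω.U j) Γ(X, ω.U i ⊓ ω.U j) (e j a)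
            = ∑ b : Fin g, M a b •
              KaehlerDifferential.map k k Γ(X, ω.U i) Γ(X, ω.U i ⊓ ω.U j) (e i b)) ∧
        (ω.t i j : Γ(X, ω.U i ⊓ ω.U j)) = M.det

/-- A self-map of an integral scheme is separable if it fixes the generic point and the
induced extension of function fields is separable. -/
def IsSeparableSelfMap {X : Scheme.{u}} [IsIntegral X] (φ : X ⟶ X) : Prop :=
  ∃ h : φ.base (genericPoint X) = genericPoint X,
    letI E : X.functionField ⟶ X.functionField :=
      (X.presheaf.stalkCongr (Inseparable.of_eq h.symm)).hom ≫ φ.stalkMap (genericPoint X)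
    letI : Algebra X.functionField X.functionField := (E.hom : _ →+* _).toAlgebra
    Algebra.IsSeparable X.functionField X.functionField

/-- A scheme `Y` has finite algebraic (étale) fundamental group iff the degrees of its
connected finite étale covers are bounded. -/
def HasFiniteAlgebraicPi1 (Y : Scheme.{u}) : Prop :=
  ∃ n : ℕ, ∀ (Z : Scheme.{u}) (p : Z ⟶ Y), IsFinite p → IsEtale p → ConnectedSpace Z →
    ∀ y : Y, (p.base ⁻¹' {y}).ncard ≤ n

set_option linter.style.haveILetI false

section Proof

open LineBundle
open scoped TensorProduct

/-- An integral element divides its norm inside the algebra it generates. -/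
lemma exists_norm_eq_mul {R K F : Type*} [CommRing R] [IsDomain R] [IsIntegrallyClosed R]
    [Field K] [Field F] [Algebra R K] [IsFractionRing R K] [Algebra K F] [Algebra R F]
    [IsScalarTower R K F] [FiniteDimensional K F] {f : F} (hf : IsIntegral R f) :
    ∃ n : R, algebraMap R K n = Algebra.norm K f ∧
      ∃ g ∈ Algebra.adjoin R {f}, algebraMap R F n = f * g := by
  have hmin := minpoly.isIntegrallyClosed_eq_field_fractions' K hf
  have hfK : IsIntegral K f := hf.tower_top
  have hN : Algebra.norm K f = algebraMap R K
      (((-1) ^ (minpoly K f).natDegree * (minpoly R f).coeff 0) ^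
        Module.finrank (IntermediateField.adjoin K {f}) F) := by
    rw [Algebra.norm_eq_norm_adjoin]
    have := Algebra.PowerBasis.norm_gen_eq_coeff_zero_minpoly
      (IntermediateField.adjoin.powerBasis hfK)
    rw [IntermediateField.adjoin.powerBasis_gen] at this
    rw [this, IntermediateField.minpoly_gen, IntermediateField.adjoin.powerBasis_dim]
    have hc : (minpoly K f).coeff 0 = algebraMap R K ((minpoly R f).coeff 0) := by
      rw [hmin, Polynomial.coeff_map]
    rw [hc]
    simp
  refine ⟨_, hN.symm, ?_⟩
  obtain ⟨m, hm⟩ : ∃ m, Module.finrank (IntermediateField.adjoin K {f}) F = m + 1 :=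
    Nat.exists_eq_succ_of_ne_zero Module.finrank_pos.ne'
  rw [hm]
  have h0 : algebraMap R F ((minpoly R f).coeff 0)
      = f * (- Polynomial.aeval f (minpoly R f).divX) := by
    have h1 := minpoly.aeval R f
    rw [← Polynomial.divX_mul_X_add (minpoly R f)] at h1
    simp only [map_add, map_mul, Polynomial.aeval_X, Polynomial.aeval_C] at h1
    linear_combination h1
  refine ⟨(- Polynomial.aeval f (minpoly R f).divX) *
    algebraMap R F ((-1) ^ (minpoly K f).natDegree *
      ((-1) ^ (minpoly K f).natDegree * (minpoly R f).coeff 0) ^ m), ?_, ?_⟩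
  · exact mul_mem (neg_mem (Polynomial.aeval_mem_adjoin_singleton R f))
      (Subalgebra.algebraMap_mem _ _)
  · rw [pow_succ, map_mul, map_mul (algebraMap R F) _ (_ ^ m), map_mul (algebraMap R F) (_ ^ _) _,
      h0]
    ring

lemma Polynomial.exists_map_eq_of_eval_mem_range {k K : Type*} [Field k] [Infinite k] [Field K]
    [Algebra k K] (p : Polynomial K)
    (hp : ∀ c : k, p.eval (algebraMap k K c) ∈ (algebraMap k K).range) :
    ∃ q : Polynomial k, q.map (algebraMap k K) = p := by
  classical
  choose r hr using hp
  obtain ⟨s, hs⟩ := Infinite.exists_subset_card_eq k (p.natDegree + 1)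
  refine ⟨Lagrange.interpolate s id r, ?_⟩
  have hinj : Function.Injective (algebraMap k K) := (algebraMap k K).injective
  refine Polynomial.eq_of_degrees_lt_of_eval_index_eq s (v := fun c => algebraMap k K c)
    (fun a _ b _ h => hinj h) ?_ ?_ ?_
  · rw [Polynomial.degree_map]
    exact Lagrange.degree_interpolate_lt r (Function.injective_id.injOn)
  · rw [hs]
    exact lt_of_le_of_lt Polynomial.degree_le_natDegree (by exact_mod_cast Nat.lt_succ_self _)
  · intro c hc
    rw [Polynomial.eval_map, Polynomial.eval₂_at_apply]
    have := Lagrange.eval_interpolate_at_node r (v := id) Function.injective_id.injOn hc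
    simp only [id] at this
    rw [this, hr]

/-- If translates of `u` by constants all have constant norm, then `u` is algebraic over
the constants. -/
lemma isAlgebraic_of_norm_mem_range {k K F : Type*} [Field k] [Infinite k] [Field K] [Field F]
    [Algebra k K] [Algebra K F] [Algebra k F] [IsScalarTower k K F] [FiniteDimensional K F]
    (u : F) (hu : ∀ c : k, Algebra.norm K (u + algebraMap k F c) ∈ (algebraMap k K).range) :
    IsAlgebraic k u := by
  have key : ∀ c : k, (Algebra.lmul K F (-u)).charpoly.eval (algebraMap k K c)
      = Algebra.norm K (u + algebraMap k F c) := by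
    intro c
    rw [LinearMap.eval_charpoly, Algebra.norm_apply]
    congr 1
    ext x
    simp [Algebra.smul_def, IsScalarTower.algebraMap_apply k K F]
    ring
  obtain ⟨q, hq⟩ := Polynomial.exists_map_eq_of_eval_mem_range (k := k)
    (Algebra.lmul K F (-u)).charpoly (fun c => by rw [key]; exact hu c)
  have hu0 : Polynomial.aeval (-u) (Algebra.lmul K F (-u)).charpoly = 0 := by
    have := LinearMap.aeval_self_charpoly (Algebra.lmul K F (-u))
    rw [Polynomial.aeval_algHom_apply] at this
    have h2 := congrArg (fun g => g 1) this
    simpa using h2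
  rw [← hq, Polynomial.aeval_map_algebraMap] at hu0
  have : IsAlgebraic k (-u) := ⟨q, ?_, hu0⟩
  · simpa using this.neg
  · rintro rfl
    simp only [Polynomial.map_zero] at hq
    exact (LinearMap.charpoly_monic _).ne_zero hq.symm

lemma MvPolynomial.totalDegree_pow_eq {σ k : Type*} [Field k] (p : MvPolynomial σ k) (n : ℕ) :
    (p ^ n).totalDegree = n * p.totalDegree := by
  by_cases hp : p = 0
  · cases n <;> simp [hp]
  · induction n with
    | zero => simp
    | succ n ih =>
      rw [pow_succ, MvPolynomial.totalDegree_mul_of_isDomain (pow_ne_zero _ hp) hp, ih]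
      ring

/-- An `M`-th power which is a quotient of two polynomials of degree `< M` is an
`M`-th power of a constant. -/
lemma mem_range_of_pow_mul_eq {σ k K : Type*} [Field k] [Field K]
    [Algebra (MvPolynomial σ k) K] [IsFractionRing (MvPolynomial σ k) K] [Algebra k K]
    [IsScalarTower k (MvPolynomial σ k) K]
    {M : ℕ} {P Q : MvPolynomial σ k} (hQ : Q ≠ 0) (hPM : P.totalDegree < M)
    (hQM : Q.totalDegree < M) (y : K)
    (h : algebraMap _ K P = algebraMap _ K Q * y ^ M) : y ∈ (algebraMap k K).range := by
  have hinj : Function.Injective (algebraMap (MvPolynomial σ k) K) :=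
    IsFractionRing.injective _ _
  obtain ⟨a, b, hab, hy⟩ := IsFractionRing.exists_reduced_fraction (A := MvPolynomial σ k) y
  have hb0 : (b : MvPolynomial σ k) ≠ 0 := nonZeroDivisors.ne_zero b.2
  have hbK : algebraMap _ K (b : MvPolynomial σ k) ≠ 0 :=
    (map_ne_zero_iff _ hinj).2 hb0
  have hya : y * algebraMap _ K (b : MvPolynomial σ k) = algebraMap _ K a := by
    rw [← hy, IsLocalization.mk'_spec]
  have e1 : P * (b : MvPolynomial σ k) ^ M = Q * a ^ M := by
    apply hinj
    rw [map_mul, map_mul, map_pow, map_pow, h, ← hya]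
    ring
  have hcop : IsRelPrime (a ^ M) ((b : MvPolynomial σ k) ^ M) := hab.pow
  have hdeg : ∀ {p q : MvPolynomial σ k}, q ≠ 0 → q.totalDegree < M → p ^ M ∣ q →
      p.totalDegree = 0 := by
    rintro p q hq hqM ⟨r, rfl⟩
    have hr : r ≠ 0 := right_ne_zero_of_mul hq
    have hp : p ^ M ≠ 0 := left_ne_zero_of_mul hq
    rw [MvPolynomial.totalDegree_mul_of_isDomain hp hr, MvPolynomial.totalDegree_pow_eq] at hqM
    by_contra h0
    have : M * 1 ≤ M * p.totalDegree := Nat.mul_le_mul_left _ (Nat.pos_of_ne_zero h0)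
    omega
  have hbQ : (b : MvPolynomial σ k) ^ M ∣ Q :=
    hcop.symm.dvd_of_dvd_mul_right ⟨P, by rw [← e1]; ring⟩
  have hb := hdeg hQ hQM hbQ
  have hb' := MvPolynomial.totalDegree_eq_zero_iff_eq_C.1 hb
  have ha' : ∃ c : k, a = MvPolynomial.C c := by
    by_cases hP : P = 0
    · have hM : M ≠ 0 := by omega
      have : a ^ M = 0 := by
        rcases mul_eq_zero.1 (e1.symm.trans (by rw [hP, zero_mul])) with h | h
        · exact absurd h hQ
        · exact h
      exact ⟨0, by simpa using (pow_eq_zero_iff hM).1 this⟩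
    · have haP : a ^ M ∣ P := hcop.dvd_of_dvd_mul_right ⟨Q, by rw [e1]; ring⟩
      exact ⟨_, MvPolynomial.totalDegree_eq_zero_iff_eq_C.1 (hdeg hP hPM haP)⟩
  obtain ⟨ca, hca⟩ := ha'
  refine ⟨ca / MvPolynomial.coeff 0 (b : MvPolynomial σ k), ?_⟩
  rw [map_div₀, eq_comm, eq_div_iff]
  · rw [IsScalarTower.algebraMap_apply k (MvPolynomial σ k) K,
      IsScalarTower.algebraMap_apply k (MvPolynomial σ k) K, MvPolynomial.algebraMap_eq, ← hb',
      ← hca, hya]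
  · rw [IsScalarTower.algebraMap_apply k (MvPolynomial σ k) K, MvPolynomial.algebraMap_eq, ← hb']
    exact hbK

/-- Affine coordinates `T_j / T_i` (`j ≠ i`) attached to homogeneous coordinates `T`. -/
def affCoord {e : ℕ} {K : Type*} [Field K] (T : Fin (e + 1) → K) (i : Fin (e + 1)) : Fin e → K :=
  fun j => T (i.succAbove j) / T i

/-- Homogeneous coordinates generating a purely transcendental extension. -/
structure IsProjGen {e : ℕ} (k : Type*) {K : Type*} [Field k] [Field K] [Algebra k K]
    (T : Fin (e + 1) → K) : Prop where
  ne_zero : ∀ i, T i ≠ 0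
  indep : ∀ i, AlgebraicIndependent k (affCoord T i)
  gen : IntermediateField.adjoin k (Set.range (affCoord T 0)) = ⊤

namespace IsProjGen

variable {e : ℕ} {k K : Type*} [Field k] [Field K] [Algebra k K] {T : Fin (e + 1) → K}

lemma gen' (h : IsProjGen k T) (i : Fin (e + 1)) :
    IntermediateField.adjoin k (Set.range (affCoord T i)) = ⊤ := by
  rw [eq_top_iff, ← h.gen, IntermediateField.adjoin_le_iff]
  have hmem : ∀ j, T j / T i ∈ IntermediateField.adjoin k (Set.range (affCoord T i)) := by
    intro j
    by_cases hj : j = i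
    · subst hj
      rw [div_self (h.ne_zero j)]
      exact one_mem _
    · obtain ⟨j', rfl⟩ := Fin.exists_succAbove_eq hj
      exact IntermediateField.subset_adjoin _ _ ⟨j', rfl⟩
  rintro _ ⟨j, rfl⟩
  have : affCoord T 0 j = (T ((0 : Fin (e + 1)).succAbove j) / T i) / (T 0 / T i) := by
    rw [affCoord, div_div_div_cancel_right₀ (h.ne_zero i)]
  rw [this]
  exact div_mem (hmem _) (hmem _)

lemma isFractionRing (h : IsProjGen k T) (i : Fin (e + 1)) :
    letI : Algebra (MvPolynomial (Fin e) k) K :=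
      (MvPolynomial.aeval (affCoord T i)).toRingHom.toAlgebra
    IsFractionRing (MvPolynomial (Fin e) k) K := by
  letI : Algebra (MvPolynomial (Fin e) k) K :=
      (MvPolynomial.aeval (affCoord T i)).toRingHom.toAlgebra
  have hinj : Function.Injective (algebraMap (MvPolynomial (Fin e) k) K) := h.indep i
  have : FaithfulSMul (MvPolynomial (Fin e) k) K :=
    (faithfulSMul_iff_algebraMap_injective _ _).2 hinj
  refine IsFractionRing.of_field _ _ fun z => ?_
  have hz : z ∈ IntermediateField.adjoin k (Set.range (affCoord T i)) := by
    rw [h.gen' i]; trivial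
  obtain ⟨a, b, hab⟩ := (IntermediateField.mem_adjoin_range_iff k _ z).1 hz
  exact ⟨a, b, hab⟩

lemma exists_mul_pow_eq (h : IsProjGen k T) (i : Fin (e + 1)) (q : MvPolynomial (Fin e) k) :
    ∃ (m : ℕ) (q' : MvPolynomial (Fin e) k), q'.totalDegree ≤ m ∧
      MvPolynomial.aeval (affCoord T i) q * (T i / T 0) ^ m =
        MvPolynomial.aeval (affCoord T 0) q' := by
  have hcoord : ∀ j, ∃ p : MvPolynomial (Fin e) k, p.totalDegree ≤ 1 ∧
      MvPolynomial.aeval (affCoord T 0) p = T j / T 0 := by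
    intro j
    by_cases hj : j = 0
    · subst hj
      exact ⟨1, by simp, by simp [div_self (h.ne_zero 0)]⟩
    · obtain ⟨j', rfl⟩ := Fin.exists_succAbove_eq hj
      exact ⟨MvPolynomial.X j', by simp, by simp [affCoord]⟩
  obtain ⟨pi, hpi, hpi'⟩ := hcoord i
  induction q using MvPolynomial.induction_on with
  | C a => exact ⟨0, MvPolynomial.C a, by simp, by simp⟩
  | add p q hp hq =>
    obtain ⟨m, p', hm, hp'⟩ := hp
    obtain ⟨n, q', hn, hq'⟩ := hq
    refine ⟨m + n, p' * pi ^ n + q' * pi ^ m, ?_, ?_⟩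
    · refine (MvPolynomial.totalDegree_add _ _).trans (max_le ?_ ?_)
      · refine (MvPolynomial.totalDegree_mul _ _).trans (add_le_add hm ?_)
        refine (MvPolynomial.totalDegree_pow _ _).trans ?_
        exact (Nat.mul_le_mul_left n hpi).trans (mul_one n).le
      · rw [add_comm m n]
        refine (MvPolynomial.totalDegree_mul _ _).trans (add_le_add hn ?_)
        refine (MvPolynomial.totalDegree_pow _ _).trans ?_
        exact (Nat.mul_le_mul_left m hpi).trans (mul_one m).le
    · simp only [map_add, map_mul, map_pow, ← hp', ← hq', hpi']
      ring
  | mul_X p j hp =>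
    obtain ⟨m, p', hm, hp'⟩ := hp
    obtain ⟨pj, hpj, hpj'⟩ := hcoord (i.succAbove j)
    refine ⟨m + 1, p' * pj, (MvPolynomial.totalDegree_mul _ _).trans (add_le_add hm hpj), ?_⟩
    have := h.ne_zero i
    have := h.ne_zero 0
    simp only [map_mul, ← hp', hpj', MvPolynomial.aeval_X, affCoord, pow_succ]
    field_simp

lemma totalDegree_le (h : IsProjGen k T) {B : ℕ} (P : MvPolynomial (Fin e) k)
    (hP : ∀ i, ∃ q : MvPolynomial (Fin e) k, MvPolynomial.aeval (affCoord T 0) P *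
      (T 0 / T i) ^ B = MvPolynomial.aeval (affCoord T i) q) : P.totalDegree ≤ B := by
  by_cases hP0 : P = 0
  · simp [hP0]
  rcases Nat.eq_zero_or_pos e with rfl | he
  · rw [MvPolynomial.eq_C_of_isEmpty P]
    simp
  obtain ⟨q, hq⟩ := hP ((0 : Fin (e + 1)).succAbove ⟨0, he⟩)
  obtain ⟨m, q', hm, hq'⟩ := h.exists_mul_pow_eq ((0 : Fin (e + 1)).succAbove ⟨0, he⟩) q
  have hi := h.ne_zero ((0 : Fin (e + 1)).succAbove ⟨0, he⟩)
  have h0 := h.ne_zero 0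
  have e1 : P * MvPolynomial.X ⟨0, he⟩ ^ m = MvPolynomial.X ⟨0, he⟩ ^ B * q' := by
    apply h.indep 0
    simp only [map_mul, map_pow, MvPolynomial.aeval_X, ← hq', ← hq]
    simp only [affCoord]
    generalize MvPolynomial.aeval (affCoord T 0) P = y
    rw [mul_comm, ← mul_assoc, mul_comm (_ ^ B) (_ * _), mul_assoc y, ← mul_pow,
      div_mul_div_cancel₀ hi, div_self h0, one_pow, mul_one, mul_comm]
  have e2 := congrArg MvPolynomial.totalDegree e1
  have hX : ∀ n, (MvPolynomial.X ⟨0, he⟩ : MvPolynomial (Fin e) k) ^ n ≠ 0 :=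
    fun n => pow_ne_zero _ (MvPolynomial.X_ne_zero _)
  rw [MvPolynomial.totalDegree_mul_of_isDomain hP0 (hX _)] at e2
  have e3 := MvPolynomial.totalDegree_mul (MvPolynomial.X ⟨0, he⟩ ^ B) q'
  simp only [MvPolynomial.totalDegree_pow_eq, MvPolynomial.totalDegree_X, mul_one] at e2 e3
  omega

end IsProjGen

lemma IsIntegral.of_range {R S F : Type*} [CommRing R] [CommRing F] [Algebra R F] [CommRing S]
    [Algebra S F] (hS : (algebraMap S F).range ≤ (algebraMap R F).range) {f : F}
    (hf : IsIntegral S f) : IsIntegral R f := by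
  obtain ⟨p, hp, hpf⟩ := hf
  have hl : p.map (algebraMap S F) ∈ Polynomial.lifts (algebraMap R F) := by
    rw [Polynomial.lifts_iff_coeff_lifts]
    intro n
    rw [Polynomial.coeff_map]
    exact hS ⟨_, rfl⟩
  obtain ⟨q, hq, -, hqm⟩ := Polynomial.lifts_and_natDegree_eq_and_monic hl (hp.map _)
  refine ⟨q, hqm, ?_⟩
  rw [← Polynomial.eval_map, hq, Polynomial.eval_map]
  exact hpf

lemma IsProjGen.exists_norm_eq {e : ℕ} {k K F : Type*} [Field k] [Field K] [Field F] [Algebra k K]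
    [Algebra K F] [Algebra k F] [IsScalarTower k K F] [FiniteDimensional K F]
    {T : Fin (e + 1) → K} (hT : IsProjGen k T) {s : Fin (e + 1) → F} (hs : s 0 ≠ 0)
    (hsT : ∀ i, s i = s 0 * algebraMap K F (T i / T 0)) (f : F) (l : ℕ)
    (hf : ∀ i, IsIntegral (Algebra.adjoin k (Set.range fun j => s j / s i)) (f / s i ^ l)) :
    ∃ P : MvPolynomial (Fin e) k, P.totalDegree ≤ l * Module.finrank K F ∧
      MvPolynomial.aeval (affCoord T 0) P = Algebra.norm K (f / s 0 ^ l) ∧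
      ∀ i, ∃ g ∈ Algebra.adjoin k (Set.range (fun j => s j / s i) ∪ {f / s i ^ l}),
        algebraMap K F (MvPolynomial.aeval (affCoord T 0) P) *
          (s 0 / s i) ^ (l * Module.finrank K F) = f / s i ^ l * g := by
  have hs0 : ∀ i, s i ≠ 0 := by
    intro i
    rw [hsT i]
    exact mul_ne_zero hs ((map_ne_zero _).2 (div_ne_zero (hT.ne_zero i) (hT.ne_zero 0)))
  have hT0 := hT.ne_zero
  have hcoord : ∀ i j, s j / s i = algebraMap K F (T j / T i) := by
    intro i j
    rw [hsT i, hsT j, mul_div_mul_left _ _ hs, ← map_div₀]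
    congr 1
    have := hT.ne_zero i
    have := hT.ne_zero 0
    field_simp
  have key : ∀ i, ∃ n : MvPolynomial (Fin e) k,
      MvPolynomial.aeval (affCoord T i) n = Algebra.norm K (f / s i ^ l) ∧
      ∃ g ∈ Algebra.adjoin k (Set.range (fun j => s j / s i) ∪ {f / s i ^ l}),
        algebraMap K F (MvPolynomial.aeval (affCoord T i) n) = f / s i ^ l * g := by
    intro i
    letI : Algebra (MvPolynomial (Fin e) k) K :=
      (MvPolynomial.aeval (affCoord T i)).toRingHom.toAlgebra
    haveI := hT.isFractionRing i
    letI : Algebra (MvPolynomial (Fin e) k) F :=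
      ((algebraMap K F).comp (MvPolynomial.aeval (affCoord T i)).toRingHom).toAlgebra
    haveI : IsScalarTower (MvPolynomial (Fin e) k) K F :=
      IsScalarTower.of_algebraMap_eq fun _ => rfl
    haveI : IsScalarTower k (MvPolynomial (Fin e) k) F := IsScalarTower.of_algebraMap_eq fun x => by
      show _ = algebraMap K F (MvPolynomial.aeval (affCoord T i) (algebraMap _ _ x))
      rw [AlgHom.commutes, ← IsScalarTower.algebraMap_apply]
    have hcF : ∀ j, s j / s i ∈ (algebraMap (MvPolynomial (Fin e) k) F).range := by
      intro j
      rw [hcoord]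
      by_cases hj : j = i
      · subst hj
        rw [div_self (hT0 j), map_one]
        exact one_mem _
      · obtain ⟨j', rfl⟩ := Fin.exists_succAbove_eq hj
        refine ⟨MvPolynomial.X j', ?_⟩
        show algebraMap K F (MvPolynomial.aeval (affCoord T i) _) = _
        rw [MvPolynomial.aeval_X]
        rfl
    have hle : (Algebra.adjoin k (Set.range fun j => s j / s i)) ≤
        (Algebra.ofId (MvPolynomial (Fin e) k) F).range.restrictScalars k := by
      rw [Algebra.adjoin_le_iff]
      rintro _ ⟨j, rfl⟩
      exact hcF j
    have hinteg : IsIntegral (MvPolynomial (Fin e) k) (f / s i ^ l) := by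
      refine IsIntegral.of_range ?_ (hf i)
      rintro _ ⟨⟨x, hx⟩, rfl⟩
      exact hle hx
    obtain ⟨n, hn, g, hg, hng⟩ := exists_norm_eq_mul (R := MvPolynomial (Fin e) k) (K := K) hinteg
    refine ⟨n, hn, g, ?_, hng⟩
    have hle2 : ∀ x ∈ Algebra.adjoin (MvPolynomial (Fin e) k) {f / s i ^ l},
        x ∈ Algebra.adjoin k (Set.range (fun j => s j / s i) ∪ {f / s i ^ l}) := by
      intro x hx
      induction hx using Algebra.adjoin_induction with
      | mem x hx => exact Algebra.subset_adjoin (Or.inr hx)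
      | algebraMap r =>
        show algebraMap K F (MvPolynomial.aeval (affCoord T i) r) ∈ _
        induction r using MvPolynomial.induction_on with
        | C a =>
          rw [MvPolynomial.aeval_C, ← IsScalarTower.algebraMap_apply]
          exact Subalgebra.algebraMap_mem _ _
        | add p q hp hq =>
          rw [map_add, map_add]
          exact add_mem hp hq
        | mul_X p j hp =>
          rw [map_mul, map_mul, MvPolynomial.aeval_X]
          refine mul_mem hp ?_
          rw [affCoord, ← hcoord]
          exact Algebra.subset_adjoin (Or.inl ⟨_, rfl⟩)
      | add x y _ _ hx hy => exact add_mem hx hy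
      | mul x y _ _ hx hy => exact mul_mem hx hy
    exact hle2 g hg
  have hN : ∀ i, Algebra.norm K (f / s i ^ l) =
      Algebra.norm K (f / s 0 ^ l) * (T 0 / T i) ^ (l * Module.finrank K F) := by
    intro i
    have : f / s i ^ l = f / s 0 ^ l * algebraMap K F ((T 0 / T i) ^ l) := by
      rw [map_pow, ← hcoord, div_pow, div_mul_div_cancel₀ (pow_ne_zero _ hs)]
    rw [this, map_mul, Algebra.norm_algebraMap, pow_mul]
  obtain ⟨P, hP, -⟩ := key 0
  refine ⟨P, ?_, hP, ?_⟩
  · refine hT.totalDegree_le P fun i => ?_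
    obtain ⟨n, hn, -⟩ := key i
    exact ⟨n, by rw [hn, hP, hN i]⟩
  · intro i
    obtain ⟨n, hn, g, hg, hng⟩ := key i
    refine ⟨g, hg, ?_⟩
    rw [← hng, hn, hN i, hP, map_mul, map_pow, ← hcoord]

lemma IsProjGen.isAlgebraic_ratio {e N : ℕ} {k K F : Type*} [Field k] [Infinite k] [Field K]
    [Field F] [Algebra k K]
    [Algebra K F] [Algebra k F] [IsScalarTower k K F] [FiniteDimensional K F]
    {T : Fin (e + 1) → K} (hT : IsProjGen k T) {s : Fin (e + 1) → F} (hs : s 0 ≠ 0)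
    (hsT : ∀ i, s i = s 0 * algebraMap K F (T i / T 0)) {M : ℕ} (hM : Module.finrank K F < M)
    (γ : Fin N → F) {h : F} (hh : h ≠ 0)
    (hf : ∀ (a : Fin N → k) (i), IsIntegral (Algebra.adjoin k (Set.range fun j => s j / s i))
      (h * (∑ l, algebraMap k F (a l) * γ l) ^ M / s i)) (l j : Fin N) (hj : γ j ≠ 0) :
    IsAlgebraic k (γ l / γ j) := by
  have key : ∀ a : Fin N → k, ∃ P : MvPolynomial (Fin e) k, P.totalDegree < M ∧
      MvPolynomial.aeval (affCoord T 0) P =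
        Algebra.norm K (h * (∑ l, algebraMap k F (a l) * γ l) ^ M / s 0) := by
    intro a
    obtain ⟨P, hP, hP', -⟩ := hT.exists_norm_eq hs hsT
      (h * (∑ l, algebraMap k F (a l) * γ l) ^ M) 1 (by simpa using hf a)
    rw [one_mul] at hP
    rw [pow_one] at hP'
    exact ⟨P, hP.trans_lt hM, hP'⟩
  letI : Algebra (MvPolynomial (Fin e) k) K :=
    (MvPolynomial.aeval (affCoord T 0)).toRingHom.toAlgebra
  haveI := hT.isFractionRing 0
  haveI : IsScalarTower k (MvPolynomial (Fin e) k) K := IsScalarTower.of_algebraMap_eq fun x => by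
    show _ = MvPolynomial.aeval (affCoord T 0) (algebraMap _ _ x)
    rw [AlgHom.commutes]
  obtain ⟨Q, hQ, hQ'⟩ := key (Pi.single j 1)
  have hsum : ∑ l, algebraMap k F ((Pi.single j 1 : Fin N → k) l) * γ l = γ j := by
    rw [Finset.sum_eq_single j]
    · simp
    · intro b _ hb
      simp [Pi.single_eq_of_ne hb]
    · simp
  rw [hsum] at hQ'
  refine isAlgebraic_of_norm_mem_range (K := K) _ fun c => ?_
  obtain ⟨P, hP, hP'⟩ := key (Pi.single l 1 + Pi.single j c)
  have hsum2 : ∑ i, algebraMap k F ((Pi.single l 1 + Pi.single j c : Fin N → k) i) * γ i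
      = γ l + algebraMap k F c * γ j := by
    simp only [Pi.add_apply, map_add, add_mul, Finset.sum_add_distrib]
    congr 1
    · rw [Finset.sum_eq_single l]
      · simp
      · intro b _ hb
        simp [Pi.single_eq_of_ne hb]
      · simp
    · rw [Finset.sum_eq_single j]
      · simp
      · intro b _ hb
        simp [Pi.single_eq_of_ne hb]
      · simp
  rw [hsum2] at hP'
  refine mem_range_of_pow_mul_eq (P := P) (Q := Q) (M := M) ?_ hP hQ _ ?_
  · rintro rfl
    rw [map_zero, eq_comm, Algebra.norm_eq_zero_iff] at hQ'
    exact div_ne_zero (mul_ne_zero hh (pow_ne_zero _ hj)) hs hQ'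
  · show MvPolynomial.aeval (affCoord T 0) P = MvPolynomial.aeval (affCoord T 0) Q * _
    rw [hP', hQ', ← map_pow, ← map_mul]
    congr 1
    have : γ l / γ j + algebraMap k F c = (γ l + algebraMap k F c * γ j) / γ j := by
      rw [add_div, mul_div_cancel_right₀ _ hj]
    rw [this, div_pow, div_mul_eq_mul_div, mul_assoc, mul_div_cancel₀ _ (pow_ne_zero _ hj)]

/-- The localisation homomorphism between stalks attached to a specialisation. -/
abbrev stalkSp {X : Scheme.{u}} {z x : X} (h : z ⤳ x) :
    X.presheaf.stalk x →+* X.presheaf.stalk z :=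
  (X.presheaf.stalkSpecializes h).hom

/-- The germ of a section, as a ring homomorphism. -/
abbrev germHom (X : Scheme.{u}) (U : X.Opens) (x : X) (hx : x ∈ U) :
    Γ(X, U) →+* X.presheaf.stalk x :=
  (X.presheaf.germ U x hx).hom

lemma germHom_sres {X : Scheme.{u}} {U V : X.Opens} (h : V ≤ U) {x : X} (hx : x ∈ V)
    (a : Γ(X, U)) : germHom X V x hx (sres X h a) = germHom X U x (h hx) a :=
  TopCat.Presheaf.germ_res_apply X.presheaf (homOfLE h) x hx a

lemma stalkSp_germHom {X : Scheme.{u}} {U : X.Opens} {z x : X} (h : z ⤳ x) (hx : x ∈ U)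
    (a : Γ(X, U)) : stalkSp h (germHom X U x hx a) = germHom X U z (h.mem_open U.2 hx) a :=
  TopCat.Presheaf.germ_stalkSpecializes_apply X.presheaf hx h a

lemma stalkSp_trans {X : Scheme.{u}} {w z x : X} (h : w ⤳ z) (h' : z ⤳ x)
    (a : X.presheaf.stalk x) : stalkSp h (stalkSp h' a) = stalkSp (h.trans h') a := by
  exact congrArg (fun g => g.hom a) (X.presheaf.stalkSpecializes_comp h h')

lemma stalkMap_germHom {X Y : Scheme.{u}} (f : X ⟶ Y) {U : Y.Opens} {x : X} (hx : f x ∈ U)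
    (a : Γ(Y, U)) : (f.stalkMap x).hom (germHom Y U (f x) hx a)
      = germHom X (f ⁻¹ᵁ U) x hx ((f.app U).hom a) :=
  Scheme.Hom.germ_stalkMap_apply f U x hx a

lemma map_specializes {X Y : Scheme.{u}} (f : X ⟶ Y) {z x : X} (h : z ⤳ x) : f z ⤳ f x :=
  f.base.hom.map_specializes h

lemma stalkMap_stalkSp {X Y : Scheme.{u}} (f : X ⟶ Y) {z x : X} (h : z ⤳ x)
    (a : Y.presheaf.stalk (f x)) : (f.stalkMap z).hom (stalkSp (map_specializes f h) a)
      = stalkSp h ((f.stalkMap x).hom a) :=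
  Scheme.Hom.stalkSpecializes_stalkMap_apply f z x h a

section Constants

variable {k : Type u} [Field k] {X : Scheme.{u}} (sX : X ⟶ Spec (CommRingCat.of k))

/-- Constants in a stalk. -/
def stalkConst (x : X) : k →+* X.presheaf.stalk x :=
  (germHom X ⊤ x (TopologicalSpace.Opens.mem_top x)).comp (toSections sX ⊤)

lemma germHom_toSections (U : X.Opens) (x : X) (hx : x ∈ U) (c : k) :
    germHom X U x hx (toSections sX U c) = stalkConst sX x c := by
  rw [← sres_toSections sX (le_top : U ≤ ⊤) c, germHom_sres]
  rfl

lemma stalkSp_stalkConst {z x : X} (h : z ⤳ x) (c : k) :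
    stalkSp h (stalkConst sX x c) = stalkConst sX z c := by
  rw [stalkConst, RingHom.comp_apply, stalkSp_germHom]
  rfl

lemma toSections_app {Y : Scheme.{u}} (f : Y ⟶ X) (sY : Y ⟶ Spec (CommRingCat.of k))
    (hf : f ≫ sX = sY) (U : X.Opens) (c : k) :
    (f.app U).hom (toSections sX U c) = toSections sY (f ⁻¹ᵁ U) c := by
  subst hf
  simp only [toSections, RingHom.comp_apply]
  have h1 : ∀ a, (f.app U).hom (sres X (le_top : U ≤ ⊤) a) =
      sres Y (le_top : f ⁻¹ᵁ U ≤ ⊤) ((f.app ⊤).hom a) := by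
    intro a
    have := Scheme.Hom.naturality f (homOfLE (le_top : U ≤ ⊤)).op
    exact congrArg (fun g => g.hom a) this
  rw [h1, Scheme.Hom.comp_appTop]
  rfl

lemma stalkMap_stalkConst {Y : Scheme.{u}} (f : Y ⟶ X) (sY : Y ⟶ Spec (CommRingCat.of k))
    (hf : f ≫ sX = sY) (y : Y) (c : k) :
    (f.stalkMap y).hom (stalkConst sX (f y) c) = stalkConst sY y c := by
  rw [stalkConst, RingHom.comp_apply, stalkMap_germHom, toSections_app sX f sY hf]
  rfl

lemma fromSpecStalk_comp_str (x : X) :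
    X.fromSpecStalk x ≫ sX = Spec.map (CommRingCat.ofHom (stalkConst sX x)) := by
  have h1 : sX = X.toSpecΓ ≫ Spec.map ((Scheme.ΓSpecIso (CommRingCat.of k)).inv ≫ sX.appTop) := by
    rw [Spec.map_comp, ← Scheme.toSpecΓ_naturality_assoc]
    simp
  conv_lhs => rw [h1]
  rw [← Category.assoc, Scheme.fromSpecStalk_toSpecΓ, ← Spec.map_comp]
  congr 1
  ext c
  exact (germHom_sres (le_top : (⊤ : X.Opens) ≤ ⊤) (TopologicalSpace.Opens.mem_top x) _).symm

end Constants

/-- A point `x` is a center of the valuation ring `O` of the residue-type field `F` at `z`. -/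
structure Center {X : Scheme.{u}} {z : X} {F : Type u} [Field F]
    (α : X.presheaf.stalk z →+* F) (O : ValuationSubring F) (x : X) where
  sp : z ⤳ x
  β : X.presheaf.stalk x →+* O
  isLocal : IsLocalHom β
  comp : ∀ a, (β a : F) = α (stalkSp sp a)

lemma exists_center {k : Type u} [Field k] {X : Scheme.{u}} (sX : X ⟶ Spec (CommRingCat.of k))
    [UniversallyClosed sX] {z : X} {F : Type u} [Field F]
    (α : X.presheaf.stalk z →+* F) [IsLocalHom α] (O : ValuationSubring F)
    (hO : ∀ c, α (stalkConst sX z c) ∈ O) : ∃ x, Nonempty (Center α O x) := by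
  have hex : ValuativeCriterion.Existence sX := by
    have h : UniversallyClosed sX := inferInstance
    rw [UniversallyClosed.eq_valuativeCriterion] at h
    exact h.1
  let αk : k →+* O := (α.comp (stalkConst sX z)).codRestrict O.toSubring hO
  let i₁ : Spec (.of F) ⟶ X := Spec.map (CommRingCat.ofHom α) ≫ X.fromSpecStalk z
  let i₂ : Spec (.of O) ⟶ Spec (.of k) := Spec.map (CommRingCat.ofHom αk)
  have hsq : CommSq i₁ (Spec.map (CommRingCat.ofHom (algebraMap O F))) sX i₂ := by
    constructor
    simp only [i₁, i₂]
    rw [Category.assoc, fromSpecStalk_comp_str, ← Spec.map_comp, ← Spec.map_comp]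
    rfl
  obtain ⟨⟨l, hl1, hl2⟩⟩ := hex ⟨O, F, i₁, i₂, hsq⟩
  simp only at hl1 hl2
  change Spec (.of O) ⟶ X at l
  have hz : i₁ (IsLocalRing.closedPoint F) = z := by
    have : (Spec.map (CommRingCat.ofHom α)) (IsLocalRing.closedPoint F)
        = IsLocalRing.closedPoint (X.presheaf.stalk z) := IsLocalRing.comap_closedPoint α
    exact (congrArg (X.fromSpecStalk z) this).trans Scheme.fromSpecStalk_closedPoint
  have hsp : z ⤳ l (IsLocalRing.closedPoint O) := by
    have e : l ((Spec.map (CommRingCat.ofHom (algebraMap O F))) (IsLocalRing.closedPoint F)) = z :=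
      (congrArg (fun f : Spec (.of F) ⟶ X => f (IsLocalRing.closedPoint F)) hl1).trans hz
    have h := map_specializes l (z := (Spec.map (CommRingCat.ofHom (algebraMap O F)))
      (IsLocalRing.closedPoint F)) (IsLocalRing.specializes_closedPoint _)
    rwa [e] at h
  refine ⟨l (IsLocalRing.closedPoint O), ⟨⟨hsp, (Scheme.stalkClosedPointTo l).hom, ?_, ?_⟩⟩⟩
  · infer_instance
  · have h1 : Spec.map (CommRingCat.ofHom (algebraMap O F)) ≫ Spec.map (Scheme.stalkClosedPointTo l)
        ≫ X.fromSpecStalk _ = Spec.map (CommRingCat.ofHom α) ≫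
          Spec.map (X.presheaf.stalkSpecializes hsp) ≫ X.fromSpecStalk _ := by
      rw [Scheme.Spec_stalkClosedPointTo_fromSpecStalk,
        Scheme.SpecMap_stalkSpecializes_fromSpecStalk]
      exact hl1
    rw [← Category.assoc, ← Category.assoc, cancel_mono, ← Spec.map_comp, ← Spec.map_comp] at h1
    have h2 := Spec.map_injective h1
    intro a
    exact congrArg (fun g => g.hom a) h2

lemma isIntegral_of_forall_valuationSubring {k F : Type*} [CommRing k] [Field F] [Algebra k F]
    (S : Subalgebra k F) (f : F)
    (h : ∀ O : ValuationSubring F, (S : Set F) ⊆ O → f ∈ O) : IsIntegral S f := by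
  have h1 : f ∈ (⨅ V : {V : ValuationSubring F // (S : Set F) ⊆ V.toSubring}, V.1.toSubring) := by
    rw [Subring.mem_iInf]
    rintro ⟨V, hV⟩
    exact h V hV
  rw [iInf_valuationSubring_superset] at h1
  have h2 : IsIntegral (Subring.closure (S : Set F)) f := h1
  refine IsIntegral.of_range ?_ h2
  rintro _ ⟨⟨x, hx⟩, rfl⟩
  have : Subring.closure (S : Set F) ≤ S.toSubring := Subring.closure_le.2 le_rfl
  exact ⟨⟨x, this hx⟩, rfl⟩

lemma comm_group_rearrange {G : Type*} [CommGroup G] (b f s t A S X : G) :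
    b * f * s * t = A⁻¹ * S⁻¹ * X⁻¹ * (A * (S * (X * (t * b)) * s * f)) := by
  have : A⁻¹ * S⁻¹ * X⁻¹ * (A * (S * (X * (t * b)) * s * f)) =
    (A⁻¹ * A) * (S⁻¹ * S) * (X⁻¹ * X) * (b * f * s * t) := by ac_rfl
  rw [this]
  simp

section Transition

variable {X Y : Scheme.{u}}

lemma mem_inf' {U V : X.Opens} {x : X} (hU : x ∈ U) (hV : x ∈ V) : x ∈ U ⊓ V := ⟨hU, hV⟩

/-- The germ of a transition unit of a line bundle. -/
def germT (L : LineBundle X) (x : X) (i j : L.ι) (hi : x ∈ L.U i) (hj : x ∈ L.U j) :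
    (X.presheaf.stalk x)ˣ :=
  Units.map (germHom X (L.U i ⊓ L.U j) x (mem_inf' hi hj)).toMonoidHom (L.t i j)

lemma germT_mul (L : LineBundle X) (x : X) (i j l : L.ι) (hi : x ∈ L.U i) (hj : x ∈ L.U j)
    (hl : x ∈ L.U l) : germT L x i j hi hj * germT L x j l hj hl = germT L x i l hi hl := by
  have h := congrArg (Units.map (germHom X (L.U i ⊓ L.U j ⊓ L.U l) x
    (mem_inf' (mem_inf' hi hj) hl)).toMonoidHom)
    (L.cocycle i j l)
  rw [map_mul] at h
  ext
  have h' := congrArg Units.val h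
  simp only [Units.val_mul, Units.coe_map] at h'
  simp only [RingHom.toMonoidHom_eq_coe, MonoidHom.coe_coe, germHom_sres] at h'
  exact h'

lemma stalkSp_germT (L : LineBundle X) {z x : X} (h : z ⤳ x) (i j : L.ι) (hi : x ∈ L.U i)
    (hj : x ∈ L.U j) : stalkSp h (germT L x i j hi hj : X.presheaf.stalk x)
      = germT L z i j (h.mem_open (L.U i).2 hi) (h.mem_open (L.U j).2 hj) :=
  stalkSp_germHom h (U := L.U i ⊓ L.U j) (mem_inf' hi hj) _

lemma germT_pow (L : LineBundle X) (n : ℕ) (x : X) (i j : L.ι) (hi : x ∈ L.U i)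
    (hj : x ∈ L.U j) : germT (L.pow n) x i j hi hj = germT L x i j hi hj ^ n :=
  map_pow _ _ _

lemma germT_pullback (f : X ⟶ Y) (L : LineBundle Y) (x : X) (i j : L.ι) (hi : f x ∈ L.U i)
    (hj : f x ∈ L.U j) : (germT (pullbackLB f L) x i j hi hj : X.presheaf.stalk x)
      = (f.stalkMap x).hom (germT L (f x) i j hi hj : Y.presheaf.stalk (f x)) := by
  have h1 := stalkMap_germHom f (U := L.U i ⊓ L.U j) (x := x) (mem_inf' hi hj) (L.t i j)
  refine Eq.trans ?_ h1.symm
  have h2 : (show (Γ(X, f ⁻¹ᵁ L.U i ⊓ f ⁻¹ᵁ L.U j))ˣ from (pullbackLB f L).t i j).val =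
    (f.appLE (L.U i ⊓ L.U j) (f ⁻¹ᵁ L.U i ⊓ f ⁻¹ᵁ L.U j)
      (preimage_inf f (L.U i) (L.U j)).ge).hom (L.t i j) := rfl
  have h3 := sres_appLE f (U := L.U i ⊓ L.U j) (V := f ⁻¹ᵁ (L.U i ⊓ L.U j)) le_rfl
    (preimage_inf f (L.U i) (L.U j)).ge (L.t i j)
  have h4 : germHom X (f ⁻¹ᵁ L.U i ⊓ f ⁻¹ᵁ L.U j) x (mem_inf' hi hj)
      (show (Γ(X, f ⁻¹ᵁ L.U i ⊓ f ⁻¹ᵁ L.U j))ˣ from (pullbackLB f L).t i j).val =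
        germHom X _ x (mem_inf' hi hj)
      (sres X (preimage_inf f (L.U i) (L.U j)).ge ((f.app (L.U i ⊓ L.U j)).hom (L.t i j))) := by
    rw [h2, ← h3, Scheme.Hom.app_eq_appLE]
  exact h4.trans (germHom_sres _ _ _)

end Transition

/-- Germs of finitely many generating sections of a very ample-like line bundle, in chosen
local trivialisations, with the comparison units along specialisations. -/
structure ProjData (X : Scheme.{u}) (N : ℕ) where
  g : ∀ x : X, Fin N → X.presheaf.stalk x
  c : ∀ {z x : X}, z ⤳ x → (X.presheaf.stalk z)ˣ
  compat : ∀ {z x : X} (h : z ⤳ x) (j), g z j = c h * stalkSp h (g x j)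
  U : Fin N → X.Opens
  affine : ∀ j, IsAffineOpen (U j)
  mem_iff : ∀ x j, x ∈ U j ↔ IsUnit (g x j)
  cover : ∀ x, ∃ j, x ∈ U j

/-- The self-map `ψ` multiplies the line bundle by `M`, at the level of comparison units. -/
def ProjData.Pull {X : Scheme.{u}} {N : ℕ} (P : ProjData X N) (ψ : X ⟶ X) (M : ℕ) : Prop :=
  ∀ z : X, ∃ h : (X.presheaf.stalk z)ˣ, ∀ (x : X) (hzx : z ⤳ x),
    ∃ v : (X.presheaf.stalk x)ˣ,
      stalkSp hzx v * (P.c hzx : X.presheaf.stalk z) ^ M =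
        h * (ψ.stalkMap z).hom (P.c (map_specializes ψ hzx))

lemma ProjData.Pull.comp {X : Scheme.{u}} {N : ℕ} {P : ProjData X N} {φ ψ : X ⟶ X} {d D : ℕ}
    (hφ : P.Pull φ d) (hψ : P.Pull ψ D) : P.Pull (φ ≫ ψ) (d * D) := by
  intro z
  obtain ⟨h₁, H₁⟩ := hφ z
  obtain ⟨h₂, H₂⟩ := hψ (φ z)
  refine ⟨h₁ ^ D * Units.map (φ.stalkMap z).hom.toMonoidHom h₂, fun x hzx => ?_⟩
  obtain ⟨v₁, e₁⟩ := H₁ x hzx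
  obtain ⟨v₂, e₂⟩ := H₂ (φ x) (map_specializes φ hzx)
  refine ⟨v₁ ^ D * Units.map (φ.stalkMap x).hom.toMonoidHom v₂, ?_⟩
  have e₃ := congrArg (φ.stalkMap z).hom e₂
  have e₅ := stalkMap_stalkSp φ hzx v₂
  rw [map_mul, map_mul, e₅, map_pow] at e₃
  have e₄ : ((φ ≫ ψ).stalkMap z).hom
        (P.c (map_specializes (φ ≫ ψ) hzx) : X.presheaf.stalk ((φ ≫ ψ) z)) =
      (φ.stalkMap z).hom ((ψ.stalkMap (φ z)).hom
        (P.c (map_specializes ψ (map_specializes φ hzx)) : X.presheaf.stalk (ψ (φ z)))) :=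
    congrArg (fun g : X.presheaf.stalk ((φ ≫ ψ) z) ⟶ X.presheaf.stalk z =>
      g.hom (P.c (map_specializes (φ ≫ ψ) hzx) : X.presheaf.stalk ((φ ≫ ψ) z)))
      (Scheme.Hom.stalkMap_comp φ ψ z)
  rw [e₄]
  simp only [Units.val_mul, Units.val_pow_eq_pow_val, Units.coe_map, map_mul, map_pow,
    RingHom.toMonoidHom_eq_coe, MonoidHom.coe_coe]
  calc _ = (stalkSp hzx v₁ * (P.c hzx : X.presheaf.stalk z) ^ d) ^ D *
        stalkSp hzx ((φ.stalkMap x).hom v₂) := by ring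
    _ = h₁ ^ D * (stalkSp hzx ((φ.stalkMap x).hom v₂) * (φ.stalkMap z).hom
        (P.c (map_specializes φ hzx) : X.presheaf.stalk (φ z)) ^ D) := by
      rw [e₁, mul_pow]; ring
    _ = _ := by rw [e₃]; ring

/-- Iterates of an endomorphism of a scheme. -/
def iterHom {X : Scheme.{u}} (φ : X ⟶ X) : ℕ → (X ⟶ X)
  | 0 => 𝟙 X
  | n + 1 => φ ≫ iterHom φ n

lemma ProjData.Pull.iter {X : Scheme.{u}} {N : ℕ} {P : ProjData X N} {φ : X ⟶ X} {d : ℕ}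
    (hφ : P.Pull φ d) (n : ℕ) : P.Pull (iterHom φ n) (d ^ n) := by
  induction n with
  | zero =>
    intro z
    refine ⟨1, fun x hzx => ⟨1, ?_⟩⟩
    have : ((𝟙 X : X ⟶ X).stalkMap z).hom (P.c (map_specializes (𝟙 X) hzx) :
        X.presheaf.stalk ((𝟙 X : X ⟶ X) z)) = (P.c hzx : X.presheaf.stalk z) :=
      congrArg (fun g : X.presheaf.stalk z ⟶ X.presheaf.stalk z =>
        g.hom (P.c hzx : X.presheaf.stalk z)) (Scheme.Hom.stalkMap_id X z)
    refine Eq.trans ?_ (congrArg (_ * ·) this.symm)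
    simp
  | succ n ih =>
    rw [pow_succ']
    exact hφ.comp ih

lemma LineBundle.exists_mem (X : Scheme.{u}) (L : LineBundle X) (x : X) : ∃ i, x ∈ L.U i := by
  have : x ∈ (⊤ : X.Opens) := TopologicalSpace.Opens.mem_top x
  rw [← L.covers] at this
  exact TopologicalSpace.Opens.mem_iSup.1 this

/-- Powers of sections. -/
def GlobalSec.powSec {X : Scheme.{u}} {L : LineBundle X} {m : ℕ} (σ : GlobalSec (L.pow m)) (q : ℕ) :
    GlobalSec (L.pow (m * q)) where
  s i := (show Γ(X, L.U i) from σ.s i) ^ q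
  compat i j := by
    have := congrArg (· ^ q) (σ.compat i j)
    simp only [mul_pow, ← map_pow] at this
    refine this.trans ?_
    congr 1
    show (((L.t i j) ^ m : (Γ(X, L.U i ⊓ L.U j))ˣ) : Γ(X, L.U i ⊓ L.U j)) ^ q =
      (((L.t i j) ^ (m * q) : (Γ(X, L.U i ⊓ L.U j))ˣ) : Γ(X, L.U i ⊓ L.U j))
    rw [pow_mul]; simp only [Units.val_pow_eq_pow_val]

lemma germ_compat {X : Scheme.{u}} {L : LineBundle X} (σ : GlobalSec L) (x : X) (i j : L.ι)
    (hi : x ∈ L.U i) (hj : x ∈ L.U j) : germHom X (L.U i) x hi (σ.s i)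
      = germT L x i j hi hj * germHom X (L.U j) x hj (σ.s j) := by
  have := congrArg (germHom X (L.U i ⊓ L.U j) x (mem_inf' hi hj)) (σ.compat i j)
  rw [map_mul, germHom_sres, germHom_sres] at this
  exact this

lemma mem_locus_iff {X : Scheme.{u}} {L : LineBundle X} (σ : GlobalSec L) (x : X) (i : L.ι)
    (hi : x ∈ L.U i) : x ∈ σ.locus ↔ IsUnit (germHom X (L.U i) x hi (σ.s i)) := by
  rw [GlobalSec.locus, TopologicalSpace.Opens.mem_iSup]
  constructor
  · rintro ⟨j, hj⟩
    have hj' := X.basicOpen_le _ hj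
    replace hj := (Scheme.mem_basicOpen X (σ.s j) x hj').1 hj
    rw [germ_compat σ x i j hi hj']
    exact (Units.isUnit _).mul hj
  · intro h
    exact ⟨i, (Scheme.mem_basicOpen X (σ.s i) x hi).2 h⟩

lemma locus_powSec {X : Scheme.{u}} {L : LineBundle X} {m : ℕ} (σ : GlobalSec (L.pow m)) {q : ℕ}
    (hq : q ≠ 0) : (GlobalSec.powSec σ q).locus = σ.locus := by
  ext x
  obtain ⟨i, hi⟩ := LineBundle.exists_mem X L x
  show x ∈ (GlobalSec.powSec σ q).locus ↔ x ∈ σ.locus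
  refine (mem_locus_iff (GlobalSec.powSec σ q) x i hi).trans
    (Iff.trans ?_ (mem_locus_iff σ x i hi).symm)
  show IsUnit (germHom X (L.U i) x hi ((show Γ(X, L.U i) from σ.s i) ^ q)) ↔ _
  rw [map_pow, isUnit_pow_iff hq]
  rfl

lemma exists_projData {X : Scheme.{u}} (L : LineBundle X) (hL : L.IsAmple) :
    ∃ (N : ℕ) (P : ProjData X N), ∀ (φ : X ⟶ X) (d : ℕ),
      (pullbackLB φ L).EquivLB (L.pow d) → P.Pull φ d := by
  classical
  obtain ⟨hc, hL⟩ := hL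
  choose m hm σ hσ hσ' using hL
  obtain ⟨t, ht⟩ := isCompact_univ.elim_finite_subcover (fun x : X => ((σ x).locus : Set X))
    (fun x => (σ x).locus.2) (fun x _ => Set.mem_iUnion.2 ⟨x, hσ x⟩)
  let r := ∏ x ∈ t, m x
  let ee := t.equivFin.symm
  have hr : ∀ x ∈ t, ∃ q, q ≠ 0 ∧ m x * q = r := by
    intro x hx
    refine ⟨∏ y ∈ t.erase x, m y, ?_, Finset.mul_prod_erase t m hx⟩
    exact Finset.prod_ne_zero_iff.2 fun y _ => (hm y).ne'
  have hτ : ∀ j : Fin t.card, ∃ τ : GlobalSec (L.pow r), τ.locus = (σ (ee j)).locus := by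
    intro j
    obtain ⟨q, hq, hqr⟩ := hr (ee j) (ee j).2
    rw [← hqr]
    exact ⟨GlobalSec.powSec _ q, locus_powSec _ hq⟩
  choose τ hτ using hτ
  choose ch hch using LineBundle.exists_mem X L
  refine ⟨t.card, ⟨fun x j => germHom X (L.U (ch x)) x (hch x) ((τ j).s (ch x)),
    fun {z x} h => germT L z (ch z) (ch x) (hch z) (h.mem_open (L.U _).2 (hch x)) ^ r, ?_,
    fun j => (τ j).locus, ?_, ?_, ?_⟩, ?_⟩
  · intro z x h j
    have h1 := germ_compat (τ j) z (ch z) (ch x) (hch z) (h.mem_open (L.U _).2 (hch x))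
    replace h1 := h1.trans (congrArg (fun t : (X.presheaf.stalk z)ˣ => (t : X.presheaf.stalk z) * _)
      (germT_pow L r z (ch z) (ch x) (hch z) (h.mem_open (L.U _).2 (hch x))))
    refine h1.trans ?_
    congr 1
    exact (stalkSp_germHom h (U := L.U (ch x)) (hch x) _).symm
  · intro j
    rw [hτ]
    exact hσ' _
  · intro x j
    exact mem_locus_iff (τ j) x (ch x) (hch x)
  · intro x
    obtain ⟨y, hy⟩ := Set.mem_iUnion.1 (ht (Set.mem_univ x))
    obtain ⟨hy, hxy⟩ := Set.mem_iUnion.1 hy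
    refine ⟨ee.symm ⟨y, hy⟩, ?_⟩
    rw [hτ, Equiv.apply_symm_apply]
    exact hxy
  · rintro φ d ⟨κ, V, hV, (a : κ → L.ι), (b : κ → L.ι),
      (ha : ∀ c, V c ≤ φ ⁻¹ᵁ L.U (a c)), (hb : ∀ c, V c ≤ L.U (b c)), s, hs⟩
    intro z
    have hVx : ∀ x : X, ∃ c, x ∈ V c := by
      intro x
      have : x ∈ (⊤ : X.Opens) := TopologicalSpace.Opens.mem_top x
      rw [← hV] at this
      exact TopologicalSpace.Opens.mem_iSup.1 this
    obtain ⟨c, hc⟩ := hVx z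
    let sg : ∀ (x : X) (c : κ) (_ : x ∈ V c), (X.presheaf.stalk x)ˣ := fun x c hx =>
      Units.map (germHom X (V c) x hx).toMonoidHom (s c)
    let φT : ∀ (x : X) (i j : L.ι) (_ : φ x ∈ L.U i) (_ : φ x ∈ L.U j), (X.presheaf.stalk x)ˣ :=
      fun x i j hi hj => germT (pullbackLB φ L) x i j hi hj
    have hφT : ∀ (x : X) (i j : L.ι) (hi : φ x ∈ L.U i) (hj : φ x ∈ L.U j),
      (φT x i j hi hj : X.presheaf.stalk x) = (φ.stalkMap x).hom (germT L (φ x) i j hi hj) :=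
      fun x i j hi hj => germT_pullback φ L x i j hi hj
    have hφTm : ∀ (x : X) (i j l : L.ι) (hi : φ x ∈ L.U i) (hj : φ x ∈ L.U j) (hl : φ x ∈ L.U l),
      φT x i j hi hj * φT x j l hj hl = φT x i l hi hl :=
      fun x i j l hi hj hl => germT_mul (pullbackLB φ L) x i j l hi hj hl
    have key : ∀ (x : X) (c c' : κ) (hx : x ∈ V c) (hx' : x ∈ V c'),
        φT x (a c) (a c') (ha c hx) (ha c' hx') * sg x c' hx' =
          sg x c hx * germT L x (b c) (b c') (hb c hx) (hb c' hx') ^ d := by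
      intro x c c' hx hx'
      have h1 := congrArg (Units.map (germHom X (V c ⊓ V c') x (mem_inf' hx hx')).toMonoidHom)
        (hs c c')
      rw [map_mul, map_mul] at h1
      refine Eq.trans ?_ (congrArg (_ * ·) (germT_pow L d x (b c) (b c') (hb c hx) (hb c' hx')))
      ext
      have h' := congrArg Units.val h1
      simp only [Units.val_mul, Units.coe_map] at h'
      simp only [RingHom.toMonoidHom_eq_coe, MonoidHom.coe_coe, germHom_sres] at h'
      exact h'
    refine ⟨((φT z (ch (φ z)) (a c) (hch _) (ha c hc)) * sg z c hc *
      germT L z (b c) (ch z) (hb c hc) (hch z) ^ d)⁻¹ ^ r, fun x hzx => ?_⟩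
    obtain ⟨c', hc'⟩ := hVx x
    have hzc' : z ∈ V c' := hzx.mem_open (V c').2 hc'
    refine ⟨(germT L x (ch x) (b c') (hch x) (hb c' hc') ^ d) ^ r *
      (φT x (a c') (ch (φ x)) (ha c' hc') (hch _)) ^ r * ((sg x c' hc')⁻¹) ^ r, ?_⟩
    have hφx := (map_specializes φ hzx).mem_open (L.U (ch (φ x))).2 (hch (φ x))
    have hzx' := hzx.mem_open (L.U (ch x)).2 (hch x)
    have e1 := hφTm z (ch (φ z)) (a c) (ch (φ x)) (hch _) (ha c hc) hφx
    have e2 := hφTm z (a c) (a c') (ch (φ x)) (ha c hc) (ha c' hzc') hφx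
    have e3 := key z c c' hc hzc'
    have e4 := germT_mul L z (b c) (ch z) (b c') (hb c hc) (hch z) (hb c' hzc')
    have e5 := germT_mul L z (ch z) (ch x) (b c') (hch z) hzx' (hb c' hzc')
    have f1 : stalkSp hzx (germT L x (ch x) (b c') (hch x) (hb c' hc') : X.presheaf.stalk x) =
      germT L z (ch x) (b c') hzx' (hb c' hzc') := stalkSp_germT L hzx _ _ _ _
    have f2 : stalkSp hzx (φT x (a c') (ch (φ x)) (ha c' hc') (hch _) : X.presheaf.stalk x) =
      φT z (a c') (ch (φ x)) (ha c' hzc') hφx := stalkSp_germT (pullbackLB φ L) hzx _ _ _ _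
    have f3 : stalkSp hzx (((sg x c' hc')⁻¹ : (X.presheaf.stalk x)ˣ) : X.presheaf.stalk x) =
        ((sg z c' hzc')⁻¹ : (X.presheaf.stalk z)ˣ) := by
      refine Units.eq_inv_of_mul_eq_one_left ?_
      have : (sg z c' hzc' : X.presheaf.stalk z) = stalkSp hzx (sg x c' hc') :=
        (stalkSp_germHom hzx (U := V c') hc' _).symm
      rw [this, ← map_mul, Units.mul_inv, map_one]
    have f4 : (φ.stalkMap z).hom ((germT L (φ z) (ch (φ z)) (ch (φ x)) (hch _) hφx ^ r :
        (X.presheaf.stalk (φ z))ˣ) : X.presheaf.stalk (φ z)) =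
        (φT z (ch (φ z)) (ch (φ x)) (hch _) hφx ^ r : (X.presheaf.stalk z)ˣ) := by
      rw [Units.val_pow_eq_pow_val, map_pow, Units.val_pow_eq_pow_val, hφT]
    refine Eq.trans ?_ (congrArg (_ * ·) f4.symm)
    rw [Units.val_mul, Units.val_mul, map_mul, map_mul]
    simp only [Units.val_pow_eq_pow_val, map_pow, f1, f2, f3]
    simp only [← Units.val_pow_eq_pow_val, ← Units.val_mul]
    congr 1
    rw [← e1, ← e2, eq_mul_inv_of_mul_eq e3, ← e4, ← e5]
    simp only [mul_pow, inv_pow, mul_inv, ← pow_mul]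
    generalize germT L z (b c) (ch z) (hb c hc) (hch z) = x1
    rw [mul_comm d r]
    exact comm_group_rearrange _ _ _ _ _ _ _

section Consts

variable {k : Type u} [Field k] {X : Scheme.{u}} (sX : X ⟶ Spec (CommRingCat.of k))

lemma toSections_eq (U : X.Opens) : toSections sX U =
    (sX.appLE ⊤ U le_top).hom.comp (Scheme.ΓSpecIso (CommRingCat.of k)).inv.hom := by
  ext c
  have h := sres_appLE sX (U := ⊤) (V := ⊤) (V' := U) le_top le_top
    ((Scheme.ΓSpecIso (CommRingCat.of k)).inv.hom c)
  refine Eq.trans ?_ h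
  simp only [toSections, RingHom.comp_apply]
  refine congrArg _ ?_
  exact congrArg (fun g : Γ(Spec (CommRingCat.of k), ⊤) ⟶ Γ(X, ⊤) =>
    g.hom ((Scheme.ΓSpecIso (CommRingCat.of k)).inv.hom c)) (Scheme.Hom.appLE_eq_app (f := sX)).symm

lemma toSections_property {P : MorphismProperty Scheme.{u}}
    {Q : ∀ {R S : Type u} [CommRing R] [CommRing S], (R →+* S) → Prop}
    [HasRingHomProperty P Q] (h : P sX) {U : X.Opens} (hU : IsAffineOpen U) :
    Q (toSections sX U) := by
  have h1 := HasRingHomProperty.appLE P sX h ⟨⊤, isAffineOpen_top _⟩ ⟨U, hU⟩ le_top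
  rw [toSections_eq]
  exact (HasRingHomProperty.isLocal_ringHomProperty P (Q := Q)).respectsIso.2 _
    (Scheme.ΓSpecIso (CommRingCat.of k)).symm.commRingCatIsoToRingEquiv h1

lemma toSections_finiteType [LocallyOfFiniteType sX] {U : X.Opens} (hU : IsAffineOpen U) :
    (toSections sX U).FiniteType :=
  toSections_property sX (P := @LocallyOfFiniteType) inferInstance hU

/-- Every element of a stalk is a fraction of germs on an affine open. -/
lemma exists_germ_mul_eq {U : X.Opens} (hU : IsAffineOpen U) {x : X} (hx : x ∈ U)
    (y : X.presheaf.stalk x) : ∃ a b : Γ(X, U), IsUnit (germHom X U x hx b) ∧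
      y * germHom X U x hx b = germHom X U x hx a := by
  have h := hU.isLocalization_stalk ⟨x, hx⟩
  letI : Algebra Γ(X, U) (X.presheaf.stalk x) := (germHom X U x hx).toAlgebra
  obtain ⟨⟨a, b⟩, hab⟩ := IsLocalization.surj (hU.primeIdealOf ⟨x, hx⟩).asIdeal.primeCompl y
  exact ⟨a, b, IsLocalization.map_units _ b, hab⟩

lemma stalk_essFiniteType [LocallyOfFiniteType sX] {U : X.Opens} (hU : IsAffineOpen U) {x : X}
    (hx : x ∈ U) : (stalkConst sX x).EssFiniteType := by
  letI : Algebra Γ(X, U) (X.presheaf.stalk x) := (germHom X U x hx).toAlgebra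
  letI : Algebra k Γ(X, U) := (toSections sX U).toAlgebra
  letI : Algebra k (X.presheaf.stalk x) := (stalkConst sX x).toAlgebra
  haveI : IsScalarTower k Γ(X, U) (X.presheaf.stalk x) := IsScalarTower.of_algebraMap_eq fun c =>
    (germHom_toSections sX U x hx c).symm
  haveI : Algebra.FiniteType k Γ(X, U) := toSections_finiteType sX hU
  have h := hU.isLocalization_stalk ⟨x, hx⟩
  haveI : Algebra.EssFiniteType Γ(X, U) (X.presheaf.stalk x) :=
    Algebra.EssFiniteType.of_isLocalization _ (hU.primeIdealOf ⟨x, hx⟩).asIdeal.primeCompl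
  exact Algebra.EssFiniteType.comp k Γ(X, U) (X.presheaf.stalk x)

end Consts

namespace ProjData

variable {k : Type u} [Field k] {X : Scheme.{u}} (sX : X ⟶ Spec (CommRingCat.of k))
  {N : ℕ} (P : ProjData X N)

/-- The germ of a linear combination of the generating sections. -/
def lin (w : Fin N → k) (x : X) : X.presheaf.stalk x := ∑ j, stalkConst sX x (w j) * P.g x j

lemma lin_single (j : Fin N) (x : X) : P.lin sX (Pi.single j 1) x = P.g x j := by
  classical
  rw [lin, Finset.sum_eq_single j]
  · simp
  · intro b _ hb
    simp [Pi.single_eq_of_ne hb]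
  · simp

lemma lin_compat (w : Fin N → k) {z x : X} (h : z ⤳ x) :
    P.lin sX w z = P.c h * stalkSp h (P.lin sX w x) := by
  simp only [lin, map_sum, map_mul, stalkSp_stalkConst, Finset.mul_sum]
  refine Finset.sum_congr rfl fun j _ => ?_
  rw [P.compat h]
  ring

lemma lin_sub_smul (w w' : Fin N → k) (b : k) (x : X) :
    P.lin sX (w - b • w') x = P.lin sX w x - stalkConst sX x b * P.lin sX w' x := by
  simp only [lin, Finset.mul_sum, ← Finset.sum_sub_distrib]
  refine Finset.sum_congr rfl fun j _ => ?_
  simp only [Pi.sub_apply, Pi.smul_apply, smul_eq_mul, map_sub, map_mul]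
  ring

variable {F : Type u} [Field F]

lemma center_ratio_mem {z x : X} {α : X.presheaf.stalk z →+* F} {O : ValuationSubring F}
    (c : Center α O x) {w : Fin N → k} (hw : IsUnit (P.lin sX w x)) (w' : Fin N → k) :
    α (P.lin sX w' z) / α (P.lin sX w z) ∈ O := by
  obtain ⟨a, ha⟩ := hw
  have h1 : α (P.lin sX w' z) / α (P.lin sX w z) =
      (c.β (P.lin sX w' x * (a⁻¹ : (X.presheaf.stalk x)ˣ)) : F) := by
    rw [P.lin_compat sX w' c.sp, P.lin_compat sX w c.sp, map_mul, map_mul,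
      mul_div_mul_left _ _ ((P.c c.sp).isUnit.map α).ne_zero, ← ha, c.comp, map_mul, map_mul,
      div_eq_mul_inv]
    congr 1
    refine inv_eq_of_mul_eq_one_right ?_
    rw [← map_mul, ← map_mul, Units.mul_inv, map_one, map_one]
  rw [h1]
  exact Subtype.property _

/-- A family of linear forms without common zeros on the closure of `z`. -/
def Nondeg {ι : Type*} (z : X) (w : ι → Fin N → k) : Prop :=
  ∀ x, z ⤳ x → ∃ i, IsUnit (P.lin sX (w i) x)

lemma nondeg_single (z : X) : P.Nondeg sX z (fun j : Fin N => (Pi.single j 1 : Fin N → k)) := by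
  intro x _
  obtain ⟨j, hj⟩ := P.cover x
  exact ⟨j, by rw [lin_single]; exact (P.mem_iff x j).1 hj⟩

variable [Algebra k F]

lemma nondeg_reduce [Infinite k] {z : X} (α : X.presheaf.stalk z →+* F) [IsLocalHom α]
    (hα : ∀ c, algebraMap k F c = α (stalkConst sX z c)) {e : ℕ} {w : Fin (e + 1) → Fin N → k}
    (hw : P.Nondeg sX z w) (i : Fin (e + 1))
    (hdep : ¬ AlgebraicIndependent k (affCoord (fun i => α (P.lin sX (w i) z)) i)) :
    ∃ w' : Fin e → Fin N → k, P.Nondeg sX z w' := by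
  rw [algebraicIndependent_iff] at hdep
  push Not at hdep
  obtain ⟨p, hp, hp0⟩ := hdep
  obtain ⟨b, hb⟩ : ∃ b : Fin e → k, MvPolynomial.eval b p ≠ 0 := by
    by_contra! h
    exact hp0 (MvPolynomial.funext fun b => by rw [h b, map_zero])
  refine ⟨fun j => w (i.succAbove j) - b j • w i, fun x hzx => ?_⟩
  by_contra! hno
  simp only [lin_sub_smul] at hno
  obtain ⟨l, hl⟩ := hw x hzx
  let res := IsLocalRing.residue (X.presheaf.stalk x)
  have hno' : ∀ j, res (P.lin sX (w (i.succAbove j)) x) =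
      res (stalkConst sX x (b j)) * res (P.lin sX (w i) x) := by
    intro j
    rw [← map_mul, ← sub_eq_zero, ← map_sub]
    exact (IsLocalRing.residue_eq_zero_iff _).2 ((IsLocalRing.mem_maximalIdeal _).2 (hno j))
  have hi : IsUnit (P.lin sX (w i) x) := by
    by_cases hli : l = i
    · exact hli ▸ hl
    obtain ⟨j, rfl⟩ := Fin.exists_succAbove_eq hli
    have h1 : res (P.lin sX (w (i.succAbove j)) x) ≠ 0 := (hl.map res).ne_zero
    rw [hno' j] at h1
    exact (isUnit_of_map_unit res _ (Ne.isUnit (right_ne_zero_of_mul h1)))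
  obtain ⟨a, ha⟩ := hi
  let tx : Fin e → X.presheaf.stalk x := fun j =>
    P.lin sX (w (i.succAbove j)) x * (a⁻¹ : (X.presheaf.stalk x)ˣ)
  have h1 : α (stalkSp hzx (MvPolynomial.eval₂ (stalkConst sX x) tx p)) = 0 := by
    rw [← hp, MvPolynomial.aeval_def, MvPolynomial.hom_eval₂, MvPolynomial.hom_eval₂]
    congr 1
    · ext c
      simp only [RingHom.comp_apply, hα, stalkSp_stalkConst]
    · funext j
      simp only [affCoord, tx]
      rw [P.lin_compat sX (w (i.succAbove j)) hzx, P.lin_compat sX (w i) hzx, map_mul α, map_mul α,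
        mul_div_mul_left _ _ ((P.c hzx).isUnit.map α).ne_zero, ← ha, map_mul, map_mul,
        div_eq_mul_inv]
      congr 1
      refine (inv_eq_of_mul_eq_one_right ?_).symm
      rw [← map_mul, ← map_mul, Units.mul_inv, map_one, map_one]
  have h2 : ¬ IsUnit (MvPolynomial.eval₂ (stalkConst sX x) tx p) := fun h =>
    ((h.map (stalkSp hzx)).map α).ne_zero h1
  have h3 : res (MvPolynomial.eval₂ (stalkConst sX x) tx p) = 0 :=
    (IsLocalRing.residue_eq_zero_iff _).2 ((IsLocalRing.mem_maximalIdeal _).2 h2)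
  rw [MvPolynomial.hom_eval₂] at h3
  have h4 : (fun j => res (tx j)) = fun j => (res.comp (stalkConst sX x)) (b j) := by
    funext j
    simp only [tx, map_mul, hno' j, RingHom.comp_apply]
    rw [mul_assoc, ← ha, ← map_mul, Units.mul_inv, map_one, mul_one]
  rw [h4] at h3
  have h5 : (res.comp (stalkConst sX x)) (MvPolynomial.eval b p) = 0 := by
    rw [← h3, ← MvPolynomial.eval₂_id, MvPolynomial.hom_eval₂]
    rfl
  exact hb ((map_eq_zero _).1 h5)

lemma exists_nondeg_algebraicIndependent [Infinite k] {z : X} (α : X.presheaf.stalk z →+* F)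
    [IsLocalHom α] (hα : ∀ c, algebraMap k F c = α (stalkConst sX z c)) :
    ∃ (e : ℕ) (w : Fin (e + 1) → Fin N → k), P.Nondeg sX z w ∧
      (∀ i, α (P.lin sX (w i) z) ≠ 0) ∧
      ∀ i, AlgebraicIndependent k (affCoord (fun i => α (P.lin sX (w i) z)) i) := by
  classical
  have hex : ∃ e, ∃ w : Fin e → Fin N → k, P.Nondeg sX z w := ⟨N, _, P.nondeg_single sX z⟩
  obtain ⟨w, hw⟩ := Nat.find_spec hex
  have hmin : ∀ m < Nat.find hex, ¬ ∃ w : Fin m → Fin N → k, P.Nondeg sX z w :=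
    fun m hm => Nat.find_min hex hm
  revert w hmin
  generalize Nat.find hex = e'
  intro w hw hmin
  obtain _ | e := e'
  · obtain ⟨i, -⟩ := hw z specializes_rfl
    exact i.elim0
  have hind : ∀ i, AlgebraicIndependent k (affCoord (fun i => α (P.lin sX (w i) z)) i) := by
    intro i
    by_contra h
    exact hmin e (Nat.lt_succ_self e) (P.nondeg_reduce sX α hα hw i h)
  refine ⟨e, w, hw, fun i hi => ?_, hind⟩
  obtain ⟨l, hl⟩ := hw z specializes_rfl
  have hl0 : α (P.lin sX (w l) z) ≠ 0 := (hl.map α).ne_zero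
  have hil : i ≠ l := fun h => hl0 (h ▸ hi)
  obtain ⟨j, rfl⟩ := Fin.exists_succAbove_eq hil
  refine (hind l).ne_zero j ?_
  simp [affCoord, hi]

/-- Values of regular functions are integral over the affine cone of ratios. -/
lemma mem_of_germ [UniversallyClosed sX] {z : X} (α : X.presheaf.stalk z →+* F)
    [IsLocalHom α] (hα : ∀ c, algebraMap k F c = α (stalkConst sX z c)) {j : Fin N}
    (hj : z ∈ P.U j) (O : ValuationSubring F) (hO : ∀ c, algebraMap k F c ∈ O)
    (hO' : ∀ l, α (P.g z l) / α (P.g z j) ∈ O) (f : Γ(X, P.U j)) :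
    α (germHom X (P.U j) z hj f) ∈ O := by
  obtain ⟨x, ⟨c⟩⟩ := exists_center sX α O fun c => hα c ▸ hO c
  obtain ⟨l, hl⟩ := P.cover x
  have hlx := (P.mem_iff x l).1 hl
  obtain ⟨a, ha⟩ := hlx
  have hjz := (((P.mem_iff z j).1 hj).map α).ne_zero
  have hcz := ((P.c c.sp).isUnit.map α).ne_zero
  have hx : x ∈ P.U j := by
    rw [P.mem_iff]
    have h1 : (c.β (P.g x j * (a⁻¹ : (X.presheaf.stalk x)ˣ)) : F) * (α (P.g z l) / α (P.g z j))
        = 1 := by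
      have e1 : α (P.g z l) = α (P.c c.sp) * α (stalkSp c.sp a) := by
        rw [P.compat c.sp, map_mul, ha]
      have e2 : α (P.g z j) = α (P.c c.sp) * α (stalkSp c.sp (P.g x j)) := by
        rw [P.compat c.sp, map_mul]
      have e3 : α (stalkSp c.sp a) * α (stalkSp c.sp (a⁻¹ : (X.presheaf.stalk x)ˣ)) = 1 := by
        rw [← map_mul, ← map_mul, Units.mul_inv, map_one, map_one]
      rw [mul_div_assoc', div_eq_one_iff_eq hjz, c.comp, map_mul, map_mul, e1, e2]
      linear_combination α (P.c c.sp) * α (stalkSp c.sp (P.g x j)) * e3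
    have h2 : IsUnit (c.β (P.g x j * (a⁻¹ : (X.presheaf.stalk x)ˣ))) :=
      IsUnit.of_mul_eq_one ⟨_, hO' l⟩ (Subtype.ext h1)
    have := c.isLocal
    exact isUnit_of_mul_isUnit_left (isUnit_of_map_unit c.β _ h2)
  have h3 := c.comp (germHom X (P.U j) x hx f)
  rw [stalkSp_germHom] at h3
  exact h3 ▸ Subtype.property _

lemma isAlgebraic_of_germ [UniversallyClosed sX] {z : X} (α : X.presheaf.stalk z →+* F)
    [IsLocalHom α] (hα : ∀ c, algebraMap k F c = α (stalkConst sX z c))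
    (hsurj : Function.Surjective α) (K : IntermediateField k F) (j : Fin N)
    (hj : z ∈ P.U j) (hK : ∀ l, IsAlgebraic K (α (P.g z l) / α (P.g z j))) :
    Algebra.IsAlgebraic K F := by
  let A : Subalgebra k F := Algebra.adjoin k (Set.range fun l => α (P.g z l) / α (P.g z j))
  have h1 : ∀ f, IsAlgebraic K (α (germHom X (P.U j) z hj f)) := by
    intro f
    have h2 : IsIntegral A (α (germHom X (P.U j) z hj f)) := by
      refine isIntegral_of_forall_valuationSubring A _ fun O hO => ?_
      exact P.mem_of_germ sX α hα hj O (fun c => hO (algebraMap_mem A c))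
        (fun l => hO (Algebra.subset_adjoin ⟨l, rfl⟩)) f
    let B : IntermediateField K F := algebraicClosure K F
    have hAB : ∀ a ∈ A, a ∈ B := by
      intro a ha
      have : A ≤ B.toSubalgebra.restrictScalars k := Algebra.adjoin_le (by
        rintro _ ⟨l, rfl⟩
        exact mem_algebraicClosure_iff.2 (hK l))
      exact this ha
    have h3 : IsIntegral B (α (germHom X (P.U j) z hj f)) := by
      refine IsIntegral.of_range ?_ h2
      rintro _ ⟨⟨a, ha⟩, rfl⟩
      exact ⟨⟨a, hAB a ha⟩, rfl⟩
    exact (isIntegral_trans (R := K) (A := B) _ h3).isAlgebraic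
  refine ⟨fun y => ?_⟩
  obtain ⟨y, rfl⟩ := hsurj y
  obtain ⟨a, b, hb, hab⟩ := exists_germ_mul_eq (P.affine j) hj y
  have h4 : α y = α (germHom X (P.U j) z hj a) * (α (germHom X (P.U j) z hj b))⁻¹ := by
    rw [eq_mul_inv_iff_mul_eq₀ (hb.map α).ne_zero, ← map_mul, hab]
  rw [h4]
  exact (h1 a).mul (h1 b).inv

theorem exists_noether [Infinite k] [UniversallyClosed sX] [LocallyOfFiniteType sX] {z : X}
    (α : X.presheaf.stalk z →+* F)
    [IsLocalHom α] (hα : ∀ c, algebraMap k F c = α (stalkConst sX z c))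
    (hsurj : Function.Surjective α) :
    ∃ (e : ℕ) (w : Fin (e + 1) → Fin N → k), P.Nondeg sX z w ∧
      (∀ i, α (P.lin sX (w i) z) ≠ 0) ∧
      (∀ i, AlgebraicIndependent k (affCoord (fun i => α (P.lin sX (w i) z)) i)) ∧
      FiniteDimensional (IntermediateField.adjoin k
        (Set.range (affCoord (fun i => α (P.lin sX (w i) z)) 0))) F := by
  obtain ⟨e, w, hw, h0, hind⟩ := P.exists_nondeg_algebraicIndependent sX α hα
  refine ⟨e, w, hw, h0, hind, ?_⟩
  set s : Fin (e + 1) → F := fun i => α (P.lin sX (w i) z) with hs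
  let K := IntermediateField.adjoin k (Set.range (affCoord s 0))
  have hsK : ∀ i, s i / s 0 ∈ K := by
    intro i
    by_cases hi : i = 0
    · rw [hi, div_self (h0 0)]; exact one_mem _
    · obtain ⟨j, rfl⟩ := Fin.exists_succAbove_eq hi
      exact IntermediateField.subset_adjoin _ _ ⟨j, rfl⟩
  have h1 : ∀ l, IsAlgebraic K (α (P.g z l) / s 0) := by
    intro l
    let A : Subalgebra k F := Algebra.adjoin k (Set.range fun i => s i / s 0)
    have h2 : IsIntegral A (α (P.g z l) / s 0) := by
      refine isIntegral_of_forall_valuationSubring A _ fun O hO => ?_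
      obtain ⟨x, ⟨c⟩⟩ := exists_center sX α O fun c => hα c ▸ hO (algebraMap_mem A c)
      obtain ⟨i, hi⟩ := hw x c.sp
      have h3 := P.center_ratio_mem sX c hi (Pi.single l 1)
      rw [lin_single] at h3
      have h4 : s i / s 0 ∈ O := hO (Algebra.subset_adjoin ⟨i, rfl⟩)
      have h5 := mul_mem h3 h4
      rwa [div_mul_div_cancel₀ (h0 i)] at h5
    have hAK : A ≤ K.toSubalgebra := Algebra.adjoin_le (by rintro _ ⟨i, rfl⟩; exact hsK i)
    have h3 : IsIntegral K (α (P.g z l) / s 0) := by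
      refine IsIntegral.of_range ?_ h2
      rintro _ ⟨⟨a, ha⟩, rfl⟩
      exact ⟨⟨a, hAK ha⟩, rfl⟩
    exact h3.isAlgebraic
  obtain ⟨j, hj⟩ := P.cover z
  have hjz := (((P.mem_iff z j).1 hj).map α).ne_zero
  haveI : Algebra.IsAlgebraic K F := by
    refine P.isAlgebraic_of_germ sX α hα hsurj K j hj fun l => ?_
    rw [← div_div_div_cancel_right₀ (h0 0), div_eq_mul_inv]
    exact (h1 l).mul (h1 j).inv
  haveI : Algebra.EssFiniteType k F := by
    letI : Algebra k (X.presheaf.stalk z) := (stalkConst sX z).toAlgebra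
    letI : Algebra (X.presheaf.stalk z) F := α.toAlgebra
    haveI : IsScalarTower k (X.presheaf.stalk z) F := IsScalarTower.of_algebraMap_eq hα
    haveI : Algebra.EssFiniteType k (X.presheaf.stalk z) := stalk_essFiniteType sX (P.affine j) hj
    haveI : Algebra.FiniteType (X.presheaf.stalk z) F :=
      Algebra.FiniteType.of_surjective (Algebra.ofId _ F) hsurj
    exact Algebra.EssFiniteType.comp k (X.presheaf.stalk z) F
  haveI : Algebra.EssFiniteType K F := Algebra.EssFiniteType.of_comp k K F
  exact Algebra.finite_of_essFiniteType_of_isAlgebraic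

end ProjData

lemma isProjGen_adjoin {k K : Type*} [Field k] [Field K] [Algebra k K] {e : ℕ}
    {s : Fin (e + 1) → K} (h0 : ∀ i, s i ≠ 0) (hind : ∀ i, AlgebraicIndependent k (affCoord s i)) :
    ∃ T : Fin (e + 1) → IntermediateField.adjoin k (Set.range (affCoord s 0)),
      IsProjGen k T ∧ ∀ i, (T i : K) = s i / s 0 := by
  let K0 := IntermediateField.adjoin k (Set.range (affCoord s 0))
  have hsK : ∀ i, s i / s 0 ∈ K0 := by
    intro i
    by_cases hi : i = 0
    · rw [hi, div_self (h0 0)]; exact one_mem _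
    · obtain ⟨j, rfl⟩ := Fin.exists_succAbove_eq hi
      exact IntermediateField.subset_adjoin _ _ ⟨j, rfl⟩
  have hco : ∀ i j, ((affCoord (fun i => (⟨s i / s 0, hsK i⟩ : K0)) i j : K0) : K) =
      affCoord s i j := by
    intro i j
    simp only [affCoord]
    exact div_div_div_cancel_right₀ (h0 0) _ _
  refine ⟨fun i => ⟨s i / s 0, hsK i⟩, ⟨fun i h => ?_, fun i => ?_, ?_⟩, fun i => rfl⟩
  · exact div_ne_zero (h0 i) (h0 0) (congrArg Subtype.val h)
  · rw [← AlgHom.algebraicIndependent_iff (f := K0.val) (K0.val : K0 →+* K).injective]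
    convert hind i using 1
    funext j
    exact hco i j
  · have : (IntermediateField.adjoin k
      (Set.range (affCoord (fun i => (⟨s i / s 0, hsK i⟩ : K0)) 0))).map
        K0.val = K0 := by
      rw [IntermediateField.adjoin_map]
      congr 1
      rw [← Set.range_comp]
      congr 1
      funext j
      exact hco 0 j
    rw [eq_top_iff]
    rintro ⟨x, hx⟩ -
    have hx' := hx
    rw [show IntermediateField.adjoin k (Set.range (affCoord s 0)) = _ from this.symm] at hx'
    obtain ⟨y, hy, hyx⟩ := hx'
    have : y = ⟨x, hx⟩ := Subtype.ext hyx
    exact this ▸ hy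

namespace ProjData

variable {k : Type u} [Field k] [Infinite k] {X : Scheme.{u}} (sX : X ⟶ Spec (CommRingCat.of k))
  [UniversallyClosed sX] {N : ℕ} (P : ProjData X N)

theorem isAlgebraic_of_pull {ψ : X ⟶ X} {M : ℕ} (hM : P.Pull ψ M) {p : X}
    {F K : Type u} [Field F] [Field K] [Algebra k F] [Algebra k K] [Algebra K F]
    [IsScalarTower k K F] [FiniteDimensional K F]
    (α : X.presheaf.stalk p →+* F) [IsLocalHom α]
    (hα : ∀ c, algebraMap k F c = α (stalkConst sX p c)) (hsurj : Function.Surjective α)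
    (αc : X.presheaf.stalk (ψ p) →+* K)
    (hcomp : ∀ y, algebraMap K F (αc y) = α ((ψ.stalkMap p).hom y))
    {e : ℕ} (w : Fin (e + 1) → Fin N → k) (hw : P.Nondeg sX (ψ p) w)
    (h0 : ∀ i, αc (P.lin sX (w i) (ψ p)) ≠ 0)
    (hind : ∀ i, AlgebraicIndependent k (affCoord (fun i => αc (P.lin sX (w i) (ψ p))) i))
    (hfin : FiniteDimensional (IntermediateField.adjoin k
        (Set.range (affCoord (fun i => αc (P.lin sX (w i) (ψ p))) 0))) K)
    (hlt : Module.finrank (IntermediateField.adjoin k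
        (Set.range (affCoord (fun i => αc (P.lin sX (w i) (ψ p))) 0))) K * Module.finrank K F < M) :
    Algebra.IsAlgebraic k F := by
  set s' : Fin (e + 1) → K := fun i => αc (P.lin sX (w i) (ψ p)) with hs'
  let K0 := IntermediateField.adjoin k (Set.range (affCoord s' 0))
  obtain ⟨T, hT, hTs⟩ := isProjGen_adjoin h0 hind
  let s : Fin (e + 1) → F := fun i => algebraMap K F (s' i)
  have hs0 : ∀ i, s i ≠ 0 := fun i => (map_ne_zero _).2 (h0 i)
  haveI : FiniteDimensional K0 F := FiniteDimensional.trans K0 K F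
  have hdeg : Module.finrank K0 F < M := by
    rw [← Module.finrank_mul_finrank K0 K F]
    exact hlt
  have hsT : ∀ i, s i = s 0 * algebraMap K0 F (T i / T 0) := by
    intro i
    rw [IsScalarTower.algebraMap_apply K0 K F]
    show _ = _ * algebraMap K F ((T i : K) / (T 0 : K))
    rw [hTs, hTs, div_self (h0 0), div_one, ← map_mul, mul_div_cancel₀ _ (h0 0)]
  obtain ⟨h, hh⟩ := hM p
  have hfin : ∀ (a : Fin N → k) (i), IsIntegral (Algebra.adjoin k (Set.range fun j => s j / s i))
      ((α h)⁻¹ * (∑ l, algebraMap k F (a l) * α (P.g p l)) ^ M / s i) := by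
    intro a i
    have ha : ∑ l, algebraMap k F (a l) * α (P.g p l) = α (P.lin sX a p) := by
      simp only [lin, map_sum, map_mul, hα]
    rw [ha]
    refine isIntegral_of_forall_valuationSubring _ _ fun O hO => ?_
    obtain ⟨x, ⟨c⟩⟩ := exists_center sX α O fun c => hα c ▸ hO (algebraMap_mem _ c)
    obtain ⟨i', hi'⟩ := hw (ψ x) (map_specializes ψ c.sp)
    obtain ⟨v, hv⟩ := hh x c.sp
    obtain ⟨b, hb⟩ := hi'
    let b' := Units.map c.β.toMonoidHom (Units.map (ψ.stalkMap x).hom.toMonoidHom b)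
    have hvv := congrArg α hv
    rw [map_mul, map_mul, map_pow] at hvv
    have hsi : s i' = α ((ψ.stalkMap p).hom (P.c (map_specializes ψ c.sp))) * ((b' : O) : F) := by
      show algebraMap K F (αc _) = _
      rw [hcomp, P.lin_compat sX (w i') (map_specializes ψ c.sp), map_mul, map_mul]
      congr 1
      have e1 := stalkMap_stalkSp ψ c.sp (P.lin sX (w i') (ψ x))
      rw [e1, ← hb]
      exact (c.comp _).symm
    have hb0 : ((b' : O) : F) ≠ 0 := fun h => b'.ne_zero (Subtype.ext h)
    have hC0 : α ((ψ.stalkMap p).hom (P.c (map_specializes ψ c.sp))) ≠ 0 := by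
      intro h
      exact hs0 i' (by rw [hsi, h, zero_mul])
    have hh0 : α h ≠ 0 := (h.isUnit.map α).ne_zero
    let v' := Units.map c.β.toMonoidHom v
    have hv' : ((v' : O) : F) = α (stalkSp c.sp v) := c.comp v
    have hv0 : ((v' : O) : F) ≠ 0 := fun h => v'.ne_zero (Subtype.ext h)
    have hinvO : ∀ y : Oˣ, ((y : O) : F)⁻¹ ∈ O := by
      intro y
      have : ((y : O) : F)⁻¹ = ((y⁻¹ : Oˣ) : O) := by
        refine inv_eq_of_mul_eq_one_right ?_
        exact congrArg Subtype.val (Units.mul_inv y)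
      rw [this]
      exact Subtype.property _
    have hkey : (α h)⁻¹ * α (P.lin sX a p) ^ M / s i =
        ((v' : O) : F)⁻¹ * ((b' : O) : F)⁻¹ * (c.β (P.lin sX a x) : F) ^ M * (s i' / s i) := by
      rw [P.lin_compat sX a c.sp, map_mul, ← c.comp, hsi]
      rw [← hv'] at hvv
      have := hs0 i
      field_simp
      linear_combination (c.β (P.lin sX a x) : F) ^ M * hvv
    rw [hkey]
    refine mul_mem (mul_mem (mul_mem (hinvO _) (hinvO _)) (pow_mem (Subtype.property _) _)) ?_
    exact hO (Algebra.subset_adjoin ⟨i', rfl⟩)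
  obtain ⟨j, hj⟩ := P.cover p
  have hjz := (((P.mem_iff p j).1 hj).map α).ne_zero
  have halg := fun l => hT.isAlgebraic_ratio (hs0 0) hsT hdeg (fun l => α (P.g p l))
    (inv_ne_zero (h.isUnit.map α).ne_zero) hfin l j hjz
  have hbot : Algebra.IsAlgebraic (⊥ : IntermediateField k F) F := by
    refine P.isAlgebraic_of_germ sX α hα hsurj ⊥ j hj fun l => ?_
    exact (halg l).tower_top _
  haveI : Algebra.IsAlgebraic k (⊥ : IntermediateField k F) := inferInstance
  exact Algebra.IsAlgebraic.trans k (⊥ : IntermediateField k F) F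

end ProjData

section Covers

variable {X Y : Scheme.{u}}

lemma finrank_eq_of_field {κ : CommRingCat.{u}} (hκ : IsField κ) (f : X ⟶ Spec κ)
    [IsFinite f] [Flat f]
    (ρ : κ →+* Γ(X, ⊤)) (hρ : ρ = (f.appTop.hom).comp (Scheme.ΓSpecIso κ).inv.hom)
    (p : Spec κ) :
    letI := ρ.toAlgebra
    Module.Finite κ Γ(X, ⊤) ∧ f.finrank p = Module.finrank κ Γ(X, ⊤) ∧
      (Etale f → Algebra.FormallyEtale κ Γ(X, ⊤)) := by
  letI := ρ.toAlgebra
  haveI : IsAffine X := isAffine_of_isAffineHom f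
  have e1 : X.isoSpec.inv ≫ f = Spec.map (CommRingCat.ofHom ρ) := by
    have : CommRingCat.ofHom ρ = (Scheme.ΓSpecIso κ).inv ≫ f.appTop := by
      ext c; rw [hρ]; rfl
    rw [this, Spec.map_comp, Iso.inv_comp_eq, Scheme.isoSpec_hom_naturality_assoc,
      Scheme.isoSpec_Spec_hom, ← Spec.map_comp, Iso.inv_hom_id, Spec.map_id]
    exact (Category.comp_id f).symm
  have hfin : IsFinite (Spec.map (CommRingCat.ofHom ρ)) := e1 ▸ inferInstance
  rw [IsFinite.SpecMap_iff] at hfin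
  have hfin' : Module.Finite κ Γ(X, ⊤) := hfin
  have hfl : Flat (Spec.map (CommRingCat.ofHom ρ)) := e1 ▸ inferInstance
  rw [Flat.SpecMap_iff] at hfl
  refine ⟨hfin', ?_, fun he => ?_⟩
  · rw [← Scheme.Hom.finrank_comp_left_of_isIso X.isoSpec.inv, e1,
      Scheme.Hom.finrank_SpecMap_eq_finrank hfin hfl]
    have h2 : (CommRingCat.ofHom ρ).hom.finrank = Module.rankAtStalk (R := κ) Γ(X, ⊤) := rfl
    letI := hκ.toField
    haveI : Module.Free κ Γ(X, ⊤) := Module.Free.of_divisionRing κ Γ(X, ⊤)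
    rw [h2, Module.rankAtStalk_eq_finrank_of_free]
    rfl
  · have h3 : Etale (Spec.map (CommRingCat.ofHom ρ)) := e1 ▸ inferInstance
    have h4 : ρ.Etale := (HasRingHomProperty.Spec_iff (P := @Etale)).mp h3
    have h5 : Algebra.Etale κ Γ(X, ⊤) := h4
    infer_instance

lemma residueDegree_le_finrank (f : X ⟶ Y) [IsFinite f] [Flat f] (x : X) :
    (f.residueFieldMap x).hom.Finite ∧ f.residueDegree x ≤ f.finrank (f x) := by
  haveI : IsFinite (f.fiberToSpecResidueField (f x)) :=
    inferInstanceAs (IsFinite (pullback.snd f (Y.fromSpecResidueField (f x))))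
  haveI : Flat (f.fiberToSpecResidueField (f x)) :=
    inferInstanceAs (Flat (pullback.snd f (Y.fromSpecResidueField (f x))))
  haveI : IsAffine (f.fiber (f x)) := isAffine_of_isAffineHom (f.fiberToSpecResidueField (f x))
  obtain ⟨p, hp⟩ : ∃ p, Y.fromSpecResidueField (f x) p = f x := ⟨default, by simp⟩
  have key := finrank_eq_of_field (Field.toIsField _) (f.fiberToSpecResidueField (f x)) _ rfl p
  set ρ := ((f.fiberToSpecResidueField (f x)).appTop.hom).comp
    (Scheme.ΓSpecIso (Y.residueField (f x))).inv.hom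
  letI := ρ.toAlgebra
  obtain ⟨h1, h2, -⟩ := key
  have h3 : f.finrank (f x) = (f.fiberToSpecResidueField (f x)).finrank p := by
    refine Eq.trans (congrArg f.finrank hp.symm) ?_
    exact (Scheme.Hom.finrank_pullback_snd f _ p).symm
  have hcl : IsClosed {f.asFiber x} := by
    haveI := (f.isDiscrete_preimage_singleton (f x)).to_subtype
    haveI := (f.fiberHomeo (f x)).symm.discreteTopology
    exact isClosed_discrete _
  haveI : IsClosedImmersion (f.asFiberHom x) :=
    .of_isPreimmersion _ (by rw [Scheme.Hom.range_asFiberHom]; exact hcl)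
  have hsurj := (IsClosedImmersion.isAffine_surjective_of_isAffine (f.asFiberHom x)).2
  letI := (f.residueFieldMap x).hom.toAlgebra
  let π : Γ(f.fiber (f x), ⊤) →+* X.residueField x :=
    (Scheme.ΓSpecIso (X.residueField x)).hom.hom.comp (f.asFiberHom x).appTop.hom
  have hπ : ∀ c, π (ρ c) = (f.residueFieldMap x).hom c := by
    intro c
    have h5 := f.asFiberHom_fiberToSpecResidueField x
    have h6 : (Scheme.ΓSpecIso _).inv ≫ (f.fiberToSpecResidueField (f x)).appTop ≫
        (f.asFiberHom x).appTop ≫ (Scheme.ΓSpecIso _).hom = f.residueFieldMap x := by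
      rw [← Scheme.Hom.comp_appTop_assoc, h5, Scheme.ΓSpecIso_naturality, Iso.inv_hom_id_assoc]
    exact congrArg (fun g : Y.residueField (f x) ⟶ X.residueField x => g.hom c) h6
  have hπs : Function.Surjective π :=
    (ConcreteCategory.bijective_of_isIso (Scheme.ΓSpecIso (X.residueField x)).hom).2.comp hsurj
  let πl : Γ(f.fiber (f x), ⊤) →ₗ[Y.residueField (f x)] X.residueField x :=
    { toFun := π, map_add' := π.map_add, map_smul' := fun c y => by
        rw [Algebra.smul_def, map_mul]
        exact congrArg (· * π y) (hπ c) }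
  refine ⟨Module.Finite.of_surjective πl hπs, ?_⟩
  rw [h3, h2]
  exact LinearMap.finrank_le_finrank_of_surjective (f := πl) hπs

lemma finrank_eq_ncard (f : X ⟶ Y) [IsFinite f] [Etale f] (y : Y) [IsAlgClosed (Y.residueField y)] :
    f.finrank y = (f ⁻¹' {y}).ncard := by
  haveI : IsFinite (f.fiberToSpecResidueField y) :=
    inferInstanceAs (IsFinite (pullback.snd f (Y.fromSpecResidueField y)))
  haveI : Etale (f.fiberToSpecResidueField y) :=
    inferInstanceAs (Etale (pullback.snd f (Y.fromSpecResidueField y)))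
  haveI : IsAffine (f.fiber y) := isAffine_of_isAffineHom (f.fiberToSpecResidueField y)
  obtain ⟨p, hp⟩ : ∃ p, Y.fromSpecResidueField y p = y := ⟨default, by simp⟩
  have key := finrank_eq_of_field (Field.toIsField _) (f.fiberToSpecResidueField y) _ rfl p
  set ρ := ((f.fiberToSpecResidueField y).appTop.hom).comp
    (Scheme.ΓSpecIso (Y.residueField y)).inv.hom
  letI := ρ.toAlgebra
  obtain ⟨h1, h2, h3⟩ := key
  haveI := h3 inferInstance
  have h4 : f.finrank y = (f.fiberToSpecResidueField y).finrank p := by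
    conv_lhs => rw [← hp]
    exact (Scheme.Hom.finrank_pullback_snd f _ p).symm
  haveI : IsArtinianRing Γ(f.fiber y, ⊤) := isArtinian_of_tower (Y.residueField y) inferInstance
  rw [h4, h2, (Algebra.FormallyEtale.equivPiOfIsSepClosed (Y.residueField y)
    Γ(f.fiber y, ⊤)).toLinearEquiv.finrank_eq]
  letI := Fintype.ofFinite (PrimeSpectrum Γ(f.fiber y, ⊤))
  rw [Module.finrank_fintype_fun_eq_card, ← Nat.card_eq_fintype_card, ← Nat.card_coe_set_eq]
  exact Nat.card_congr ((f.fiber y).isoSpec.hom.homeomorph.symm.toEquiv.trans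
    (f.fiberHomeo y).toEquiv)

lemma isOpen_connectedComponent_of_finite {T : Type*} [TopologicalSpace T]
    [Finite (ConnectedComponents T)] (x : T) : IsOpen (connectedComponent x) := by
  have h : (connectedComponent x)ᶜ =
      ⋃ c ∈ {c : ConnectedComponents T | c ≠ ConnectedComponents.mk x},
        ConnectedComponents.mk ⁻¹' {c} := by
    ext y
    simp only [← connectedComponents_preimage_singleton, Set.mem_compl_iff, Set.mem_preimage,
      Set.mem_singleton_iff, Set.mem_ofPred_eq, Set.mem_iUnion, exists_prop, exists_eq_right']
  rw [← isClosed_compl_iff, h]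
  refine Set.Finite.isClosed_biUnion (Set.toFinite _) fun c _ => ?_
  obtain ⟨y, rfl⟩ := ConnectedComponents.surjective_coe c
  rw [connectedComponents_preimage_singleton]
  exact isClosed_connectedComponent

lemma exists_connected_residueDegree_le {W : Scheme.{u}} (q : W ⟶ Y) [IsFinite q] [Etale q]
    [IsIntegral Y] {n : ℕ} (hn : ∀ (Z : Scheme.{u}) (p : Z ⟶ Y), IsFinite p → Etale p →
      ConnectedSpace Z → ∀ y : Y, (p ⁻¹' {y}).ncard ≤ n)
    {y : Y} (hy : IsAlgClosed (Y.residueField y)) (x : W) :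
    ∃ (Z : Scheme.{u}) (i : Z ⟶ W) (z : Z), i z = x ∧
      ((i ≫ q).residueFieldMap z).hom.Finite ∧ (i ≫ q).residueDegree z ≤ n := by
  haveI : Finite (_root_.ConnectedComponents W) :=
    IsOpenMap.finite_connectedComponents_of_finite_preimage_singleton_of_connectedSpace
      q.isOpenMap q.isClosedMap (q.finite_preimage_singleton y)
  let V : W.Opens := ⟨connectedComponent x, isOpen_connectedComponent_of_finite x⟩
  haveI : IsClosedImmersion V.ι := .of_isPreimmersion _ (by
    rw [Scheme.Opens.range_ι]; exact isClosed_connectedComponent)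
  haveI : ConnectedSpace V := isConnected_iff_connectedSpace.mp isConnected_connectedComponent
  let z : V := ⟨x, mem_connectedComponent⟩
  have h1 := residueDegree_le_finrank (V.ι ≫ q) z
  refine ⟨V, V.ι, z, rfl, h1.1, h1.2.trans ?_⟩
  have h2 := (Scheme.Hom.isLocallyConstant_finrank (V.ι ≫ q)).apply_eq_of_preconnectedSpace
    ((V.ι ≫ q) z) y
  rw [h2, finrank_eq_ncard]
  exact hn _ _ inferInstance inferInstance inferInstance y

lemma finite_of_comp_eq {K F K' F' : Type*} [Field K] [Field F] [Field K'] [Field F']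
    (r₁ : K →+* F) (r₂ : F →+* F') (s₁ : K →+* K') (s₂ : K' →+* F') (h : r₂.comp r₁ = s₂.comp s₁)
    (hs : Function.Surjective s₁) (hf : s₂.Finite) {n : ℕ}
    (hn : letI := s₂.toAlgebra; Module.finrank K' F' ≤ n) :
    letI := r₁.toAlgebra; Module.Finite K F ∧ Module.finrank K F ≤ n := by
  letI := r₁.toAlgebra
  letI := s₂.toAlgebra
  letI : Algebra K F' := (s₂.comp s₁).toAlgebra
  letI : Algebra K K' := s₁.toAlgebra
  haveI : IsScalarTower K K' F' := IsScalarTower.of_algebraMap_eq fun _ => rfl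
  haveI : Module.Finite K' F' := hf
  haveI : Module.Finite K K' := Module.Finite.of_surjective (Algebra.linearMap K K') hs
  haveI : Module.Finite K F' := Module.Finite.trans K' F'
  have h1 : Module.finrank K F' = Module.finrank K' F' := by
    have : Module.finrank K K' = 1 := by
      rw [finrank_eq_one_iff']
      exact ⟨1, one_ne_zero, fun w => by
        obtain ⟨c, rfl⟩ := hs w
        exact ⟨c, by rw [Algebra.smul_def, mul_one]; rfl⟩⟩
    rw [← Module.finrank_mul_finrank K K' F', this, one_mul]
  have hl' : ∀ (c : K) (x : F), r₂ (c • x) = c • r₂ x := fun c x => by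
    rw [Algebra.smul_def, map_mul, Algebra.smul_def]
    exact congrArg (· * r₂ x) (DFunLike.congr_fun h c)
  let l : F →ₗ[K] F' := { toFun := r₂, map_add' := r₂.map_add, map_smul' := hl' }
  have hl : Function.Injective l := r₂.injective
  exact ⟨Module.Finite.of_injective l hl, (LinearMap.finrank_le_finrank_of_injective hl).trans
    (h1.le.trans hn)⟩

lemma residueFieldMap_surjective (j : Y ⟶ X) [IsClosedImmersion j] (y : Y) :
    Function.Surjective (j.residueFieldMap y).hom := by
  have h := Scheme.residue_residueFieldMap j y
  intro a
  obtain ⟨b, rfl⟩ := Scheme.residue_surjective Y y a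
  obtain ⟨c, rfl⟩ := j.stalkMap_surjective y b
  exact ⟨(X.residue (j y)).hom c, congrArg (fun g : X.presheaf.stalk (j y) ⟶ Y.residueField y =>
    g.hom c) h⟩

lemma exists_residueDegree_le (ψ : X ⟶ X) [IsFinite ψ] [Etale ψ] [Surjective ψ]
    (j : Y ⟶ X) [IsClosedImmersion j]
    [IsIntegral Y] {n : ℕ} (hn : ∀ (Z : Scheme.{u}) (p : Z ⟶ Y), IsFinite p → Etale p →
      ConnectedSpace Z → ∀ y : Y, (p ⁻¹' {y}).ncard ≤ n)
    {y : Y} (hy : IsAlgClosed (Y.residueField y)) (y₀ : Y) :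
    ∃ p : X, ψ p = j y₀ ∧ (ψ.residueFieldMap p).hom.Finite ∧ ψ.residueDegree p ≤ n := by
  obtain ⟨x, hx⟩ := (pullback.snd ψ j).surjective y₀
  obtain ⟨Z, i, z, hz, h1, h2⟩ := exists_connected_residueDegree_le (pullback.snd ψ j) hn hy x
  have hcomm : (i ≫ pullback.fst ψ j) ≫ ψ = (i ≫ pullback.snd ψ j) ≫ j := by
    simp [pullback.condition]
  generalize i ≫ pullback.fst ψ j = a at *
  have h3 : (i ≫ pullback.snd ψ j) z = y₀ := by rw [← hx, ← hz]; rfl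
  generalize i ≫ pullback.snd ψ j = b at *
  refine ⟨a z, ?_, ?_⟩
  · rw [← h3]
    exact congrArg (fun f : Z ⟶ X => f z) hcomm
  · have h4 := Scheme.Hom.residueFieldMap_congr hcomm z
    rw [Scheme.residueFieldMap_comp, Scheme.residueFieldMap_comp] at h4
    refine finite_of_comp_eq (ψ.residueFieldMap (a z)).hom (a.residueFieldMap z).hom
      ((j.residueFieldMap (b z)).hom.comp (X.residueFieldCongr _).hom.hom) (b.residueFieldMap z).hom
      (congrArg (fun g => CommRingCat.Hom.hom g) h4)
      ((residueFieldMap_surjective j (b z)).comp (ConcreteCategory.bijective_of_isIso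
        (X.residueFieldCongr _).hom).2) h1 h2

end Covers

section EtaleSelfMap

variable {k : Type u} [Field k] {X : Scheme.{u}}
  (sX : X ⟶ Spec (CommRingCat.of k))

lemma isClosed_of_isAlgebraic_residueField [IsAlgClosed k] [LocallyOfFiniteType sX] (p : X)
    (h : letI := ((X.residue p).hom.comp (stalkConst sX p)).toAlgebra
      Algebra.IsAlgebraic k (X.residueField p)) : IsClosed {p} := by
  letI := ((X.residue p).hom.comp (stalkConst sX p)).toAlgebra
  haveI : Algebra.IsAlgebraic k (X.residueField p) := h
  haveI : JacobsonSpace X := LocallyOfFiniteType.jacobsonSpace sX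
  have h1 : X.fromSpecResidueField p ≫ sX =
      Spec.map (CommRingCat.ofHom ((X.residue p).hom.comp (stalkConst sX p))) := by
    rw [Scheme.fromSpecResidueField, Category.assoc, fromSpecStalk_comp_str, ← Spec.map_comp]
    rfl
  have h2 : Function.Bijective ((X.residue p).hom.comp (stalkConst sX p)) :=
    IsAlgClosed.algebraMap_bijective_of_isIntegral (k := k) (K := X.residueField p)
  have h3 : IsIso (CommRingCat.ofHom ((X.residue p).hom.comp (stalkConst sX p))) :=
    (ConcreteCategory.isIso_iff_bijective _).2 h2
  have h4 : LocallyOfFiniteType (X.fromSpecResidueField p ≫ sX) := by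
    rw [h1]; infer_instance
  rw [isClosed_singleton_iff_locallyOfFiniteType]
  exact locallyOfFiniteType_of_comp _ sX

lemma Etale.locallyQuasiFinite {X Y : Scheme.{u}} (f : X ⟶ Y) [Etale f] :
    LocallyQuasiFinite f := by
  refine ⟨fun {U} hU {V} hV e => ?_⟩
  have h : (f.appLE U V e).hom.Etale :=
    HasRingHomProperty.appLE @Etale f inferInstance ⟨U, hU⟩ ⟨V, hV⟩ e
  algebraize [(f.appLE U V e).hom]
  exact (inferInstance : Algebra.QuasiFinite Γ(Y, U) Γ(X, V))

lemma isFinite_of_etale [IsProper sX] (φ : X ⟶ X) (hφ : φ ≫ sX = sX) [Etale φ] : IsFinite φ := by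
  haveI : IsProper (φ ≫ sX) := by rw [hφ]; infer_instance
  exact (IsFinite.iff_isProper_and_locallyQuasiFinite φ).2
    ⟨IsProper.of_comp φ sX, Etale.locallyQuasiFinite φ⟩

lemma surjective_of_etale [IsIntegral X] (φ : X ⟶ X) [IsFinite φ] [Etale φ] : Surjective φ := by
  refine ⟨Set.range_eq_univ.1 (IsClopen.eq_univ ⟨φ.isClosedMap.isClosed_range,
    φ.isOpenMap.isOpen_range⟩ (Set.range_nonempty _))⟩

lemma iterHom_properties {φ : X ⟶ X} [IsFinite φ] [Etale φ] [Surjective φ] (hφ : φ ≫ sX = sX)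
    (n : ℕ) : IsFinite (iterHom φ n) ∧ Etale (iterHom φ n) ∧ Surjective (iterHom φ n) ∧
      iterHom φ n ≫ sX = sX := by
  induction n with
  | zero => exact ⟨inferInstanceAs (IsFinite (𝟙 X)), inferInstanceAs (Etale (𝟙 X)),
      inferInstanceAs (Surjective (𝟙 X)), Category.id_comp _⟩
  | succ n ih =>
    obtain ⟨h1, h2, h3, h4⟩ := ih
    refine ⟨inferInstanceAs (IsFinite (φ ≫ iterHom φ n)), inferInstanceAs (Etale (φ ≫ iterHom φ n)),
      inferInstanceAs (Surjective (φ ≫ iterHom φ n)), ?_⟩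
    show (φ ≫ iterHom φ n) ≫ sX = sX
    rw [Category.assoc, h4, hφ]

lemma exists_bound_of_residueDegree [IsAlgClosed k] [IsProper sX] {N : ℕ} (P : ProjData X N)
    (z : X) :
    ∃ B : ℕ, ∀ (ψ : X ⟶ X) (M : ℕ), ψ ≫ sX = sX → P.Pull ψ M → ∀ p, ψ p = z →
      (ψ.residueFieldMap p).hom.Finite → B * ψ.residueDegree p < M → IsClosed {p} := by
  letI : Algebra k (X.residueField z) := ((X.residue z).hom.comp (stalkConst sX z)).toAlgebra
  haveI (x : X) : IsLocalHom (X.residue x).hom :=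
    inferInstanceAs (IsLocalHom (IsLocalRing.residue (X.presheaf.stalk x)))
  obtain ⟨e, w, hw, h0, hind, hfin⟩ := P.exists_noether sX (X.residue z).hom (fun _ => rfl)
    (Scheme.residue_surjective X z)
  refine ⟨Module.finrank (IntermediateField.adjoin k (Set.range (affCoord
    (fun i => (X.residue z).hom (P.lin sX (w i) z)) 0))) (X.residueField z),
    fun ψ M hψ hM p hp hψp hlt => ?_⟩
  · subst hp
    refine isClosed_of_isAlgebraic_residueField sX p ?_
    letI : Algebra k (X.residueField p) := ((X.residue p).hom.comp (stalkConst sX p)).toAlgebra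
    letI : Algebra (X.residueField (ψ p)) (X.residueField p) := (ψ.residueFieldMap p).hom.toAlgebra
    have hres : ∀ y, (ψ.residueFieldMap p).hom ((X.residue (ψ p)).hom y) =
        (X.residue p).hom ((ψ.stalkMap p).hom y) := fun y =>
      congrArg (fun g : X.presheaf.stalk (ψ p) ⟶ X.residueField p => g.hom y)
        (Scheme.residue_residueFieldMap ψ p)
    haveI : IsScalarTower k (X.residueField (ψ p)) (X.residueField p) :=
      IsScalarTower.of_algebraMap_eq fun c => by
        refine Eq.trans ?_ (hres _).symm
        exact congrArg (X.residue p).hom (stalkMap_stalkConst sX ψ sX hψ p c).symm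
    haveI : FiniteDimensional (X.residueField (ψ p)) (X.residueField p) := hψp
    exact P.isAlgebraic_of_pull sX hM (X.residue p).hom (fun _ => rfl)
      (Scheme.residue_surjective X p) (X.residue (ψ p)).hom hres w hw h0 hind hfin hlt

theorem not_hasFiniteAlgebraicPi1 [IsAlgClosed k] [IsIntegral X] [IsProper sX] {N : ℕ}
    (P : ProjData X N)
    {φ : X ⟶ X} (hφ : φ ≫ sX = sX) [Etale φ] {d : ℕ} (hd : 1 < d) (hP : P.Pull φ d)
    {Y : Scheme.{u}} (j : Y ⟶ X) [IsClosedImmersion j] [IsIntegral Y]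
    (hY : 0 < topologicalKrullDim Y) : ¬ HasFiniteAlgebraicPi1 Y := by
  rintro ⟨n, hn⟩
  haveI := isFinite_of_etale sX φ hφ
  haveI := surjective_of_etale φ
  haveI : JacobsonSpace Y := LocallyOfFiniteType.jacobsonSpace (j ≫ sX)
  obtain ⟨y, -, hy⟩ := nonempty_inter_closedPoints (X := Y) (Z := Set.univ)
    Set.univ_nonempty isClosed_univ.isLocallyClosed
  have hy' : IsAlgClosed (Y.residueField y) :=
    IsAlgClosed.of_ringEquiv k _ (residueFieldIsoBase (j ≫ sX) y hy).symm.commRingCatIsoToRingEquiv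
  obtain ⟨B, hB⟩ := exists_bound_of_residueDegree sX P (j (genericPoint Y))
  obtain ⟨m, hm⟩ := pow_unbounded_of_one_lt (B * n) hd
  obtain ⟨h1, h2, h3, h4⟩ := iterHom_properties sX hφ m
  obtain ⟨p, hp, hpf, hpn⟩ := exists_residueDegree_le (iterHom φ m) j hn hy' (genericPoint Y)
  have hcl := hB _ _ h4 (hP.iter m) p hp hpf ((Nat.mul_le_mul_left B hpn).trans_lt hm)
  have hcl2 : IsClosed {j (genericPoint Y)} := by
    rw [← hp, ← Set.image_singleton]
    exact (iterHom φ m).isClosedMap _ hcl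
  have hcl3 : IsClosed {genericPoint Y} := by
    have := hcl2.preimage j.continuous
    rwa [← Set.image_singleton, Set.preimage_image_eq _ j.isEmbedding.injective] at this
  have hsub : ∀ x : Y, x = genericPoint Y := fun x =>
    (genericPoint_specializes x).mem_closed hcl3 rfl
  haveI : Subsingleton Y := ⟨fun a b => (hsub a).trans (hsub b).symm⟩
  have h0 := topologicalKrullDim_zero_of_discreteTopology Y
  exact not_lt_of_ge h0 hY

end EtaleSelfMap

lemma exists_ne_zero_forall_mem {k V : Type*} [Field k] [AddCommGroup V] [Module k V]
    [FiniteDimensional k V] (W : ℕ → Submodule k V) (hW : Antitone W) (h : ∀ m, W m ≠ ⊥) :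
    ∃ v ≠ 0, ∀ m, v ∈ W m := by
  obtain ⟨n, hn⟩ := IsArtinian.monotone_stabilizes (R := k) (M := V)
    ⟨fun m => OrderDual.toDual (W m), fun a b hab => hW hab⟩
  obtain ⟨v, hv, hv0⟩ := (W n).ne_bot_iff.1 (h n)
  refine ⟨v, hv0, fun m => ?_⟩
  rcases le_total n m with hnm | hmn
  · have : W n = W m := hn m hnm
    exact this ▸ hv
  · exact hW hmn hv

/-- A descending family of divisibility conditions on "sections of the `l`-th power", each met by
some nonzero section, has a common nonzero solution (in a larger degree). -/
theorem exists_common_section {Ξ k F : Type*} [Field k] [Field F] [Algebra k F]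
    (R : Ξ → Subring F) (hk : ∀ x c, algebraMap k F c ∈ R x) (t : Ξ → F) (ht : ∀ x, t x ≠ 0)
    {e : ℕ} {s : Fin (e + 1) → F} (h0 : ∀ i, s i ≠ 0)
    (hind : ∀ i, AlgebraicIndependent k (affCoord s i))
    (hfin : FiniteDimensional (IntermediateField.adjoin k (Set.range (affCoord s 0))) F)
    (hsR : ∀ x i, s i / t x ∈ R x) (hnd : ∀ x, ∃ i, (s i / t x)⁻¹ ∈ R x)
    (hcen : ∀ O : ValuationSubring F, (∀ c, algebraMap k F c ∈ O) →
      ∃ x, (R x : Set F) ⊆ O)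
    (l : ℕ) (I : ℕ → Ξ → F) (hI : ∀ m x, I m x ∈ R x)
    (hI' : ∀ m x, ∃ r ∈ R x, I (m + 1) x = I m x * r)
    (G : ℕ → F) (hG0 : ∀ m, G m ≠ 0) (hG : ∀ m x, ∃ r ∈ R x, G m / t x ^ l = I m x * r) :
    ∃ (B : ℕ) (h : F), h ≠ 0 ∧ ∀ m x, ∃ r ∈ R x, h / t x ^ B = I m x * r := by
  let K0 := IntermediateField.adjoin k (Set.range (affCoord s 0))
  obtain ⟨T, hT, hTs⟩ := isProjGen_adjoin h0 hind
  have hsT : ∀ i, s i = s 0 * algebraMap K0 F (T i / T 0) := by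
    intro i
    show _ = _ * ((T i : F) / (T 0 : F))
    rw [hTs, hTs, div_self (h0 0), div_one, mul_div_cancel₀ _ (h0 0)]
  have hGR : ∀ m x, G m / t x ^ l ∈ R x := by
    intro m x
    obtain ⟨r, hr, h⟩ := hG m x
    rw [h]
    exact mul_mem (hI m x) hr
  have hinteg : ∀ m i, IsIntegral (Algebra.adjoin k (Set.range fun j => s j / s i))
      (G m / s i ^ l) := by
    intro m i
    refine isIntegral_of_forall_valuationSubring _ _ fun O hO => ?_
    obtain ⟨x, hx⟩ := hcen O fun c => hO (algebraMap_mem _ c)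
    obtain ⟨j, hj⟩ := hnd x
    have e1 : G m / s i ^ l = G m / t x ^ l * ((s j / t x)⁻¹ * (s j / s i)) ^ l := by
      have := h0 i
      have := h0 j
      have := ht x
      simp only [div_pow, mul_pow, inv_div]
      field_simp
    rw [e1]
    exact mul_mem (hx (hGR m x)) (pow_mem (mul_mem (hx hj)
      (hO (Algebra.subset_adjoin ⟨j, rfl⟩))) _)
  choose Q hQd hQn hQg using fun m => hT.exists_norm_eq (h0 0) hsT (G m) l (hinteg m)
  set B := l * Module.finrank K0 F
  let ev : MvPolynomial (Fin e) k →ₗ[k] F := LinearMap.mulLeft k (s 0 ^ B) ∘ₗ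
    (MvPolynomial.aeval fun j => algebraMap K0 F (affCoord T 0 j)).toLinearMap
  have hev : ∀ p, ev p = s 0 ^ B * algebraMap K0 F (MvPolynomial.aeval (affCoord T 0) p) := by
    intro p
    show s 0 ^ B * MvPolynomial.aeval _ p = _
    congr 1
    exact MvPolynomial.aeval_algebraMap_apply F (affCoord T 0) p
  have hevinj : ∀ p, ev p = 0 → p = 0 := by
    intro p hp
    rw [hev, mul_eq_zero, or_iff_right (pow_ne_zero _ (h0 0)), map_eq_zero] at hp
    exact (injective_iff_map_eq_zero' _).1 (hT.indep 0) p |>.1 hp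
  let W : ℕ → Submodule k (MvPolynomial.restrictTotalDegree (Fin e) k B) := fun m =>
    { carrier := {p | ∀ x, ∃ r ∈ R x, ev p / t x ^ B = I m x * r}
      zero_mem' := fun x => ⟨0, zero_mem _, by simp⟩
      add_mem' := fun {a b} ha hb x => by
        obtain ⟨r, hr, h⟩ := ha x
        obtain ⟨r', hr', h'⟩ := hb x
        refine ⟨r + r', add_mem hr hr', ?_⟩
        rw [Submodule.coe_add, map_add, add_div, h, h', mul_add]
      smul_mem' := fun c a ha x => by
        obtain ⟨r, hr, h⟩ := ha x
        refine ⟨algebraMap k F c * r, mul_mem (hk x c) hr, ?_⟩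
        rw [Submodule.coe_smul, map_smul, Algebra.smul_def, mul_div_assoc, h]
        ring }
  have hanti : Antitone W := by
    refine antitone_nat_of_succ_le fun m p hp x => ?_
    obtain ⟨r, hr, h⟩ := hp x
    obtain ⟨r', hr', h'⟩ := hI' m x
    exact ⟨r' * r, mul_mem hr' hr, by rw [h, h', mul_assoc]⟩
  have hmem : ∀ m, W m ≠ ⊥ := by
    intro m
    rw [Submodule.ne_bot_iff]
    refine ⟨⟨Q m, (MvPolynomial.mem_restrictTotalDegree _ _ _).2 (hQd m)⟩, fun x => ?_, fun h => ?_⟩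
    · obtain ⟨i, hi⟩ := hnd x
      obtain ⟨g, hg, hgi⟩ := hQg m i
      obtain ⟨r, hr, hrG⟩ := hG m x
      have hss : ∀ j, s j / s i ∈ R x := fun j => by
        have e1 : s j / s i = s j / t x * (s i / t x)⁻¹ := by
          have := h0 i
          have := ht x
          field_simp
        rw [e1]
        exact mul_mem (hsR x j) hi
      have hfi : G m / s i ^ l = I m x * (r * (s i / t x)⁻¹ ^ l) := by
        rw [← mul_assoc, ← hrG]
        have := h0 i
        have := ht x
        simp only [div_pow, inv_pow]
        field_simp
      have hgR : g ∈ R x := by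
        let S : Subalgebra k F := { R x with algebraMap_mem' := hk x }
        have hS : Algebra.adjoin k (Set.range (fun j => s j / s i) ∪ {G m / s i ^ l}) ≤ S := by
          rw [Algebra.adjoin_le_iff]
          rintro _ (⟨j, rfl⟩ | h)
          · exact hss j
          · rw [Set.mem_singleton_iff.1 h, hfi]
            exact mul_mem (hI m x) (mul_mem hr (pow_mem hi _))
        exact hS hg
      refine ⟨r * (s i / t x)⁻¹ ^ l * g * (s i / t x) ^ B, mul_mem (mul_mem (mul_mem hr
        (pow_mem hi _)) hgR) (pow_mem (hsR x i) _), ?_⟩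
      show ev (Q m) / _ = _
      have e2 : ev (Q m) / t x ^ B = (algebraMap K0 F (MvPolynomial.aeval (affCoord T 0) (Q m)) *
          (s 0 / s i) ^ B) * (s i / t x) ^ B := by
        rw [hev]
        have := h0 i
        have := ht x
        simp only [div_pow]
        field_simp
      rw [e2, hgi, hfi]
      ring
    · have hQ0 : Q m = 0 := congrArg Subtype.val h
      have h2 := hQn m
      rw [hQ0, map_zero, eq_comm, Algebra.norm_eq_zero_iff] at h2
      exact div_ne_zero (hG0 m) (pow_ne_zero _ (h0 0)) h2
  obtain ⟨p, hp0, hp⟩ := exists_ne_zero_forall_mem W hanti hmem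
  exact ⟨B, ev p, fun h => hp0 (Subtype.ext (hevinj _ h)), fun m x => hp m x⟩

section LocalRings

variable {X : Scheme.{u}} [IsIntegral X]

/-- The inclusion of a local ring into the function field. -/
abbrev toK (x : X) : X.presheaf.stalk x →+* X.functionField :=
  stalkSp (genericPoint_specializes x)

lemma toK_injective (x : X) : Function.Injective (toK x) :=
  IsFractionRing.injective (X.presheaf.stalk x) X.functionField

lemma toK_stalkSp {z x : X} (h : z ⤳ x) (a : X.presheaf.stalk x) :
    toK z (stalkSp h a) = toK x a := stalkSp_trans _ _ _

/-- The local rings as subrings of the function field. -/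
def locRing (x : X) : Subring X.functionField := (toK x).range

lemma toK_mem (x : X) (a : X.presheaf.stalk x) : toK x a ∈ locRing x := ⟨a, rfl⟩

lemma locRing_mono {z x : X} (h : z ⤳ x) : locRing x ≤ locRing z := by
  rintro _ ⟨a, rfl⟩
  exact ⟨stalkSp h a, toK_stalkSp h a⟩

lemma exists_opens_mem_locRing {x : X} {r : X.functionField} (hr : r ∈ locRing x) :
    ∃ V : X.Opens, x ∈ V ∧ ∀ y ∈ V, r ∈ locRing y := by
  obtain ⟨a, rfl⟩ := hr
  obtain ⟨V, hV, b, rfl⟩ := TopCat.Presheaf.exists_germ_eq X.presheaf a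
  refine ⟨V, hV, fun y hy => ⟨germHom X V y hy b, ?_⟩⟩
  exact (stalkSp_germHom _ hy b).trans (stalkSp_germHom _ hV b).symm

/-- A function which is a unit at `x`. -/
def IsU (x : X) (a : X.functionField) : Prop := a ∈ locRing x ∧ a⁻¹ ∈ locRing x

lemma isU_toK_iff (x : X) (a : X.presheaf.stalk x) (ha : a ≠ 0) : IsU x (toK x a) ↔ IsUnit a := by
  refine ⟨fun h => ?_, fun h => ⟨toK_mem x a, ?_⟩⟩
  · obtain ⟨b, hb⟩ := h.2
    refine IsUnit.of_mul_eq_one b (toK_injective x ?_)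
    rw [map_mul, hb, map_one]
    exact mul_inv_cancel₀ ((map_ne_zero_iff _ (toK_injective x)).2 ha)
  · obtain ⟨u, rfl⟩ := h
    refine ⟨(u⁻¹ : (X.presheaf.stalk x)ˣ), eq_inv_of_mul_eq_one_left ?_⟩
    rw [← map_mul, Units.inv_mul, map_one]

lemma IsU.mul {x : X} {a b : X.functionField} (ha : IsU x a) (hb : IsU x b) : IsU x (a * b) :=
  ⟨mul_mem ha.1 hb.1, by rw [mul_inv]; exact mul_mem ha.2 hb.2⟩

lemma IsU.inv {x : X} {a : X.functionField} (ha : IsU x a) : IsU x a⁻¹ :=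
  ⟨ha.2, by rw [inv_inv]; exact ha.1⟩

lemma IsU.pow {x : X} {a : X.functionField} (ha : IsU x a) (n : ℕ) : IsU x (a ^ n) :=
  ⟨pow_mem ha.1 n, by rw [← inv_pow]; exact pow_mem ha.2 n⟩

lemma IsU.mono {z x : X} (h : z ⤳ x) {a : X.functionField} (ha : IsU x a) : IsU z a :=
  ⟨locRing_mono h ha.1, locRing_mono h ha.2⟩

lemma IsU.of_mul {x : X} {a b : X.functionField} (hab : IsU x (a * b)) (ha : a ∈ locRing x)
    (hb : b ∈ locRing x) (hb0 : b ≠ 0) : IsU x a :=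
  ⟨ha, by
    have : a⁻¹ = (a * b)⁻¹ * b := by rw [mul_inv, mul_assoc, inv_mul_cancel₀ hb0, mul_one]
    rw [this]
    exact mul_mem hab.2 hb⟩

lemma exists_opens_isU {x : X} {r : X.functionField} (hr : IsU x r) :
    ∃ V : X.Opens, x ∈ V ∧ ∀ y ∈ V, IsU y r := by
  obtain ⟨V, hV, h⟩ := exists_opens_mem_locRing hr.1
  obtain ⟨W, hW, h'⟩ := exists_opens_mem_locRing hr.2
  exact ⟨V ⊓ W, ⟨hV, hW⟩, fun y hy => ⟨h y hy.1, h' y hy.2⟩⟩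

/-- Points specializing to `x` are determined by their primes in the local ring at `x`. -/
lemma eq_of_isUnit_stalkSp_iff {X : Scheme.{u}} {y z x : X} (hy : y ⤳ x) (hz : z ⤳ x)
    (h : ∀ a, IsUnit (stalkSp hy a) ↔ IsUnit (stalkSp hz a)) : y = z := by
  obtain ⟨V, hV, hxV, -⟩ := exists_isAffineOpen_mem_and_subset (TopologicalSpace.Opens.mem_top x)
  have key : ∀ {y z : X} (hy : y ⤳ x) (hz : z ⤳ x),
      (∀ a, IsUnit (stalkSp hy a) → IsUnit (stalkSp hz a)) → y ∈ closure {z} := by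
    intro y z hy hz h
    rw [mem_closure_iff]
    intro O hO hyO
    obtain ⟨f, hf, hyf⟩ := hV.exists_basicOpen_le (V := ⟨O, hO⟩) ⟨y, hyO⟩ (hy.mem_open V.2 hxV)
    rw [Scheme.mem_basicOpen _ _ _ (hy.mem_open V.2 hxV)] at hyf
    have h1 : IsUnit (stalkSp hy (germHom X V x hxV f)) := by rw [stalkSp_germHom]; exact hyf
    have h2 := h _ h1
    rw [stalkSp_germHom] at h2
    exact ⟨z, hf ((Scheme.mem_basicOpen _ _ _ (hz.mem_open V.2 hxV)).2 h2), rfl⟩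
  have h1 : z ⤳ y := specializes_iff_mem_closure.2 (key hy hz fun a => (h a).1)
  have h2 : y ⤳ z := specializes_iff_mem_closure.2 (key hz hy fun a => (h a).2)
  exact (h2.antisymm h1).eq

lemma exists_specializes_of_prime {X : Scheme.{u}} {x : X} (p : Ideal (X.presheaf.stalk x))
    [p.IsPrime] : ∃ (z : X) (hz : z ⤳ x), ∀ a, IsUnit (stalkSp hz a) ↔ a ∉ p := by
  let P : Spec (X.presheaf.stalk x) := ⟨p, inferInstance⟩
  have hP : X.fromSpecStalk x P ⤳ x := by
    have : X.fromSpecStalk x P ∈ Set.range (X.fromSpecStalk x) := ⟨P, rfl⟩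
    rwa [Scheme.range_fromSpecStalk] at this
  refine ⟨_, hP, fun a => ?_⟩
  obtain ⟨V, hV, b, rfl⟩ := TopCat.Presheaf.exists_germ_eq X.presheaf a
  have h1 := stalkSp_germHom hP hV b
  rw [h1]
  have h2 := Scheme.mem_basicOpen X b _ (hP.mem_open V.2 hV)
  refine h2.symm.trans ?_
  have h3 : P ∈ X.fromSpecStalk x ⁻¹ᵁ X.basicOpen b ↔
      P ∈ PrimeSpectrum.basicOpen (germHom X V x hV b) := by
    rw [Scheme.preimage_basicOpen, Scheme.fromSpecStalk_app hV]
    have h4 : ∀ (a : X.presheaf.stalk x) (W : (Spec (X.presheaf.stalk x)).Opens) (hPW : P ∈ W),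
        P ∈ (Spec (X.presheaf.stalk x)).basicOpen
          (((Spec (X.presheaf.stalk x)).presheaf.map (homOfLE (le_top : W ≤ ⊤)).op).hom
            ((Scheme.ΓSpecIso (X.presheaf.stalk x)).inv.hom a)) ↔
        P ∈ PrimeSpectrum.basicOpen a := by
      intro a W hPW
      rw [Scheme.basicOpen_res, basicOpen_eq_of_affine]
      exact ⟨fun h => h.2, fun h => ⟨hPW, h⟩⟩
    exact h4 _ _ (hP.mem_open V.2 hV)
  exact h3

end LocalRings

section Denominators

variable {k K : Type*} [Field k] [Field K] [Algebra k K]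

lemma adjoin_affCoord_le {e : ℕ} {s : Fin (e + 1) → K} (h0 : ∀ i, s i ≠ 0) (i i' : Fin (e + 1)) :
    IntermediateField.adjoin k (Set.range (affCoord s i)) ≤
      IntermediateField.adjoin k (Set.range (affCoord s i')) := by
  have key : ∀ j, s j / s i' ∈ IntermediateField.adjoin k (Set.range (affCoord s i')) := by
    intro j
    by_cases hj : j = i'
    · rw [hj, div_self (h0 i')]
      exact one_mem _
    · obtain ⟨l, rfl⟩ := Fin.exists_succAbove_eq hj
      exact IntermediateField.subset_adjoin _ _ ⟨l, rfl⟩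
  rw [IntermediateField.adjoin_le_iff]
  rintro _ ⟨l, rfl⟩
  have : affCoord s i l = (s (i.succAbove l) / s i') / (s i / s i') := by
    rw [affCoord, div_div_div_cancel_right₀ (h0 i')]
  show affCoord s i l ∈ IntermediateField.adjoin k (Set.range (affCoord s i'))
  rw [this]
  exact div_mem (key _) (key _)

open IntermediateField.algebraAdjoinAdjoin in
lemma exists_mem_adjoin_mul {e : ℕ} {s : Fin (e + 1) → K} (h0 : ∀ i, s i ≠ 0)
    (hfin : FiniteDimensional (IntermediateField.adjoin k (Set.range (affCoord s 0))) K)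
    (i : Fin (e + 1)) (R : Subring K) (hk : ∀ c, algebraMap k K c ∈ R)
    (hs : ∀ j, affCoord s i j ∈ R) {b : K} (hb : b ∈ R) (hb0 : b ≠ 0) :
    ∃ c ∈ Algebra.adjoin k (Set.range (affCoord s i)), c ≠ 0 ∧ ∃ r ∈ R, c = b * r := by
  let A := Algebra.adjoin k (Set.range (affCoord s i))
  have hL : IntermediateField.adjoin k (Set.range (affCoord s 0)) =
      IntermediateField.adjoin k (Set.range (affCoord s i)) :=
    le_antisymm (adjoin_affCoord_le h0 _ _) (adjoin_affCoord_le h0 _ _)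
  rw [hL] at hfin
  have hAR : ∀ a : A, (a : K) ∈ R := by
    intro a
    have : A ≤ ({ R with algebraMap_mem' := hk } : Subalgebra k K) := by
      rw [Algebra.adjoin_le_iff]
      rintro _ ⟨j, rfl⟩
      exact hs j
    exact this a.2
  have halg : Algebra.IsAlgebraic A K := by
    rw [IsFractionRing.comap_isAlgebraic_iff (A := A)
      (K := IntermediateField.adjoin k (Set.range (affCoord s i))) (C := K)]
    infer_instance
  let S := Algebra.adjoin A {b}
  have hSR : ∀ a : S, (a : K) ∈ R := by
    intro a
    have : S ≤ ({ R with algebraMap_mem' := hAR } : Subalgebra A K) := by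
      rw [Algebra.adjoin_le_iff, Set.singleton_subset_iff]
      exact hb
    exact this a.2
  let bS : S := ⟨b, Algebra.subset_adjoin rfl⟩
  have h1 : IsAlgebraic A bS := by
    rw [← isAlgebraic_algebraMap_iff (A := K) (FaithfulSMul.algebraMap_injective S K)]
    exact halg.isAlgebraic _
  have h2 : bS ∈ nonZeroDivisors S :=
    mem_nonZeroDivisors_of_ne_zero fun h => hb0 (congrArg Subtype.val h)
  obtain ⟨r, hr, y, hy⟩ := h1.exists_nonzero_dvd h2
  refine ⟨r, r.2, fun h => hr (Subtype.ext h), y, hSR y, ?_⟩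
  exact congrArg Subtype.val hy

lemma exists_pow_mul_div_mem {Ξ : Type*} (R : Ξ → Subring K) (hk : ∀ x c, algebraMap k K c ∈ R x)
    {t : Ξ → K} (ht : ∀ x, t x ≠ 0) {e : ℕ} {s : Fin (e + 1) → K} (h0 : ∀ i, s i ≠ 0)
    (hsR : ∀ x i, s i / t x ∈ R x) (i : Fin (e + 1)) {c : K}
    (hc : c ∈ Algebra.adjoin k (Set.range (affCoord s i))) :
    ∃ m : ℕ, ∀ x, c * s i ^ m / t x ^ m ∈ R x := by
  induction hc using Algebra.adjoin_induction with
  | mem y hy =>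
    obtain ⟨j, rfl⟩ := hy
    refine ⟨1, fun x => ?_⟩
    rw [pow_one, pow_one, affCoord, div_mul_cancel₀ _ (h0 i)]
    exact hsR x _
  | algebraMap r => exact ⟨0, fun x => by simpa using hk x r⟩
  | add a b _ _ ha hb =>
    obtain ⟨m, hm⟩ := ha
    obtain ⟨m', hm'⟩ := hb
    refine ⟨m + m', fun x => ?_⟩
    have : (a + b) * s i ^ (m + m') / t x ^ (m + m') =
        (a * s i ^ m / t x ^ m) * (s i / t x) ^ m' + (b * s i ^ m' / t x ^ m') *
          (s i / t x) ^ m := by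
      have := ht x
      simp only [div_pow]
      field_simp
      ring
    rw [this]
    exact add_mem (mul_mem (hm x) (pow_mem (hsR x i) _)) (mul_mem (hm' x) (pow_mem (hsR x i) _))
  | mul a b _ _ ha hb =>
    obtain ⟨m, hm⟩ := ha
    obtain ⟨m', hm'⟩ := hb
    refine ⟨m + m', fun x => ?_⟩
    have : a * b * s i ^ (m + m') / t x ^ (m + m') =
        (a * s i ^ m / t x ^ m) * (b * s i ^ m' / t x ^ m') := by
      rw [pow_add, pow_add, div_mul_div_comm]
      ring_nf
    rw [this]
    exact mul_mem (hm x) (hm' x)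

end Denominators

section LocalUnits

open Filter Topology

variable {X : Scheme.{u}} [IsIntegral X]

lemma eventually_mem_locRing {x : X} {r : X.functionField} (hr : r ∈ locRing x) :
    ∀ᶠ y in 𝓝 x, r ∈ locRing y := by
  obtain ⟨V, hV, h⟩ := exists_opens_mem_locRing hr
  exact eventually_of_mem (V.2.mem_nhds hV) h

lemma eventually_isU {x : X} {r : X.functionField} (hr : IsU x r) : ∀ᶠ y in 𝓝 x, IsU y r := by
  obtain ⟨V, hV, h⟩ := exists_opens_isU hr
  exact eventually_of_mem (V.2.mem_nhds hV) h

lemma exists_isU {e : ℕ} {s : Fin (e + 1) → X.functionField} {t : X → X.functionField}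
    (hsR : ∀ x i, s i / t x ∈ locRing x) (hnd : ∀ x, ∃ i, (s i / t x)⁻¹ ∈ locRing x) (x : X) :
    ∃ i, IsU x (s i / t x) := by
  obtain ⟨i, hi⟩ := hnd x
  exact ⟨i, hsR x i, hi⟩

lemma eventually_isU_div {e : ℕ} {s : Fin (e + 1) → X.functionField} {t : X → X.functionField}
    (ht : ∀ x, t x ≠ 0) (h0 : ∀ i, s i ≠ 0)
    (hsR : ∀ x i, s i / t x ∈ locRing x) (hnd : ∀ x, ∃ i, (s i / t x)⁻¹ ∈ locRing x)
    {x : X} {i : Fin (e + 1)} (hi : IsU x (s i / t x)) : ∀ᶠ y in 𝓝 x, IsU y (s i / t y) := by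
  have h1 : ∀ j, ∀ᶠ y in 𝓝 x, s j / s i ∈ locRing y := by
    intro j
    refine eventually_mem_locRing ?_
    have : s j / s i = s j / t x * (s i / t x)⁻¹ := by
      have := ht x
      have := h0 i
      field_simp
    rw [this]
    exact mul_mem (hsR x j) hi.2
  filter_upwards [eventually_all.2 h1] with y hy
  obtain ⟨j, hj⟩ := exists_isU hsR hnd y
  refine ⟨hsR y i, ?_⟩
  have : (s i / t y)⁻¹ = (s j / t y)⁻¹ * (s j / s i) := by
    have := ht y
    have := h0 i
    have := h0 j
    field_simp
  rw [this]
  exact mul_mem hj.2 (hy j)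

/-- A locally principal fractional ideal can be cleared by a section of a power of the
line bundle. -/
lemma exists_clear_denominators [CompactSpace X] {k : Type*} [Field k] [Algebra k X.functionField]
    (hk : ∀ (x : X) c, algebraMap k X.functionField c ∈ locRing x)
    {e : ℕ} {s : Fin (e + 1) → X.functionField} {t : X → X.functionField}
    (ht : ∀ x, t x ≠ 0) (h0 : ∀ i, s i ≠ 0)
    (hfin : FiniteDimensional (IntermediateField.adjoin k (Set.range (affCoord s 0)))
      X.functionField)
    (hsR : ∀ x i, s i / t x ∈ locRing x) (hnd : ∀ x, ∃ i, (s i / t x)⁻¹ ∈ locRing x)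
    {D : X → X.functionField} (hD0 : ∀ x, D x ≠ 0)
    (hD : ∀ x, ∀ᶠ y in 𝓝 x, IsU y (D y / D x)) :
    ∃ (l : ℕ) (ξ : X.functionField), ξ ≠ 0 ∧ ∀ x, ξ * D x / t x ^ l ∈ locRing x := by
  suffices ∃ (l : ℕ) (ξ : X.functionField), ξ ≠ 0 ∧ (∀ x, ξ / t x ^ l ∈ locRing x) ∧
      ∀ x ∈ (Set.univ : Set X), ξ * D x / t x ^ l ∈ locRing x by
    obtain ⟨l, ξ, h, -, h'⟩ := this
    exact ⟨l, ξ, h, fun x => h' x (Set.mem_univ x)⟩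
  refine isCompact_univ.induction_on
    (p := fun S : Set X => ∃ (l : ℕ) (ξ : X.functionField), ξ ≠ 0 ∧ (∀ x, ξ / t x ^ l ∈ locRing x) ∧
      ∀ x ∈ S, ξ * D x / t x ^ l ∈ locRing x) ?_ ?_ ?_ ?_
  · exact ⟨0, 1, one_ne_zero, fun x => by simp, fun x hx => hx.elim⟩
  · rintro S S' hSS ⟨l, ξ, h1, h2, h3⟩
    exact ⟨l, ξ, h1, h2, fun x hx => h3 x (hSS hx)⟩
  · rintro S S' ⟨l, ξ, h1, h2, h3⟩ ⟨l', ξ', h1', h2', h3'⟩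
    refine ⟨l + l', ξ * ξ', mul_ne_zero h1 h1', fun x => ?_, fun x hx => ?_⟩
    · rw [pow_add, mul_div_mul_comm]
      exact mul_mem (h2 x) (h2' x)
    · rcases hx with hx | hx
      · have : ξ * ξ' * D x / t x ^ (l + l') = ξ * D x / t x ^ l * (ξ' / t x ^ l') := by
          rw [pow_add, div_mul_div_comm]
          ring_nf
        rw [this]
        exact mul_mem (h3 x hx) (h2' x)
      · have : ξ * ξ' * D x / t x ^ (l + l') = ξ / t x ^ l * (ξ' * D x / t x ^ l') := by
          rw [pow_add, div_mul_div_comm]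
          ring_nf
        rw [this]
        exact mul_mem (h2 x) (h3' x hx)
  · intro x _
    obtain ⟨i, hi⟩ := exists_isU hsR hnd x
    obtain ⟨α, β, hβ, hαβ⟩ := IsFractionRing.div_surjective (A := X.presheaf.stalk x) (D x)
    change toK x α / toK x β = D x at hαβ
    have hβ0 : toK x β ≠ 0 := (map_ne_zero_iff _ (toK_injective x)).2 (nonZeroDivisors.ne_zero hβ)
    have hij : ∀ j, s j / s i ∈ locRing x := by
      intro j
      have : s j / s i = s j / t x * (s i / t x)⁻¹ := by
        have := ht x
        have := h0 i
        field_simp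
      rw [this]
      exact mul_mem (hsR x j) hi.2
    obtain ⟨c, hc, hc0, r, hr, hcr⟩ := exists_mem_adjoin_mul h0 hfin i (locRing x) (hk x)
      (fun j => hij _) (toK_mem x β) hβ0
    obtain ⟨m, hm⟩ := exists_pow_mul_div_mem (fun x => locRing x) hk ht h0 hsR i hc
    have hca : c * D x ∈ locRing x := by
      have : c * D x = toK x α * r := by
        rw [hcr, ← hαβ]
        field_simp
      rw [this]
      exact mul_mem (toK_mem x α) hr
    obtain ⟨V, hV, hVx⟩ := ((eventually_mem_locRing hca).and (hD x)).exists_mem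
    refine ⟨V, mem_nhdsWithin_of_mem_nhds hV, m, c * s i ^ m,
      mul_ne_zero hc0 (pow_ne_zero _ (h0 i)), hm, fun y hy => ?_⟩
    have : c * s i ^ m * D y / t y ^ m = (c * D x) * (D y / D x) * (s i / t y) ^ m := by
      have := ht y
      have := hD0 x
      simp only [div_pow]
      field_simp
    rw [this]
    exact mul_mem (mul_mem (hVx y hy).1 (hVx y hy).2.1) (pow_mem (hsR y i) m)

end LocalUnits

section Divisors

variable {X : Scheme.{u}} [IsIntegral X]

lemma IsU.of_div {x : X} {a b : X.functionField} (hb0 : b ≠ 0) (h : IsU x (a / b)) (hb : IsU x b) :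
    IsU x a := by
  have := h.mul hb
  rwa [div_mul_cancel₀ _ hb0] at this

lemma IsU.of_div' {x : X} {a b : X.functionField} (ha0 : a ≠ 0)
    (h : IsU x (a / b)) (ha : IsU x a) : IsU x b := by
  have := h.inv.mul ha
  rwa [inv_div, div_mul_cancel₀ _ ha0] at this

/-- A non-unit locus of a locally principal ideal contains a point of codimension one, and
any larger such locus contains no proper generization of it. -/
lemma exists_codim_one [IsLocallyNoetherian X] {u a : X → X.functionField}
    (hu0 : ∀ x, u x ≠ 0) (huR : ∀ x, u x ∈ locRing x) (hud : ∀ {z x : X}, z ⤳ x → IsU z (u z / u x))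
    (ha0 : ∀ x, a x ≠ 0) (haR : ∀ x, a x ∈ locRing x) (had : ∀ {z x : X}, z ⤳ x → IsU z (a z / a x))
    {y : X} (hy : ¬ IsU y (u y)) :
    ∃ z, ¬ IsU z (u z) ∧ ∀ w, w ⤳ z → ¬ IsU w (a w) → w = z := by
  obtain ⟨U, hU⟩ := huR y
  obtain ⟨A, hA⟩ := haR y
  have hU0 : U ≠ 0 := by
    rintro rfl
    exact hu0 y (by rw [← hU, map_zero])
  have hA0 : A ≠ 0 := by
    rintro rfl
    exact ha0 y (by rw [← hA, map_zero])
  have hUn : ¬ IsUnit U := by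
    rwa [← hU, isU_toK_iff y U hU0] at hy
  obtain ⟨p, hp, -⟩ := Ideal.exists_minimalPrimes_le
    (I := Ideal.span {U}) (J := IsLocalRing.maximalIdeal (X.presheaf.stalk y))
    ((Ideal.span_singleton_le_iff_mem _).2 ((IsLocalRing.mem_maximalIdeal U).2 hUn))
  have hpp : p.IsPrime := hp.1.1
  have hUp : U ∈ p := hp.1.2 (Ideal.mem_span_singleton_self U)
  have hht : p.height ≤ 1 := Ideal.height_le_one_of_isPrincipal_of_mem_minimalPrimes _ p hp
  obtain ⟨z, hz, hzp⟩ := exists_specializes_of_prime p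
  refine ⟨z, fun h => ?_, fun w hw hwa => ?_⟩
  · have h1 : IsU z (u y) := IsU.of_div' (hu0 z) (hud hz) h
    rw [← hU, ← toK_stalkSp hz, isU_toK_iff, hzp] at h1
    · exact h1 hUp
    · intro h0
      have : toK z (stalkSp hz U) = 0 := by rw [h0, map_zero]
      rw [toK_stalkSp, hU] at this
      exact hu0 y this
  · have hwy := hw.trans hz
    let q : Ideal (X.presheaf.stalk y) :=
      (IsLocalRing.maximalIdeal (X.presheaf.stalk w)).comap (stalkSp hwy)
    have hqp : q.IsPrime := Ideal.IsPrime.comap _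
    have hq : ∀ b, IsUnit (stalkSp hwy b) ↔ b ∉ q := fun b => by
      rw [Ideal.mem_comap, IsLocalRing.mem_maximalIdeal, mem_nonunits_iff, not_not]
    have hle : q ≤ p := by
      intro b hb
      by_contra hbp
      refine (not_not.2 hb) ((hq b).1 ?_)
      rw [← stalkSp_trans hw hz]
      exact ((hzp b).2 hbp).map _
    have hAq : A ∈ q := by
      by_contra hAq
      have h1 := (hq A).2 hAq
      have h2 : IsU w (a y) := by
        rw [← hA, ← toK_stalkSp hwy, isU_toK_iff _ _ ?_]
        · exact h1
        · exact h1.ne_zero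
      exact hwa (IsU.of_div (ha0 y) (had hwy) h2)
    have hqe : q = p := by
      by_contra hne
      have hlt : q < p := lt_of_le_of_ne hle hne
      have hbot : (⊥ : Ideal (X.presheaf.stalk y)) < q :=
        bot_lt_iff_ne_bot.2 fun h => hA0 ((Ideal.mem_bot).1 (h ▸ hAq))
      have h1 := Ideal.height_add_one_le_of_lt_of_isPrime hlt
      have h2 := Ideal.height_add_one_le_of_lt_of_isPrime hbot
      have h3 : (1 : ℕ∞) + 1 ≤ 1 :=
        (add_le_add_left (le_trans le_add_self h2) 1).trans (h1.trans hht)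
      exact absurd h3 (by decide)
    exact eq_of_isUnit_stalkSp_iff hwy hz fun b => by rw [hq, hzp, hqe]

lemma finite_minimal_points [TopologicalSpace.NoetherianSpace X] {F : Set X} (hF : IsClosed F) :
    {z | z ∈ F ∧ ∀ w, w ⤳ z → w ∈ F → w = z}.Finite := by
  obtain ⟨S, hSf, hSc, hSi, hS⟩ :=
    TopologicalSpace.NoetherianSpace.exists_finite_set_isClosed_irreducible hF
  have hgen : ∀ t ∈ S, ∃ w, IsGenericPoint w t := fun t ht =>
    QuasiSober.sober (hSi t ht) (hSc t ht)
  choose! w hw using hgen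
  refine (hSf.image w).subset ?_
  rintro z ⟨hz, hz'⟩
  rw [hS] at hz
  obtain ⟨t, htS, hzt⟩ := hz
  refine ⟨t, htS, hz' _ ((hw t htS).specializes hzt) ?_⟩
  rw [hS]
  exact ⟨t, htS, (hw t htS).mem⟩

lemma exists_forall_isU [IsNoetherian X] {u : ℕ → X → X.functionField} {a : X → X.functionField}
    (hu0 : ∀ m x, u m x ≠ 0) (huR : ∀ m x, u m x ∈ locRing x)
    (hud : ∀ m {z x : X}, z ⤳ x → IsU z (u m z / u m x))
    (ha0 : ∀ x, a x ≠ 0) (haR : ∀ x, a x ∈ locRing x) (had : ∀ {z x : X}, z ⤳ x → IsU z (a z / a x))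
    (hop : IsOpen {x | IsU x (a x)})
    (hdiv : ∀ M x, ∃ r ∈ locRing x, a x = (∏ m ∈ Finset.range M, u m x) * r) :
    ∃ m, ∀ x, IsU x (u m x) := by
  by_contra! hcon
  have h1 : ∀ m, ∃ z, ¬ IsU z (u m z) ∧ ∀ w, w ⤳ z → ¬ IsU w (a w) → w = z := fun m => by
    obtain ⟨y, hy⟩ := hcon m
    exact exists_codim_one (hu0 m) (huR m) (hud m) ha0 haR had hy
  choose z hz hz' using h1
  have hprod : ∀ M x, (∏ m ∈ Finset.range M, u m x) ∈ locRing x := fun M x =>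
    prod_mem fun m _ => huR m x
  have hza : ∀ m, ¬ IsU (z m) (a (z m)) := by
    intro m h
    obtain ⟨r, hr, h'⟩ := hdiv (m + 1) (z m)
    rw [Finset.prod_range_succ, mul_comm _ (u m (z m)), mul_assoc] at h'
    rw [h'] at h
    refine hz m (h.of_mul (huR m _) (mul_mem (hprod _ _) hr) ?_)
    rintro h0
    rw [h0, mul_zero] at h'
    exact ha0 _ h'
  let Z := {z | z ∈ {x | IsU x (a x)}ᶜ ∧ ∀ w, w ⤳ z → w ∈ {x | IsU x (a x)}ᶜ → w = z}
  have hZ : Z.Finite := finite_minimal_points hop.isClosed_compl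
  have := hZ.to_subtype
  obtain ⟨⟨y, hy⟩, hinf⟩ := Finite.exists_infinite_fiber
    (fun m => (⟨z m, hza m, hz' m⟩ : Z))
  have hinf' : {m | ¬ IsU y (u m y)}.Infinite := by
    refine (Set.infinite_coe_iff.1 hinf).mono fun m hm => ?_
    have : z m = y := congrArg Subtype.val hm
    show ¬ IsU y (u m y)
    rw [← this]
    exact hz m
  choose U hU using fun m => huR m y
  obtain ⟨A, hA⟩ := haR y
  have hU0 : ∀ m, U m ≠ 0 := fun m h => hu0 m y (by rw [← hU, h, map_zero])
  have hmem : ∀ M, A ∈ IsLocalRing.maximalIdeal (X.presheaf.stalk y) ^ M := by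
    intro M
    obtain ⟨S, hS, hSc⟩ := hinf'.exists_subset_card_eq M
    obtain ⟨r, ⟨B, rfl⟩, hB⟩ := hdiv (S.sup id + 1) y
    have h2 : A = (∏ m ∈ Finset.range (S.sup id + 1), U m) * B := by
      refine toK_injective y ?_
      rw [hA, hB, map_mul, map_prod]
      simp only [hU]
    have hsub : S ⊆ Finset.range (S.sup id + 1) := fun m hm =>
      Finset.mem_range.2 (Nat.lt_succ_of_le (Finset.le_sup (f := id) hm))
    rw [h2, ← Finset.prod_sdiff hsub, mul_comm (∏ m ∈ _ \ _, U m), mul_assoc]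
    refine Ideal.mul_mem_right _ _ ?_
    rw [← hSc, ← Finset.prod_const]
    refine Ideal.prod_mem_prod fun m hm => ?_
    rw [IsLocalRing.mem_maximalIdeal, mem_nonunits_iff, ← isU_toK_iff _ _ (hU0 m), hU]
    exact hS hm
  have h3 : A ∈ (⨅ i : ℕ, IsLocalRing.maximalIdeal (X.presheaf.stalk y) ^ i) :=
    (Submodule.mem_iInf _).2 hmem
  rw [Ideal.iInf_pow_eq_bot_of_isLocalRing _ (Ideal.IsPrime.ne_top inferInstance),
    Ideal.mem_bot] at h3
  exact ha0 y (by rw [← hA, h3, map_zero])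

end Divisors

section Pullback

variable {X : Scheme.{u}} [IsIntegral X]

/-- The pullback of rational functions along a morphism fixing the generic point. -/
def pullK (φ : X ⟶ X) (hη : φ (genericPoint X) = genericPoint X) :
    X.functionField →+* X.functionField :=
  (φ.stalkMap (genericPoint X)).hom.comp (stalkSp (Inseparable.of_eq hη).specializes)

variable (φ : X ⟶ X) (hη : φ (genericPoint X) = genericPoint X)

lemma pullK_toK (x : X) (y : X.presheaf.stalk (φ x)) :
    pullK φ hη (toK (φ x) y) = toK x ((φ.stalkMap x).hom y) := by
  rw [pullK, RingHom.comp_apply, stalkSp_trans]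
  exact stalkMap_stalkSp φ (genericPoint_specializes x) y

lemma pullK_mem {x : X} {a : X.functionField} (ha : a ∈ locRing (φ x)) :
    pullK φ hη a ∈ locRing x := by
  obtain ⟨b, rfl⟩ := ha
  rw [pullK_toK]
  exact toK_mem _ _

lemma pullK_isU {x : X} {a : X.functionField} (ha : IsU (φ x) a) : IsU x (pullK φ hη a) :=
  ⟨pullK_mem φ hη ha.1, by rw [← map_inv₀]; exact pullK_mem φ hη ha.2⟩

lemma isU_of_pullK {x : X} {a : X.functionField} (ha : a ∈ locRing (φ x)) (h0 : a ≠ 0)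
    (h : IsU x (pullK φ hη a)) : IsU (φ x) a := by
  obtain ⟨b, rfl⟩ := ha
  have hb : b ≠ 0 := by
    rintro rfl
    exact h0 (map_zero _)
  rw [pullK_toK, isU_toK_iff] at h
  · rw [isU_toK_iff _ _ hb]
    exact (isUnit_map_iff (φ.stalkMap x).hom b).1 h
  · intro h1
    refine h0 ((map_eq_zero_iff _ (pullK φ hη).injective).1 ?_)
    rw [pullK_toK, h1, map_zero]

end Pullback

section Jacobian

open Filter Topology

variable {k : Type u} [Field k] [Infinite k] {X : Scheme.{u}} [IsIntegral X]
  (sX : X ⟶ Spec (CommRingCat.of k)) [IsProper sX] {N : ℕ} (P : ProjData X N)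
  (φ : X ⟶ X) (hη : φ (genericPoint X) = genericPoint X) (hsurj : Function.Surjective φ)

include P hsurj sX in
/-- If the Jacobian cocycle of a surjective self-map is integral and a power of the dual
canonical bundle clears poles of a nonzero form, then the Jacobian is everywhere a unit. -/
theorem isU_jacobian {D : X → X.functionField} (hD0 : ∀ x, D x ≠ 0)
    (hD : ∀ x, ∀ᶠ y in 𝓝 x, IsU y (D y / D x)) {c : X.functionField} (hc : c ≠ 0)
    (hJ : ∀ x, pullK φ hη (D (φ x)) * c / D x ∈ locRing x) {n : ℕ} (hn : 0 < n)
    {q : X.functionField} (hq0 : q ≠ 0) (hq : ∀ x, q / D x ^ n ∈ locRing x) (x : X) :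
    IsU x (pullK φ hη (D (φ x)) * c / D x) := by
  have hDs : ∀ {z x : X}, z ⤳ x → IsU z (D z / D x) := by
    intro z x h
    obtain ⟨V, hV, hVx⟩ := (hD x).exists_mem
    exact hVx z (mem_of_mem_nhds (h.nhds_le_nhds hV))
  let J : X → X.functionField := fun x => pullK φ hη (D (φ x)) * c / D x
  have hinj : ∀ {a : X.functionField}, a ≠ 0 → pullK φ hη a ≠ 0 := fun h =>
    (map_ne_zero _).2 h
  have hJ0 : ∀ x, J x ≠ 0 := fun x =>
    div_ne_zero (mul_ne_zero (hinj (hD0 _)) hc) (hD0 x)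
  have hJs : ∀ {z x : X}, z ⤳ x → IsU z (J z / J x) := by
    intro z x h
    have h1 : J z / J x = pullK φ hη (D (φ z) / D (φ x)) * (D z / D x)⁻¹ := by
      have := hinj (hD0 (φ x))
      have := hD0 z
      have := hD0 x
      simp only [J, map_div₀]
      field_simp
    rw [h1]
    exact (pullK_isU φ hη (hDs (map_specializes φ h))).mul (hDs h).inv
  let u : ℕ → X → X.functionField :=
    fun m => m.rec J fun _ v x => pullK φ hη (v (φ x))
  have hus : ∀ m x, u (m + 1) x = pullK φ hη (u m (φ x)) := fun _ _ => rfl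
  let I : ℕ → X → X.functionField :=
    fun m => m.rec (fun _ => 1) fun _ v x => J x * pullK φ hη (v (φ x))
  have hIs : ∀ m x, I (m + 1) x = J x * pullK φ hη (I m (φ x)) := fun _ _ => rfl
  let G : ℕ → X.functionField := fun m => m.rec q fun _ v => pullK φ hη v * c ^ n
  have hGs : ∀ m, G (m + 1) = pullK φ hη (G m) * c ^ n := fun _ => rfl
  have hu0 : ∀ m x, u m x ≠ 0 := by
    intro m
    induction m with
    | zero => exact hJ0
    | succ m ih => exact fun x => hinj (ih _)
  have huR : ∀ m x, u m x ∈ locRing x := by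
    intro m
    induction m with
    | zero => exact hJ
    | succ m ih => exact fun x => pullK_mem φ hη (ih _)
  have hud : ∀ m {z x : X}, z ⤳ x → IsU z (u m z / u m x) := by
    intro m
    induction m with
    | zero => exact fun h => hJs h
    | succ m ih =>
      intro z x h
      rw [hus, hus, ← map_div₀]
      exact pullK_isU φ hη (ih (map_specializes φ h))
  have hIR : ∀ m x, I m x ∈ locRing x := by
    intro m
    induction m with
    | zero => exact fun x => one_mem _
    | succ m ih => exact fun x => mul_mem (hJ x) (pullK_mem φ hη (ih _))
  have hIu : ∀ m x, I (m + 1) x = I m x * u m x := by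
    intro m
    induction m with
    | zero =>
      intro x
      show J x * pullK φ hη 1 = 1 * J x
      rw [map_one, mul_one, one_mul]
    | succ m ih =>
      intro x
      rw [hIs (m + 1), ih, map_mul, hus m, ← mul_assoc, hIs m]
  have hIprod : ∀ m x, I m x = ∏ i ∈ Finset.range m, u i x := by
    intro m x
    induction m with
    | zero => rfl
    | succ m ih => rw [hIu, Finset.prod_range_succ, ih]
  have hG0 : ∀ m, G m ≠ 0 := by
    intro m
    induction m with
    | zero => exact hq0
    | succ m ih => exact mul_ne_zero (hinj ih) (pow_ne_zero _ hc)
  have hGI : ∀ m x, ∃ r ∈ locRing x, G m / D x ^ n = I m x * r := by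
    intro m
    induction m with
    | zero => exact fun x => ⟨_, hq x, (one_mul _).symm⟩
    | succ m ih =>
      intro x
      obtain ⟨r, hr, h⟩ := ih (φ x)
      refine ⟨pullK φ hη r * J x ^ (n - 1), mul_mem (pullK_mem φ hη hr) (pow_mem (hJ x) _), ?_⟩
      have h1 : G (m + 1) / D x ^ n = pullK φ hη (G m / D (φ x) ^ n) * J x ^ n := by
        have := hinj (hD0 (φ x))
        have := hD0 x
        simp only [J, map_div₀, map_pow, hGs, div_pow, mul_pow]
        field_simp
      obtain ⟨n, rfl⟩ : ∃ n', n = n' + 1 := ⟨n - 1, by omega⟩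
      rw [h1, h, hIs, map_mul, Nat.add_sub_cancel]
      ring
  letI : Algebra k X.functionField := (stalkConst sX (genericPoint X)).toAlgebra
  obtain ⟨e, w, hw, h0, hind, hfin⟩ := P.exists_noether sX (z := genericPoint X)
    (RingHom.id X.functionField) (fun _ => rfl) Function.surjective_id
  let s : Fin (e + 1) → X.functionField := fun i => P.lin sX (w i) (genericPoint X)
  let t : X → X.functionField := fun x =>
    ((P.c (genericPoint_specializes x) : (X.presheaf.stalk (genericPoint X))ˣ) : X.functionField)
  have ht : ∀ x, t x ≠ 0 := fun x => (P.c (genericPoint_specializes x)).ne_zero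
  have hst : ∀ x i, s i / t x = toK x (P.lin sX (w i) x) := by
    intro x i
    rw [div_eq_iff (ht x), mul_comm]
    exact P.lin_compat sX (w i) (genericPoint_specializes x)
  have hsR : ∀ x i, s i / t x ∈ locRing x := fun x i => by
    rw [hst]
    exact toK_mem _ _
  have hnd : ∀ x, ∃ i, (s i / t x)⁻¹ ∈ locRing x := by
    intro x
    obtain ⟨i, hi⟩ := hw x (genericPoint_specializes x)
    refine ⟨i, ?_⟩
    rw [hst]
    exact ((isU_toK_iff x _ hi.ne_zero).2 hi).2
  have hk : ∀ (x : X) a, algebraMap k X.functionField a ∈ locRing x := fun x a =>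
    ⟨stalkConst sX x a, stalkSp_stalkConst sX _ a⟩
  have : IsLocallyNoetherian X := LocallyOfFiniteType.isLocallyNoetherian sX
  have : CompactSpace X := QuasiCompact.compactSpace_of_compactSpace sX
  have : IsNoetherian X := ⟨⟩
  obtain ⟨l, ξ, hξ0, hξ⟩ := exists_clear_denominators hk ht h0 hfin hsR hnd
    (D := fun x => D x ^ n) (fun x => pow_ne_zero _ (hD0 x))
    (fun x => (hD x).mono fun y hy => by rw [← div_pow]; exact hy.pow n)
  obtain ⟨B, h, hh0, hh⟩ := exists_common_section (fun x : X => locRing x) hk t ht h0 hind hfin hsR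
    hnd (fun O hO => by
      obtain ⟨x, ⟨C⟩⟩ := exists_center sX (RingHom.id X.functionField) O hO
      refine ⟨x, ?_⟩
      rintro _ ⟨a, rfl⟩
      have := C.comp a
      rw [RingHom.id_apply] at this
      rw [← this]
      exact Subtype.property _) l I hIR (fun m x => ⟨_, huR m x, hIu m x⟩)
    (fun m => G m * ξ) (fun m => mul_ne_zero (hG0 m) hξ0) (fun m x => by
      obtain ⟨r, hr, h⟩ := hGI m x
      refine ⟨r * (ξ * D x ^ n / t x ^ l), mul_mem hr (hξ x), ?_⟩
      rw [← mul_assoc, ← h]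
      have := hD0 x
      field_simp)
  let a : X → X.functionField := fun x => h / t x ^ B
  have hts : ∀ {z x : X}, z ⤳ x → IsU z (t z / t x) := by
    intro z x hzx
    obtain ⟨i, hi⟩ := exists_isU hsR hnd x
    have h1 : IsU z (s i / t z) := by
      obtain ⟨V, hV, hVx⟩ := (eventually_isU_div ht h0 hsR hnd hi).exists_mem
      exact hVx z (mem_of_mem_nhds (hzx.nhds_le_nhds hV))
    have h2 : t z / t x = (s i / t x) * (s i / t z)⁻¹ := by
      have := ht x
      have := ht z
      have := h0 i
      simp only [RingHom.id_apply] at this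
      change s i ≠ 0 at this
      field_simp
    rw [h2]
    exact (hi.mono hzx).mul h1.inv
  obtain ⟨m, hm⟩ := exists_forall_isU (u := u) (a := a) hu0 huR hud
    (fun x => div_ne_zero hh0 (pow_ne_zero _ (ht x)))
    (fun x => by
      obtain ⟨r, hr, h'⟩ := hh 0 x
      show h / t x ^ B ∈ locRing x
      rw [h']
      exact mul_mem (hIR 0 x) hr)
    (fun {z x} hzx => by
      have : a z / a x = (t z / t x)⁻¹ ^ B := by
        have := ht x
        have := ht z
        simp only [a, inv_div, div_pow]
        field_simp
      rw [this]
      exact (hts hzx).inv.pow B)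
    (by
      rw [isOpen_iff_eventually]
      intro x hx
      obtain ⟨i, hi⟩ := exists_isU hsR hnd x
      have hsi : s i ≠ 0 := h0 i
      have h1 : IsU x (h / s i ^ B) := by
        have : h / s i ^ B = a x * (s i / t x)⁻¹ ^ B := by
          have := ht x
          simp only [a, inv_div, div_pow]
          field_simp
        rw [this]
        exact IsU.mul hx (hi.inv.pow B)
      filter_upwards [eventually_isU h1, eventually_isU_div ht h0 hsR hnd hi] with y hy hy'
      have : a y = h / s i ^ B * (s i / t y) ^ B := by
        have := ht y
        simp only [a, div_pow]
        field_simp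
      show IsU y (a y)
      rw [this]
      exact hy.mul (hy'.pow B))
    (fun M x => by
      obtain ⟨r, hr, h'⟩ := hh M x
      exact ⟨r, hr, by rw [← hIprod]; exact h'⟩)
  have hdown : ∀ m, (∀ x, IsU x (u m x)) → ∀ x, IsU x (J x) := by
    intro m
    induction m with
    | zero => exact fun h => h
    | succ m ih =>
      intro h
      refine ih fun x => ?_
      obtain ⟨y, rfl⟩ := hsurj x
      exact isU_of_pullK φ hη (huR m _) (hu0 m _) (h y)
  exact hdown m hm x

end Jacobian

/-- A derivation vanishing on a subfield over which the field is separable is zero. -/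
theorem derivation_eq_zero_of_isSeparable {k F K : Type u} [Field k] [Field F] [Field K]
    [Algebra k K] (σ : F →+* K) (hσ : @Algebra.IsSeparable F K _ _ σ.toAlgebra)
    {M : Type u} [AddCommGroup M] [Module k M] [Module K M] (δ : Derivation k K M)
    (hδ : ∀ f, δ (σ f) = 0) : δ = 0 := by
  letI : Algebra F K := σ.toAlgebra
  haveI : Algebra.IsSeparable F K := hσ
  letI : Module F M := Module.compHom _ σ
  haveI : IsScalarTower F K M :=
    ⟨fun a b m => by
      change (σ a * b) • m = σ a • b • m
      rw [mul_smul]⟩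
  let δ' : K →ₗ[F] M :=
    { toFun := fun a => δ a
      map_add' := fun a b => by simp
      map_smul' := fun c a => by
        change δ (σ c * a) = σ c • _
        rw [Derivation.leibniz, hδ]
        simp }
  let E : Derivation F K M := Derivation.mk' δ' fun a b => Derivation.leibniz δ a b
  haveI : Algebra.FormallyUnramified F K := Algebra.FormallyUnramified.of_isSeparable F K
  haveI : Subsingleton (Ω[K⁄F]) := Algebra.FormallyUnramified.subsingleton_kaehlerDifferential
  ext a
  change E a = 0
  rw [← E.liftKaehlerDifferential_comp_D a, Subsingleton.elim (KaehlerDifferential.D F K a) 0,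
    map_zero]

/-- A submodule of differentials of `K` containing the differentials of a subfield over which `K`
is separable is everything. -/
theorem eq_top_of_isSeparable {k F K : Type u} [Field k] [Field F] [Field K] [Algebra k K]
    (σ : F →+* K) (hσ : @Algebra.IsSeparable F K _ _ σ.toAlgebra)
    (W : Submodule K (Ω[K⁄k])) (hW : ∀ f, KaehlerDifferential.D k K (σ f) ∈ W) : W = ⊤ := by
  have h := derivation_eq_zero_of_isSeparable σ hσ (W.mkQ.compDer (KaehlerDifferential.D k K))
    fun f => (Submodule.Quotient.mk_eq_zero W).2 (hW f)
  rw [eq_top_iff, ← KaehlerDifferential.span_range_derivation, Submodule.span_le]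
  rintro _ ⟨a, rfl⟩
  exact (Submodule.Quotient.mk_eq_zero W).1 (DFunLike.congr_fun h a :)

theorem linearIndependent_D_of_algebraMap {k M F : Type u} {ι : Type*} [Field k] [Field M] [Field F]
    [Algebra k M] [Algebra k F] [Algebra M F] [IsScalarTower k M F] {x : ι → M}
    (hx : LinearIndependent F fun i => KaehlerDifferential.D k F (algebraMap M F (x i))) :
    LinearIndependent M fun i => KaehlerDifferential.D k M (x i) := by
  have h1 : LinearIndependent M fun i => KaehlerDifferential.D k F (algebraMap M F (x i)) :=
    hx.restrict_scalars' M
  refine LinearIndependent.of_comp (KaehlerDifferential.map k k M F) ?_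
  convert h1 using 1
  funext i
  exact KaehlerDifferential.map_D ..

/-- Over a perfect field, the transcendence degree bounds the number of linearly independent
differentials. -/
theorem le_trdeg_of_linearIndependent {k F : Type u} [Field k] [PerfectField k] [Field F]
    [Algebra k F] {g : ℕ} (x : Fin g → F)
    (hx : LinearIndependent F fun i => KaehlerDifferential.D k F (x i)) :
    (g : Cardinal) ≤ Algebra.trdeg k F := by
  let M := IntermediateField.adjoin k (Set.range x)
  haveI : Algebra.EssFiniteType k M := by
    exact IntermediateField.essFiniteType_iff.2
      (IntermediateField.fg_adjoin_of_finite (Set.finite_range x))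
  let y : Fin g → M := fun i => ⟨x i, IntermediateField.subset_adjoin _ _ ⟨i, rfl⟩⟩
  have hy : LinearIndependent M fun i => KaehlerDifferential.D k M (y i) :=
    linearIndependent_D_of_algebraMap hx
  obtain ⟨s, hs, hsep⟩ := exists_isTranscendenceBasis_and_isSeparable_of_perfectField k M
  have htop : Submodule.span M (KaehlerDifferential.D k M '' (s : Set M)) = ⊤ := by
    refine eq_top_of_isSeparable (algebraMap (IntermediateField.adjoin k (s : Set M)) M) hsep _ ?_
    rintro ⟨f, hf⟩
    change KaehlerDifferential.D k M f ∈ _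
    induction hf using IntermediateField.adjoin_induction with
    | mem a ha => exact Submodule.subset_span ⟨a, ha, rfl⟩
    | algebraMap a => simp
    | add a b _ _ ha hb => rw [map_add]; exact add_mem ha hb
    | inv a _ ha =>
      rw [Derivation.leibniz_inv]
      exact Submodule.smul_mem _ _ ha
    | mul a b _ _ ha hb =>
      rw [Derivation.leibniz]
      exact add_mem (Submodule.smul_mem _ _ hb) (Submodule.smul_mem _ _ ha)
  have h2 : g ≤ s.card := by
    classical
    have h3 := linearIndependent_le_span_finset _ hy
      ((s.image (KaehlerDifferential.D k M))) (by simpa using htop)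
    have h4 := h3.trans (Nat.cast_le.2 Finset.card_image_le)
    simpa using h4
  have h5 := hs.cardinalMk_eq_trdeg
  have h6 := trdeg_le_of_injective M.val M.val.injective
  refine le_trans ?_ h6
  rw [← h5]
  simpa using h2

/-- A morphism of smooth algebras inducing an isomorphism on differentials is étale. -/
theorem formallyEtale_of_bijective {R A B : Type u} [CommRing R] [CommRing A] [CommRing B]
    [Algebra R A] [Algebra R B] [Algebra A B] [IsScalarTower R A B]
    [Algebra.FormallySmooth R B]
    (h : Function.Bijective (KaehlerDifferential.mapBaseChange R A B)) :
    Algebra.FormallyEtale A B := by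
  refine ⟨?_, ?_⟩
  · refine subsingleton_of_forall_eq 0 fun z => ?_
    obtain ⟨w, rfl⟩ := KaehlerDifferential.map_surjective R A B z
    exact (KaehlerDifferential.exact_mapBaseChange_map R A B w).2 (h.2 w)
  · refine subsingleton_of_forall_eq 0 fun z => ?_
    have h0 : Algebra.H1Cotangent.δ R A B z = 0 := by
      refine h.1 ?_
      rw [map_zero]
      exact (Algebra.H1Cotangent.exact_δ_mapBaseChange R A B _).2 ⟨z, rfl⟩
    obtain ⟨w, rfl⟩ := (Algebra.H1Cotangent.exact_map_δ R A B z).1 h0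
    haveI : Subsingleton (Algebra.H1Cotangent R B) :=
      Algebra.FormallySmooth.subsingleton_h1Cotangent
    rw [Subsingleton.elim w 0, map_zero]

theorem isIntegrallyClosed_of_etale {R S : Type u} [CommRing R] [IsDomain R]
    [IsIntegrallyClosed R] [CommRing S] [IsDomain S] [Algebra R S] [Algebra.Etale R S] :
    IsIntegrallyClosed S := by
  let B := FractionRing R
  let T := S ⊗[R] B
  haveI : Module.Flat R S := inferInstance
  haveI hloc : IsLocalization (Algebra.algebraMapSubmonoid S (nonZeroDivisors R)) T :=
    IsLocalization.tensor B _
  have hinj : Function.Injective (algebraMap R S) := FaithfulSMul.algebraMap_injective R S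
  have hle : Algebra.algebraMapSubmonoid S (nonZeroDivisors R) ≤ nonZeroDivisors S := by
    rintro _ ⟨r, hr, rfl⟩
    replace hr : r ∈ nonZeroDivisors R := hr
    rw [mem_nonZeroDivisors_iff_ne_zero] at hr ⊢
    rw [Ne, map_eq_zero_iff _ hinj]
    exact hr
  haveI : IsDomain T := IsLocalization.isDomain_of_le_nonZeroDivisors T hle
  haveI : Algebra.Etale B (B ⊗[R] S) := inferInstance
  haveI : Module.Finite B (B ⊗[R] S) := Algebra.FormallyUnramified.finite_of_free B _
  haveI : IsArtinianRing (B ⊗[R] S) := IsArtinianRing.of_finite B _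
  let e : (B ⊗[R] S) ≃ₐ[R] T := Algebra.TensorProduct.comm R B S
  haveI : IsArtinianRing T := e.toRingEquiv.surjective.isArtinianRing
  have hT : IsField T := IsArtinianRing.isField_of_isDomain T
  letI := hT.toField
  haveI : IsFractionRing S T := by
    have hinjT : Function.Injective (algebraMap S T) := IsLocalization.injective T hle
    refine ⟨fun y => ?_, fun z => ?_, fun h => ⟨1, by rw [hinjT h]⟩⟩
    · refine isUnit_iff_ne_zero.2 fun h => nonZeroDivisors.coe_ne_zero y ?_
      exact hinjT (h.trans (map_zero _).symm)
    · obtain ⟨⟨a, b⟩, hab⟩ :=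
        IsLocalization.surj (Algebra.algebraMapSubmonoid S (nonZeroDivisors R)) z
      exact ⟨⟨a, ⟨b, hle b.2⟩⟩, hab⟩
  rw [isIntegrallyClosed_iff T]
  intro z hz
  obtain ⟨w, hw⟩ :=
    (TensorProduct.toIntegralClosure_bijective_of_smooth (R := R) (S := S) (B := B)).2
    ⟨z, hz⟩
  have hw' : (TensorProduct.toIntegralClosure R S B w : T) = z := congrArg Subtype.val hw
  rw [← hw']
  clear hw hw'
  induction w with
  | zero => exact ⟨0, by simp⟩
  | add a b ha hb =>
    obtain ⟨a', ha'⟩ := ha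
    obtain ⟨b', hb'⟩ := hb
    exact ⟨a' + b', by rw [map_add, ha', hb', map_add]; rfl⟩
  | tmul s b =>
    obtain ⟨r, hr⟩ := (isIntegrallyClosed_iff B).1 inferInstance b.2
    refine ⟨r • s, ?_⟩
    change _ = s ⊗ₜ[R] (b : B)
    rw [← hr]
    change (r • s) ⊗ₜ[R] (1 : B) = _
    rw [TensorProduct.smul_tmul, Algebra.algebraMap_eq_smul_one]

theorem isIntegrallyClosed_of_smooth {k A : Type u} [Field k] [CommRing A] [IsDomain A]
    [Algebra k A] [Algebra.Smooth k A] : IsIntegrallyClosed A := by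
  let K := FractionRing A
  rw [isIntegrallyClosed_iff K]
  intro z hz
  let I : Ideal A := (LinearMap.range (Algebra.linearMap A K)).comap
    (LinearMap.toSpanSingleton A K z)
  suffices hI : I = ⊤ by
    have h1 : (1 : A) ∈ I := hI ▸ Submodule.mem_top
    obtain ⟨a, ha⟩ := h1
    exact ⟨a, by simpa using ha⟩
  by_contra hI
  obtain ⟨m, hm, hIm⟩ := Ideal.exists_le_maximal I hI
  obtain ⟨f, hfm, n, _, _, _⟩ :=
    Algebra.IsSmoothAt.exists_isStandardEtale_mvPolynomial (R := k) (p := m)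
  have hf0 : f ≠ 0 := fun h => hfm (h ▸ zero_mem _)
  have hle : Submonoid.powers f ≤ nonZeroDivisors A :=
    powers_le_nonZeroDivisors_of_noZeroDivisors hf0
  let S := Localization.Away f
  haveI : IsDomain S := IsLocalization.isDomain_of_le_nonZeroDivisors S hle
  haveI : IsIntegrallyClosed S := isIntegrallyClosed_of_etale (R := MvPolynomial (Fin n) k)
  letI : Algebra S K := IsLocalization.localizationAlgebraOfSubmonoidLe S K _ _ hle
  haveI : IsScalarTower A S K :=
    IsLocalization.localization_isScalarTower_of_submonoid_le S K _ _ hle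
  haveI : IsFractionRing S K :=
    IsFractionRing.isFractionRing_of_isDomain_of_isLocalization (Submonoid.powers f) S K
  obtain ⟨y, hy⟩ := (isIntegrallyClosed_iff K).1 ‹_› (hz.tower_top (A := S))
  obtain ⟨⟨a, ⟨_, l, rfl⟩⟩, ha⟩ := IsLocalization.surj (Submonoid.powers f) y
  refine hfm (hm.isPrime.mem_of_pow_mem l (hIm ⟨a, ?_⟩))
  have h2 := congrArg (algebraMap S K) ha
  rw [map_mul, hy, ← IsScalarTower.algebraMap_apply, ← IsScalarTower.algebraMap_apply] at h2
  change algebraMap A K a = f ^ l • z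
  rw [← h2, Algebra.smul_def, mul_comm]

theorem ringKrullDim_le_of_isIntegral (R S : Type u) [CommRing R] [CommRing S] [Algebra R S]
    [FaithfulSMul R S] [Algebra.IsIntegral R S] : ringKrullDim R ≤ ringKrullDim S := by
  refine iSup_le fun l => ?_
  obtain ⟨Q, hQ, hQl⟩ := Ideal.exists_ideal_over_prime_of_isIntegral l.head.asIdeal (⊥ : Ideal S)
    (by
      rw [← RingHom.ker_eq_comap_bot,
        (RingHom.injective_iff_ker_eq_bot _).1 (FaithfulSMul.algebraMap_injective R S)]
      exact bot_le)
  haveI : Q.IsPrime := hQl.1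
  haveI : Q.LiesOver l.head.asIdeal := ⟨hQl.2.symm⟩
  obtain ⟨m, hm, -⟩ := Ideal.exists_ltSeries_of_hasGoingUp l Q
  exact hm ▸ Order.LTSeries.length_le_krullDim m

/-- The transcendence degree of a finitely generated domain is at most its Krull dimension. -/
theorem trdeg_le_of_ringKrullDim_le {k A : Type u} [Field k] [CommRing A] [IsDomain A]
    [Algebra k A] [Algebra.FiniteType k A] {g : ℕ} (hg : ringKrullDim A ≤ g) :
    Algebra.trdeg k A ≤ g := by
  obtain ⟨s, p, hp, hi⟩ := exists_integral_inj_algHom_of_fg k A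
  letI := p.toRingHom.toAlgebra
  haveI : IsScalarTower k (MvPolynomial (Fin s) k) A := IsScalarTower.of_algHom p
  haveI : Algebra.IsIntegral (MvPolynomial (Fin s) k) A := ⟨hi⟩
  haveI : FaithfulSMul (MvPolynomial (Fin s) k) A :=
    (faithfulSMul_iff_algebraMap_injective _ _).2 hp
  have h1 : (s : WithBot ℕ∞) ≤ ringKrullDim A := by
    refine le_trans (le_of_eq ?_) (ringKrullDim_le_of_isIntegral (MvPolynomial (Fin s) k) A)
    rw [MvPolynomial.ringKrullDim_of_isNoetherianRing]
    simp
  have h2 := trdeg_add_eq k (MvPolynomial (Fin s) k) (A := A)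
  rw [trdeg_eq_zero (R := MvPolynomial (Fin s) k) (A := A), add_zero] at h2
  rw [← h2, MvPolynomial.trdeg_of_isDomain]
  have h3 : s ≤ g := by exact_mod_cast h1.trans hg
  simpa using h3

/-- If `L` has at least as many independent differentials as the transcendence degree of `K`, then
`K` is algebraic over `L`. -/
theorem isAlgebraic_of_linearIndependent {k L K : Type u} [Field k] [PerfectField k] [Field L]
    [Field K] [Algebra k L] [Algebra k K] [Algebra L K] [IsScalarTower k L K] {g : ℕ}
    (x : Fin g → L) (hx : LinearIndependent L fun i => KaehlerDifferential.D k L (x i))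
    (hg : Algebra.trdeg k K ≤ g) : Algebra.IsAlgebraic L K := by
  have h1 := le_trdeg_of_linearIndependent x hx
  have h2 := trdeg_add_eq k L (A := K)
  have h3 : Algebra.trdeg L K = 0 := by
    by_contra h0
    have h4 := Cardinal.one_le_iff_ne_zero.2 h0
    have h5 : (g : Cardinal) + 1 ≤ g := (add_le_add h1 h4).trans (h2.le.trans hg)
    have h6 : g + 1 ≤ g := by exact_mod_cast h5
    omega
  exact trdeg_eq_zero_iff.1 h3

section Lattice

variable {K W : Type*} [Field K] [AddCommGroup W] [Module K W]

/-- The lattice of differentials spanned by a subring. -/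
def diffLattice (δ : K → W) (R : Subring K) : Submodule R W := Submodule.span R (δ '' R)

/-- A basis of the space of differentials which is also a basis of the lattice of a subring. -/
def IsFrame (δ : K → W) (R : Subring K) {r : ℕ} (v : Fin r → W) : Prop :=
  LinearIndependent K v ∧ Submodule.span R (Set.range v) = diffLattice δ R

lemma det_eq_mul_det {r : ℕ} (θ : Module.Basis (Fin r) K W) {v w : Fin r → W}
    (M : Matrix (Fin r) (Fin r) K) (h : ∀ i, w i = ∑ j, M i j • v j) :
    θ.det w = M.det * θ.det v := by
  rw [Module.Basis.det_apply, Module.Basis.det_apply, mul_comm, ← Matrix.det_transpose M,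
    ← Matrix.det_mul]
  congr 1
  ext a i
  rw [Module.Basis.toMatrix_apply, h, Matrix.mul_apply, map_sum, Finsupp.finsetSum_apply]
  refine Finset.sum_congr rfl fun j _ => ?_
  rw [map_smul, Finsupp.smul_apply, smul_eq_mul, mul_comm]
  rfl

lemma exists_det_eq_mul_det {r : ℕ} (θ : Module.Basis (Fin r) K W) {v w : Fin r → W}
    {R : Subring K} (h : ∀ i, w i ∈ Submodule.span R (Set.range v)) :
    ∃ m ∈ R, θ.det w = m * θ.det v := by
  choose M hM using fun i => Submodule.mem_span_range_iff_exists_fun R |>.1 (h i)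
  let M' : Matrix (Fin r) (Fin r) R := fun i j => M i j
  refine ⟨R.subtype M'.det, SetLike.coe_mem _, ?_⟩
  rw [RingHom.map_det]
  exact det_eq_mul_det θ _ fun i => (hM i).symm

lemma IsFrame.det_ne_zero {δ : K → W} {R : Subring K} {r : ℕ} {v : Fin r → W}
    (hv : IsFrame δ R v) (θ : Module.Basis (Fin r) K W) : θ.det v ≠ 0 := by
  haveI := Module.Finite.of_basis θ
  refine ((Module.Basis.is_basis_iff_det θ).1 ⟨hv.1, ?_⟩).ne_zero
  refine hv.1.span_eq_top_of_card_eq_finrank' ?_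
  rw [Module.finrank_eq_card_basis θ]

lemma IsFrame.div_mem {δ : K → W} {R : Subring K} {r : ℕ} {v w : Fin r → W}
    (hv : IsFrame δ R v) (hw : ∀ i, w i ∈ diffLattice δ R) (θ : Module.Basis (Fin r) K W) :
    θ.det w / θ.det v ∈ R := by
  obtain ⟨m, hm, h⟩ := exists_det_eq_mul_det θ (R := R) (v := v) (w := w)
    fun i => hv.2 ▸ hw i
  rwa [h, mul_div_cancel_right₀ _ (hv.det_ne_zero θ)]

lemma IsFrame.mem {δ : K → W} {R : Subring K} {r : ℕ} {v : Fin r → W}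
    (hv : IsFrame δ R v) (i : Fin r) : v i ∈ diffLattice δ R :=
  hv.2 ▸ Submodule.subset_span ⟨i, rfl⟩

lemma diffLattice_map {F V : Type*} [Field F] [AddCommGroup V] [Module F V] {σ : F →+* K}
    (S : V →ₛₗ[σ] W) {ε : F → V} {δ : K → W} (hS : ∀ f, S (ε f) = δ (σ f)) {R : Subring F}
    {T : Subring K} (hRT : ∀ a ∈ R, σ a ∈ T) {w : V} (hw : w ∈ diffLattice ε R) :
    S w ∈ diffLattice δ T := by
  induction hw using Submodule.span_induction with
  | mem x hx =>
    obtain ⟨f, hf, rfl⟩ := hx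
    exact hS f ▸ Submodule.subset_span ⟨σ f, hRT f hf, rfl⟩
  | zero => exact (map_zero S).symm ▸ zero_mem _
  | add x y _ _ hx hy => exact (map_add S x y).symm ▸ add_mem hx hy
  | smul a x _ hx =>
    have h : S (a • x) = (⟨σ a, hRT a a.2⟩ : T) • S x := S.map_smulₛₗ (a : F) x
    exact h ▸ Submodule.smul_mem _ _ hx

lemma det_semilinear {σ : K →+* K} {r : ℕ} (θ : Module.Basis (Fin r) K W)
    (S : W →ₛₗ[σ] W) (v : Fin r → W) :
    θ.det (fun i => S (v i)) = σ (θ.det v) * θ.det (fun i => S (θ i)) := by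
  rw [Module.Basis.det_apply θ v, RingHom.map_det, ← Matrix.det_transpose]
  refine det_eq_mul_det θ _ fun i => ?_
  conv_lhs => rw [← θ.sum_repr (v i)]
  rw [map_sum]
  exact Finset.sum_congr rfl fun j _ => S.map_smulₛₗ _ _

end Lattice

section DiffMap

variable {k R S T : Type u} [CommRing k] [CommRing R] [CommRing S] [CommRing T] [Algebra k R]
  [Algebra k S] [Algebra k T]

/-- The semilinear map on differentials induced by a ring homomorphism. -/
def diffMap (k : Type u) {R S : Type u} [CommRing k] [CommRing R] [CommRing S] [Algebra k R]
    [Algebra k S] (σ : R →+* S) (hσ : ∀ c, σ (algebraMap k R c) = algebraMap k S c) :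
    Ω[R⁄k] →ₛₗ[σ] Ω[S⁄k] :=
  letI : Algebra R S := σ.toAlgebra
  haveI : IsScalarTower k R S := IsScalarTower.of_algebraMap_eq fun c => (hσ c).symm
  { toFun := KaehlerDifferential.map k k R S
    map_add' := map_add _
    map_smul' := fun c x => by rw [map_smul]; exact (algebraMap_smul S c _).symm }

lemma diffMap_D (σ : R →+* S) (hσ : ∀ c, σ (algebraMap k R c) = algebraMap k S c) (a : R) :
    diffMap k σ hσ (KaehlerDifferential.D k R a) = KaehlerDifferential.D k S (σ a) := by
  letI : Algebra R S := σ.toAlgebra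
  haveI : IsScalarTower k R S := IsScalarTower.of_algebraMap_eq fun c => (hσ c).symm
  exact KaehlerDifferential.map_D k k R S a

lemma diffMap_smul (σ : R →+* S) (hσ : ∀ c, σ (algebraMap k R c) = algebraMap k S c) (a : R)
    (ω : Ω[R⁄k]) : diffMap k σ hσ (a • ω) = σ a • diffMap k σ hσ ω :=
  LinearMap.map_smulₛₗ _ _ _

lemma kaehlerDifferential_induction {p : Ω[R⁄k] → Prop} (ω : Ω[R⁄k])
    (hD : ∀ a, p (KaehlerDifferential.D k R a)) (h_zero : p 0)
    (h_add : ∀ x y, p x → p y → p (x + y)) (h_smul : ∀ (a : R) x, p x → p (a • x)) : p ω := by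
  have h : ω ∈ Submodule.span R (Set.range (KaehlerDifferential.D k R)) := by
    rw [KaehlerDifferential.span_range_derivation]
    trivial
  induction h using Submodule.span_induction with
  | mem x hx => obtain ⟨a, rfl⟩ := hx; exact hD a
  | zero => exact h_zero
  | add x y _ _ hx hy => exact h_add x y hx hy
  | smul a x _ hx => exact h_smul a x hx

lemma diffMap_diffMap (σ : R →+* S) (hσ : ∀ c, σ (algebraMap k R c) = algebraMap k S c)
    (τ : S →+* T) (hτ : ∀ c, τ (algebraMap k S c) = algebraMap k T c)
    (ρ : R →+* T) (hρ : ∀ c, ρ (algebraMap k R c) = algebraMap k T c)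
    (h : ∀ a, τ (σ a) = ρ a) (ω : Ω[R⁄k]) :
    diffMap k τ hτ (diffMap k σ hσ ω) = diffMap k ρ hρ ω := by
  induction ω using kaehlerDifferential_induction with
  | hD a => rw [diffMap_D, diffMap_D, diffMap_D, h]
  | h_zero => simp
  | h_add x y hx hy => simp only [map_add, hx, hy]
  | h_smul a x hx => rw [diffMap_smul, diffMap_smul, diffMap_smul, hx, h]

/-- A homomorphism between algebras with free differentials is formally étale if it induces a
matrix with invertible determinant on differentials. -/
theorem formallyEtale_of_isUnit_det [Algebra R S] [IsScalarTower k R S]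
    [Algebra.FormallySmooth k S] {r : ℕ} (b : Module.Basis (Fin r) R (Ω[R⁄k]))
    (b' : Module.Basis (Fin r) S (Ω[S⁄k])) (P : Matrix (Fin r) (Fin r) S)
    (hP : ∀ i, KaehlerDifferential.map k k R S (b i) = ∑ j, P i j • b' j) (hdet : IsUnit P.det) :
    Algebra.FormallyEtale R S := by
  refine formallyEtale_of_bijective (R := k) ?_
  let c := b.baseChange S
  let e := LinearEquiv.ofIsUnitDet (v := c) (v' := b')
    (f := KaehlerDifferential.mapBaseChange k R S) (by
      have h : LinearMap.toMatrix c b' (KaehlerDifferential.mapBaseChange k R S) = P.transpose := by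
        ext i j
        rw [LinearMap.toMatrix_apply, Module.Basis.baseChange_apply,
          KaehlerDifferential.mapBaseChange_tmul, one_smul, hP]
        simp [Finsupp.single_apply]
      rw [h, Matrix.det_transpose]
      exact hdet)
  exact e.bijective

end DiffMap

/-- A basis of the differentials of a domain gives a frame at every localization. -/
theorem isFrame_of_isFractionRing {k A K : Type u} [Field k] [CommRing A] [IsDomain A] [Field K]
    [Algebra k A] [Algebra k K] [Algebra A K] [IsScalarTower k A K] [IsFractionRing A K]
    {r : ℕ} (b : Module.Basis (Fin r) A (Ω[A⁄k])) {R : Subring K}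
    (hR : ∀ a, algebraMap A K a ∈ R)
    (hR' : ∀ f ∈ R, ∃ a s, (algebraMap A K s)⁻¹ ∈ R ∧ algebraMap A K s ≠ 0 ∧
      f * algebraMap A K s = algebraMap A K a) :
    IsFrame (KaehlerDifferential.D k K) R fun i => KaehlerDifferential.map k k A K (b i) := by
  let T := KaehlerDifferential.map k k A K
  have hT : ∀ a ω, T (a • ω) = algebraMap A K a • T ω := fun a ω => by
    rw [map_smul, algebraMap_smul]
  have hmem : ∀ ω, T ω ∈ Submodule.span R (Set.range fun i => T (b i)) := fun ω => by
    rw [← b.sum_repr ω, map_sum]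
    refine sum_mem fun i _ => ?_
    rw [hT]
    exact Submodule.smul_mem _ (⟨_, hR _⟩ : R) (Submodule.subset_span ⟨i, rfl⟩)
  refine ⟨?_, le_antisymm (Submodule.span_le.2 ?_) (Submodule.span_le.2 ?_)⟩
  · have h := (b.ofIsLocalizedModule K (nonZeroDivisors A) T).linearIndependent
    have he : ⇑(b.ofIsLocalizedModule K (nonZeroDivisors A) T) = fun i => T (b i) :=
      funext fun i => b.ofIsLocalizedModule_apply K (nonZeroDivisors A) T i
    rw [he] at h
    exact h
  · rintro _ ⟨i, rfl⟩
    change T (b i) ∈ diffLattice _ R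
    generalize b i = ω
    induction ω using kaehlerDifferential_induction with
    | hD a =>
      rw [KaehlerDifferential.map_D]
      exact Submodule.subset_span ⟨_, hR a, rfl⟩
    | h_zero => exact (map_zero T).symm ▸ zero_mem _
    | h_add x y hx hy => exact (map_add T x y).symm ▸ add_mem hx hy
    | h_smul a x hx =>
      rw [hT]
      exact Submodule.smul_mem _ (⟨_, hR a⟩ : R) hx
  · rintro _ ⟨f, hf, rfl⟩
    obtain ⟨a, s, hs, hs0, h⟩ := hR' f hf
    have h1 := congrArg (KaehlerDifferential.D k K) h
    rw [Derivation.leibniz] at h1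
    have h2 : KaehlerDifferential.D k K f = (algebraMap A K s)⁻¹ •
        (T (KaehlerDifferential.D k A a) - f • T (KaehlerDifferential.D k A s)) := by
      rw [KaehlerDifferential.map_D, KaehlerDifferential.map_D, ← h1, add_sub_cancel_left,
        smul_smul, inv_mul_cancel₀ hs0, one_smul]
    have h3 := Submodule.smul_mem (Submodule.span R (Set.range fun i => T (b i)))
      (⟨_, hs⟩ : R) (sub_mem (hmem (KaehlerDifferential.D k A a))
        (Submodule.smul_mem _ (⟨f, hf⟩ : R) (hmem (KaehlerDifferential.D k A s))))
    rw [SetLike.mem_coe, h2]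
    exact h3

theorem finrank_of_isFractionRing {k A K : Type u} [Field k] [CommRing A] [IsDomain A] [Field K]
    [Algebra k A] [Algebra k K] [Algebra A K] [IsScalarTower k A K] [IsFractionRing A K]
    {r : ℕ} (b : Module.Basis (Fin r) A (Ω[A⁄k])) :
    Module.Finite K (Ω[K⁄k]) ∧ Module.finrank K (Ω[K⁄k]) = r := by
  let c : Module.Basis (Fin r) K (Ω[K⁄k]) :=
    b.ofIsLocalizedModule K (nonZeroDivisors A) (KaehlerDifferential.map k k A K)
  exact ⟨Module.Finite.of_basis c, by rw [Module.finrank_eq_card_basis c, Fintype.card_fin]⟩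

section LocalFrames

variable {k : Type u} [Field k] {X : Scheme.{u}} (sX : X ⟶ Spec (CommRingCat.of k))

section Smooth

variable [∀ V : X.Opens, Algebra k Γ(X, V)]
  (hsec : ∀ (V : X.Opens) (c : k), algebraMap k Γ(X, V) c = toSections sX V c)

include hsec in
/-- Smooth schemes over a field are covered by affine opens with free differentials. -/
theorem exists_basis_differentials [Smooth sX] (x : X) :
    ∃ V : X.Opens, IsAffineOpen V ∧ x ∈ V ∧
      ∃ r : ℕ, Nonempty (Module.Basis (Fin r) Γ(X, V) (Ω[Γ(X, V)⁄k])) := by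
  obtain ⟨U, hU, V, hV, hx, e, h⟩ := Smooth.exists_isStandardSmooth sX x
  refine ⟨V, hV, hx, ?_⟩
  have hU' : U = ⊤ := by
    ext y
    have h1 : sX x ∈ U := e hx
    refine ⟨fun _ => TopologicalSpace.Opens.mem_top y, fun _ => ?_⟩
    exact (@Subsingleton.elim (PrimeSpectrum k) _ y (sX x)) ▸ h1
  subst hU'
  haveI : Algebra.IsStandardSmooth k Γ(X, V) := by
    have h2 := RingHom.isStandardSmooth_respectsIso.2 _
      (Scheme.ΓSpecIso (CommRingCat.of k)).symm.commRingCatIsoToRingEquiv h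
    rw [← RingHom.isStandardSmooth_algebraMap, RingHom.ext (hsec V), toSections_eq]
    exact h2
  by_cases hV0 : Nontrivial Γ(X, V)
  · haveI : Module.Finite Γ(X, V) (Ω[Γ(X, V)⁄k]) := inferInstance
    exact ⟨_, ⟨Module.finBasis Γ(X, V) (Ω[Γ(X, V)⁄k])⟩⟩
  · haveI : Nonempty V := ⟨⟨x, hx⟩⟩
    exact (hV0 inferInstance).elim

include hsec in
theorem smooth_sections [Smooth sX] {V : X.Opens} (hV : IsAffineOpen V) :
    Algebra.Smooth k Γ(X, V) := by
  have h := toSections_property sX (P := @Smooth) inferInstance hV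
  rw [← RingHom.ext (hsec V)] at h
  exact (RingHom.smooth_algebraMap).1 h

end Smooth

variable [IsIntegral X]

lemma genericPoint_mem_opens {V : X.Opens} {x : X} (hx : x ∈ V) : genericPoint X ∈ V :=
  (genericPoint_specializes x).mem_open V.2 hx

/-- Sections of an open as rational functions. -/
abbrev genHom (V : X.Opens) (hV : genericPoint X ∈ V) : Γ(X, V) →+* X.functionField :=
  germHom X V (genericPoint X) hV

lemma genHom_injective (V : X.Opens) (hV : genericPoint X ∈ V) :
    Function.Injective (genHom V hV) :=
  germ_injective_of_isIntegral X _ hV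

lemma genHom_mem_locRing {V : X.Opens} {x : X} (hx : x ∈ V) (hV : genericPoint X ∈ V)
    (a : Γ(X, V)) : genHom V hV a ∈ locRing x :=
  ⟨germHom X V x hx a, stalkSp_germHom _ _ _⟩

lemma exists_genHom_mul {V : X.Opens} (hV : IsAffineOpen V) {x : X} (hx : x ∈ V)
    (hη : genericPoint X ∈ V) {f : X.functionField} (hf : f ∈ locRing x) :
    ∃ a s : Γ(X, V), (genHom V hη s)⁻¹ ∈ locRing x ∧ genHom V hη s ≠ 0 ∧
      f * genHom V hη s = genHom V hη a := by
  obtain ⟨y, rfl⟩ := hf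
  obtain ⟨a, b, hb, h⟩ := exists_germ_mul_eq hV hx y
  have h1 : ∀ c, genHom V hη c = toK x (germHom X V x hx c) := fun c =>
    (stalkSp_germHom (genericPoint_specializes x) hx c).symm
  have hb0 : germHom X V x hx b ≠ 0 := hb.ne_zero
  refine ⟨a, b, ?_, ?_, ?_⟩
  · rw [h1]
    exact ((isU_toK_iff x _ hb0).2 hb).2
  · rw [h1]
    exact (map_ne_zero_iff _ (toK_injective x)).2 hb0
  · rw [h1, h1, ← h, map_mul]

lemma isFractionRing_genHom {V : X.Opens} (hV : IsAffineOpen V) (hη : genericPoint X ∈ V) :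
    @IsFractionRing Γ(X, V) _ X.functionField _ (genHom V hη).toAlgebra := by
  haveI : Nonempty V := ⟨⟨_, hη⟩⟩
  exact functionField_isFractionRing_of_isAffineOpen X V hV

lemma isDomain_sections {V : X.Opens} (hη : genericPoint X ∈ V) : IsDomain Γ(X, V) := by
  haveI : Nonempty V := ⟨⟨_, hη⟩⟩
  infer_instance

variable [∀ V : X.Opens, Algebra k Γ(X, V)] [Algebra k X.functionField]
  (hsec : ∀ (V : X.Opens) (c : k), algebraMap k Γ(X, V) c = toSections sX V c)
  (halg : ∀ c, algebraMap k X.functionField c = stalkConst sX (genericPoint X) c)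

include hsec halg in
lemma genHom_algebraMap (V : X.Opens) (hη : genericPoint X ∈ V) (c : k) :
    genHom V hη (algebraMap k Γ(X, V) c) = algebraMap k X.functionField c := by
  rw [hsec, halg]
  exact germHom_toSections sX V _ hη c

include hsec halg in
/-- A basis of the differentials on an affine open is a frame at each point. -/
theorem isFrame_diffMap {V : X.Opens} (hV : IsAffineOpen V) (hη : genericPoint X ∈ V) {r : ℕ}
    (b : Module.Basis (Fin r) Γ(X, V) (Ω[Γ(X, V)⁄k])) {y : X} (hy : y ∈ V) :
    IsFrame (KaehlerDifferential.D k X.functionField) (locRing y) fun i =>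
      diffMap k (genHom V hη) (genHom_algebraMap sX hsec halg V hη) (b i) := by
  letI : Algebra Γ(X, V) X.functionField := (genHom V hη).toAlgebra
  haveI : IsScalarTower k Γ(X, V) X.functionField := IsScalarTower.of_algebraMap_eq fun c =>
    (genHom_algebraMap sX hsec halg V hη c).symm
  haveI := isDomain_sections hη
  haveI := isFractionRing_genHom hV hη
  exact isFrame_of_isFractionRing b (genHom_mem_locRing hy hη)
    fun f hf => exists_genHom_mul hV hy hη hf

include hsec halg in
theorem finrank_differentials {V : X.Opens} (hV : IsAffineOpen V) (hη : genericPoint X ∈ V)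
    {r : ℕ} (b : Module.Basis (Fin r) Γ(X, V) (Ω[Γ(X, V)⁄k])) :
    Module.Finite X.functionField (Ω[X.functionField⁄k]) ∧
      Module.finrank X.functionField (Ω[X.functionField⁄k]) = r := by
  letI : Algebra Γ(X, V) X.functionField := (genHom V hη).toAlgebra
  haveI : IsScalarTower k Γ(X, V) X.functionField := IsScalarTower.of_algebraMap_eq fun c =>
    (genHom_algebraMap sX hsec halg V hη c).symm
  haveI := isDomain_sections hη
  haveI := isFractionRing_genHom hV hη
  exact finrank_of_isFractionRing b

include hsec halg in
/-- Around each point there is an affine open with a basis of differentials. -/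
theorem exists_frame [Smooth sX] (x : X) : ∃ V : X.Opens, IsAffineOpen V ∧ x ∈ V ∧
    Nonempty (Module.Basis (Fin (Module.finrank X.functionField (Ω[X.functionField⁄k]))) Γ(X, V)
      (Ω[Γ(X, V)⁄k])) := by
  obtain ⟨V, hV, hx, r, ⟨b⟩⟩ := exists_basis_differentials sX hsec x
  obtain rfl := (finrank_differentials sX hsec halg hV (genericPoint_mem_opens hx) b).2
  exact ⟨V, hV, hx, ⟨b⟩⟩

end LocalFrames

section Jacobian

variable {k : Type u} [Field k] {X : Scheme.{u}} (sX : X ⟶ Spec (CommRingCat.of k))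
  [IsIntegral X] [∀ V : X.Opens, Algebra k Γ(X, V)] [Algebra k X.functionField]
  (hsec : ∀ (V : X.Opens) (c : k), algebraMap k Γ(X, V) c = toSections sX V c)
  (halg : ∀ c, algebraMap k X.functionField c = stalkConst sX (genericPoint X) c)
  (φ : X ⟶ X) (hη : φ (genericPoint X) = genericPoint X)

omit [∀ V : X.Opens, Algebra k Γ(X, V)] in
include halg in
lemma pullK_algebraMap (hφ : φ ≫ sX = sX) (c : k) :
    pullK φ hη (algebraMap k X.functionField c) = algebraMap k X.functionField c := by
  rw [halg, ← stalkSp_stalkConst sX (genericPoint_specializes (φ (genericPoint X)))]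
  refine (pullK_toK φ hη _ _).trans ?_
  rw [stalkMap_stalkConst sX φ sX hφ]
  exact (stalkSp_stalkConst sX _ c).trans
    (stalkSp_stalkConst sX (genericPoint_specializes (φ (genericPoint X))) c).symm

lemma pullK_genHom {U V : X.Opens} (e : V ≤ φ ⁻¹ᵁ U) (hU : genericPoint X ∈ U)
    (hV : genericPoint X ∈ V) (a : Γ(X, U)) :
    pullK φ hη (genHom U hU a) = genHom V hV ((φ.appLE U V e).hom a) := by
  have hx : φ (genericPoint X) ∈ U := e hV
  have h1 : genHom U hU a = toK (φ (genericPoint X)) (germHom X U _ hx a) :=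
    (stalkSp_germHom _ _ _).symm
  rw [h1, pullK_toK, stalkMap_germHom φ hx a]
  exact (stalkSp_germHom _ _ _).trans (germHom_sres e hV _).symm

omit [IsIntegral X] [Algebra k X.functionField] in
include hsec in
lemma appLE_algebraMap (hφ : φ ≫ sX = sX) {U V : X.Opens} (e : V ≤ φ ⁻¹ᵁ U) (c : k) :
    (φ.appLE U V e).hom (algebraMap k Γ(X, U) c) = algebraMap k Γ(X, V) c := by
  rw [hsec, hsec, ← sres_toSections sX e]
  exact congrArg (sres X e) (toSections_app sX φ sX hφ U c)

lemma isUnit_of_forall_isU {V : X.Opens} (hV : genericPoint X ∈ V) {a : Γ(X, V)}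
    (ha : genHom V hV a ≠ 0) (h : ∀ y ∈ V, IsU y (genHom V hV a)) : IsUnit a := by
  refine X.toRingedSpace.isUnit_of_isUnit_germ V a fun y hy => ?_
  have h1 : genHom V hV a = toK y (germHom X V y hy a) :=
    (stalkSp_germHom (genericPoint_specializes y) hy a).symm
  have h2 := h y hy
  rw [h1, isU_toK_iff] at h2
  · exact h2
  · intro h0
    rw [h0, map_zero] at h1
    exact ha h1

omit [IsIntegral X] [Algebra k X.functionField] in
include hsec in
theorem exists_basis_le [Smooth sX] {x : X} {O : X.Opens} (hx : x ∈ O) :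
    ∃ V : X.Opens, V ≤ O ∧ IsAffineOpen V ∧ x ∈ V ∧
      ∃ r : ℕ, Nonempty (Module.Basis (Fin r) Γ(X, V) (Ω[Γ(X, V)⁄k])) := by
  obtain ⟨U, hU, hxU, r, ⟨b⟩⟩ := exists_basis_differentials sX hsec x
  obtain ⟨f, hfO, hxf⟩ := hU.exists_basicOpen_le ⟨x, hx⟩ hxU
  refine ⟨X.basicOpen f, hfO, hU.basicOpen f, hxf, r, ?_⟩
  letI : Algebra Γ(X, U) Γ(X, X.basicOpen f) := (sres X (X.basicOpen_le f)).toAlgebra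
  haveI : IsLocalization.Away f Γ(X, X.basicOpen f) := hU.isLocalization_basicOpen f
  haveI : IsScalarTower k Γ(X, U) Γ(X, X.basicOpen f) := IsScalarTower.of_algebraMap_eq fun c => by
    rw [hsec, hsec]
    exact (sres_toSections sX _ c).symm
  exact ⟨b.ofIsLocalizedModule Γ(X, X.basicOpen f) (Submonoid.powers f)
    (KaehlerDifferential.map k k Γ(X, U) Γ(X, X.basicOpen f))⟩

variable {r : ℕ} (θ : Module.Basis (Fin r) X.functionField (Ω[X.functionField⁄k]))

include hsec halg in
theorem etale_of_isUnit_jacobian [Smooth sX] (hφ : φ ≫ sX = sX)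
    (hJ : ∀ x (v w : Fin r → Ω[X.functionField⁄k]),
      IsFrame (KaehlerDifferential.D k X.functionField) (locRing (φ x)) v →
      IsFrame (KaehlerDifferential.D k X.functionField) (locRing x) w →
      θ.det (fun i => diffMap k (pullK φ hη) (pullK_algebraMap sX halg φ hη hφ) (v i)) / θ.det w ≠ 0
      ∧ IsU x (θ.det (fun i => diffMap k (pullK φ hη) (pullK_algebraMap sX halg φ hη hφ) (v i)) /
        θ.det w)) : Etale φ := by
  refine (HasRingHomProperty.iff_exists_appLE (P := @Etale)
    (RingHom.Etale.stableUnderComposition.stableUnderCompositionWithLocalizationAway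
      (RingHom.Etale.propertyIsLocal.HoldsForLocalizationAway
        RingHom.Etale.containsIdentities)).left).2 fun x => ?_
  obtain ⟨V, -, hV, hxV, r₁, ⟨b⟩⟩ := exists_basis_le sX hsec (TopologicalSpace.Opens.mem_top (φ x))
  have hxW : x ∈ φ ⁻¹ᵁ V := hxV
  obtain ⟨W, e, hW, hx, r₂, ⟨b'⟩⟩ := exists_basis_le sX hsec hxW
  refine ⟨⟨V, hV⟩, ⟨W, hW⟩, hx, e, ?_⟩
  have hηV := genericPoint_mem_opens hxV
  have hηW := genericPoint_mem_opens hx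
  have hr : Module.finrank X.functionField (Ω[X.functionField⁄k]) = r := by
    rw [Module.finrank_eq_card_basis θ, Fintype.card_fin]
  obtain rfl := (finrank_differentials sX hsec halg hV hηV b).2.symm.trans hr
  obtain rfl := (finrank_differentials sX hsec halg hW hηW b').2.symm.trans hr
  letI : Algebra Γ(X, V) Γ(X, W) := (φ.appLE V W e).hom.toAlgebra
  haveI : IsScalarTower k Γ(X, V) Γ(X, W) := IsScalarTower.of_algebraMap_eq fun c =>
    (appLE_algebraMap sX hsec φ hφ e c).symm
  haveI : Algebra.Smooth k Γ(X, W) := smooth_sections sX hsec hW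
  haveI : Algebra.Smooth k Γ(X, V) := smooth_sections sX hsec hV
  suffices h : Algebra.FormallyEtale Γ(X, V) Γ(X, W) by
    haveI : Algebra.FiniteType Γ(X, V) Γ(X, W) :=
      Algebra.FiniteType.of_restrictScalars_finiteType k _ _
    haveI : IsNoetherianRing Γ(X, V) := Algebra.FiniteType.isNoetherianRing k _
    haveI : Algebra.FinitePresentation Γ(X, V) Γ(X, W) :=
      Algebra.FinitePresentation.of_finiteType.1 inferInstance
    exact Algebra.Etale.mk
  let T := KaehlerDifferential.map k k Γ(X, V) Γ(X, W)
  let P : Matrix (Fin r₂) (Fin r₂) Γ(X, W) := fun i j => b'.repr (T (b i)) j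
  have hP : ∀ i, T (b i) = ∑ j, P i j • b' j := fun i => (b'.sum_repr _).symm
  refine formallyEtale_of_isUnit_det b b' P hP ?_
  have hSP : ∀ i, diffMap k (pullK φ hη) (pullK_algebraMap sX halg φ hη hφ)
      (diffMap k (genHom V hηV) (genHom_algebraMap sX hsec halg V hηV) (b i)) =
      ∑ j, (P.map (genHom W hηW)) i j •
        diffMap k (genHom W hηW) (genHom_algebraMap sX hsec halg W hηW) (b' j) := by
    intro i
    have h1 := congrArg (diffMap k (genHom W hηW) (genHom_algebraMap sX hsec halg W hηW)) (hP i)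
    rw [map_sum] at h1
    have hρ : ∀ c, ((genHom W hηW).comp (φ.appLE V W e).hom) (algebraMap k Γ(X, V) c) =
        algebraMap k X.functionField c := fun c =>
      (congrArg (genHom W hηW) (appLE_algebraMap sX hsec φ hφ e c)).trans
        (genHom_algebraMap sX hsec halg W hηW c)
    refine ((diffMap_diffMap _ _ _ _ ((genHom W hηW).comp (φ.appLE V W e).hom) hρ
      (fun a => pullK_genHom φ hη e hηV hηW a) (b i)).trans
        (diffMap_diffMap (φ.appLE V W e).hom (appLE_algebraMap sX hsec φ hφ e) _ _ _ hρ
          (fun a => rfl) (b i)).symm).trans (h1.trans ?_)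
    exact Finset.sum_congr rfl fun j _ => diffMap_smul _ _ _ _
  have hdet := det_eq_mul_det θ _ hSP
  have hdetP : ((P.map (genHom W hηW)).det) = genHom W hηW P.det :=
    (RingHom.map_det (genHom W hηW) P).symm
  rw [hdetP] at hdet
  have hfr : ∀ y ∈ W, genHom W hηW P.det ≠ 0 ∧ IsU y (genHom W hηW P.det) := fun y hy => by
    have hfW := isFrame_diffMap sX hsec halg hW hηW b' hy
    have h1 := hJ y _ _ (isFrame_diffMap sX hsec halg hV hηV b (e hy)) hfW
    rwa [hdet, mul_div_cancel_right₀ _ (hfW.det_ne_zero θ)] at h1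
  exact isUnit_of_forall_isU hηW (hfr x hx).1 fun y hy => (hfr y hy).2

end Jacobian

section EtaleOfForm

open Filter Topology

variable {k : Type u} [Field k] {X : Scheme.{u}} (sX : X ⟶ Spec (CommRingCat.of k))
  [IsIntegral X] (φ : X ⟶ X) (hη : φ (genericPoint X) = genericPoint X)

include sX hη in
lemma surjective_of_map_genericPoint [IsProper sX] (hφ : φ ≫ sX = sX) :
    Function.Surjective φ := by
  haveI : IsProper (φ ≫ sX) := by rw [hφ]; infer_instance
  haveI : IsProper φ := IsProper.of_comp φ sX
  intro x
  exact (genericPoint_specializes x).mem_closed φ.isClosedMap.isClosed_range ⟨_, hη⟩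

variable [∀ V : X.Opens, Algebra k Γ(X, V)] [Algebra k X.functionField]
  (hsec : ∀ (V : X.Opens) (c : k), algebraMap k Γ(X, V) c = toSections sX V c)
  (halg : ∀ c, algebraMap k X.functionField c = stalkConst sX (genericPoint X) c)

omit [∀ V : X.Opens, Algebra k Γ(X, V)] in
lemma det_diffMap_pullK_ne_zero (hφ : φ ≫ sX = sX)
    (hsep : @Algebra.IsSeparable _ _ _ _ (pullK φ hη).toAlgebra) {r : ℕ}
    (θ : Module.Basis (Fin r) X.functionField (Ω[X.functionField⁄k])) :
    θ.det (fun i => diffMap k (pullK φ hη) (pullK_algebraMap sX halg φ hη hφ) (θ i)) ≠ 0 := by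
  set S := diffMap k (pullK φ hη) (pullK_algebraMap sX halg φ hη hφ)
  haveI := Module.Finite.of_basis θ
  have hspan : Submodule.span X.functionField (Set.range fun i => S (θ i)) = ⊤ := by
    refine eq_top_of_isSeparable (pullK φ hη) hsep _ fun f => ?_
    rw [← diffMap_D (pullK φ hη) (pullK_algebraMap sX halg φ hη hφ),
      ← θ.sum_repr (KaehlerDifferential.D k _ f)]
    rw [map_sum]
    refine Submodule.sum_mem _ fun i _ => ?_
    rw [diffMap_smul]
    exact Submodule.smul_mem _ _ (Submodule.subset_span ⟨i, rfl⟩)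
  refine ((Module.Basis.is_basis_iff_det θ).1 ⟨?_, hspan⟩).ne_zero
  refine linearIndependent_of_top_le_span_of_card_eq_finrank hspan.ge ?_
  rw [Module.finrank_eq_card_basis θ]

include hsec halg in
theorem etale_of_pluricanonical [Infinite k] [IsProper sX] [Smooth sX] {N : ℕ} (P : ProjData X N)
    (hφ : φ ≫ sX = sX) (hsep : @Algebra.IsSeparable _ _ _ _ (pullK φ hη).toAlgebra) {r : ℕ}
    (θ : Module.Basis (Fin r) X.functionField (Ω[X.functionField⁄k])) {n : ℕ} (hn : 0 < n)
    {q : X.functionField} (hq0 : q ≠ 0) (hq : ∀ x (v : Fin r → Ω[X.functionField⁄k]),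
      IsFrame (KaehlerDifferential.D k X.functionField) (locRing x) v →
        q / θ.det v ^ n ∈ locRing x) : Etale φ := by
  set S := diffMap k (pullK φ hη) (pullK_algebraMap sX halg φ hη hφ)
  have hr : Module.finrank X.functionField (Ω[X.functionField⁄k]) = r := by
    rw [Module.finrank_eq_card_basis θ, Fintype.card_fin]
  subst hr
  choose V hV hxV b using exists_frame sX hsec halg
  let v : ∀ x : X, Fin _ → Ω[X.functionField⁄k] := fun x i =>
    diffMap k (genHom (V x) (genericPoint_mem_opens (hxV x)))
      (genHom_algebraMap sX hsec halg (V x) _) ((b x).some i)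
  have hv : ∀ x, ∀ y ∈ V x,
      IsFrame (KaehlerDifferential.D k X.functionField) (locRing y) (v x) := fun x y hy =>
    isFrame_diffMap sX hsec halg (hV x) _ (b x).some hy
  have hvx : ∀ x, IsFrame (KaehlerDifferential.D k X.functionField) (locRing x) (v x) :=
    fun x => hv x x (hxV x)
  have hU : ∀ x (w w' : Fin _ → Ω[X.functionField⁄k]),
      IsFrame (KaehlerDifferential.D k X.functionField) (locRing x) w →
      IsFrame (KaehlerDifferential.D k X.functionField) (locRing x) w' →
      IsU x (θ.det w / θ.det w') := fun x w w' hw hw' =>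
    ⟨hw'.div_mem hw.mem θ, by rw [inv_div]; exact hw.div_mem hw'.mem θ⟩
  have hc := det_diffMap_pullK_ne_zero sX φ hη halg hφ hsep θ
  have hJ := isU_jacobian sX P φ hη (surjective_of_map_genericPoint sX φ hη hφ)
    (D := fun x => θ.det (v x)) (fun x => (hvx x).det_ne_zero θ)
    (fun x => Filter.mem_of_superset ((V x).isOpen.mem_nhds (hxV x)) fun y hy =>
      hU y _ _ (hvx y) (hv x y hy))
    hc (fun x => by
      rw [← det_semilinear θ S]
      exact (hvx x).div_mem (fun i => diffLattice_map S (diffMap_D _ _)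
        (fun a ha => pullK_mem φ hη ha) ((hvx (φ x)).mem i)) θ)
    hn hq0 (fun x => hq x _ (hvx x))
  refine etale_of_isUnit_jacobian sX hsec halg φ hη θ hφ fun x w w' hw hw' => ?_
  have h0 := (hvx x).det_ne_zero θ
  have h1 := (hvx (φ x)).det_ne_zero θ
  have h2 := hw.det_ne_zero θ
  have h3 := hw'.det_ne_zero θ
  rw [det_semilinear θ S]
  refine ⟨div_ne_zero (mul_ne_zero ((map_ne_zero _).2 h2) hc) h3, ?_⟩
  have h4 := ((hJ x).mul (pullK_isU φ hη (hU _ _ _ hw (hvx (φ x))))).mul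
    (hU _ _ _ (hvx x) hw')
  convert h4 using 1
  have h5 : pullK φ hη (θ.det (v (φ x))) ≠ 0 := (map_ne_zero _).2 h1
  rw [map_div₀]
  field_simp
  rfl

end EtaleOfForm

section Algebraicity

lemma exists_linearIndependent_D {k L : Type u} [Field k] [Field L] [Algebra k L] {g : ℕ}
    (b : Module.Basis (Fin g) L (Ω[L⁄k])) :
    ∃ x : Fin g → L, LinearIndependent L fun i => KaehlerDifferential.D k L (x i) := by
  let c := Module.Basis.ofSpan (K := L) (s := Set.range (KaehlerDifferential.D k L))
    (KaehlerDifferential.span_range_derivation k L).ge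
  let c' := c.reindex (c.indexEquiv b)
  have h : ∀ i, ∃ x, KaehlerDifferential.D k L x = c' i := fun i => by
    rw [Module.Basis.reindex_apply]
    exact Module.Basis.ofSpan_subset (KaehlerDifferential.span_range_derivation k L).ge
      (Set.mem_range_self _)
  choose x hx using h
  exact ⟨x, by simpa only [hx] using c'.linearIndependent⟩

/-- A field of transcendence degree `g` is algebraic over a subring with `g` independent
differentials. -/
theorem isAlgebraic_of_basis {k A K : Type u} [Field k] [PerfectField k] [CommRing A] [IsDomain A]
    [Field K] [Algebra k A] [Algebra k K] [Algebra A K] [IsScalarTower k A K] [FaithfulSMul A K]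
    {g : ℕ} (b : Module.Basis (Fin g) A (Ω[A⁄k])) (hg : Algebra.trdeg k K ≤ g) :
    Algebra.IsAlgebraic A K := by
  let L := FractionRing A
  letI : Algebra L K := FractionRing.liftAlgebra A K
  haveI : IsScalarTower A L K := FractionRing.isScalarTower_liftAlgebra A K
  haveI : IsScalarTower k L K := IsScalarTower.of_algebraMap_eq fun c => by
    rw [IsScalarTower.algebraMap_apply k A K, IsScalarTower.algebraMap_apply k A L,
      ← IsScalarTower.algebraMap_apply A L K]
  obtain ⟨x, hx⟩ := exists_linearIndependent_D
    (b.ofIsLocalizedModule L (nonZeroDivisors A) (KaehlerDifferential.map k k A L))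
  exact (IsFractionRing.comap_isAlgebraic_iff (A := A) (K := L) (C := K)).2
    (isAlgebraic_of_linearIndependent x hx hg)

lemma trdeg_le_of_isFractionRing {k A K : Type u} [Field k] [CommRing A] [IsDomain A]
    [Field K] [Algebra k A] [Algebra k K] [Algebra A K] [IsScalarTower k A K] [IsFractionRing A K]
    [Algebra.FiniteType k A] {g : ℕ} (hg : ringKrullDim A ≤ g) : Algebra.trdeg k K ≤ g := by
  haveI : Algebra.IsAlgebraic A K := IsLocalization.isAlgebraic K (nonZeroDivisors A)
  have h := trdeg_add_eq k A (A := K)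
  rw [trdeg_eq_zero (R := A) (A := K), add_zero] at h
  exact h ▸ trdeg_le_of_ringKrullDim_le hg

end Algebraicity

section Sections

variable {X : Scheme.{u}} [IsIntegral X]

/-- A rational function which is locally a section is a section. -/
lemma mem_range_genHom {U : X.Opens} (hU : genericPoint X ∈ U) {z : X.functionField}
    (h : ∀ x ∈ U, ∃ V : X.Opens, V ≤ U ∧ x ∈ V ∧ ∃ hV : genericPoint X ∈ V,
      z ∈ (genHom V hV).range) : z ∈ (genHom U hU).range := by
  choose V hVU hxV hηV a ha using fun x : U => h x x.2
  obtain ⟨s, hs, -⟩ := X.sheaf.existsUnique_gluing' V U (fun i => homOfLE (hVU i))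
    (fun x hx => TopologicalSpace.Opens.mem_iSup.2 ⟨⟨x, hx⟩, hxV _⟩) a fun i j => by
      refine genHom_injective (V i ⊓ V j) ⟨hηV i, hηV j⟩ ?_
      exact (germHom_sres inf_le_left _ _).trans ((ha i).trans
        ((ha j).symm.trans (germHom_sres inf_le_right _ _).symm))
  refine ⟨s, ?_⟩
  rw [← ha ⟨_, hU⟩, ← hs ⟨_, hU⟩]
  exact (germHom_sres (hVU ⟨_, hU⟩) (hηV ⟨_, hU⟩) s).symm

variable {k : Type u} [Field k] (sX : X ⟶ Spec (CommRingCat.of k))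
  [∀ V : X.Opens, Algebra k Γ(X, V)] [Algebra k X.functionField]
  (hsec : ∀ (V : X.Opens) (c : k), algebraMap k Γ(X, V) c = toSections sX V c)
  (halg : ∀ c, algebraMap k X.functionField c = stalkConst sX (genericPoint X) c)

include hsec halg in
lemma trdeg_functionField_le [Smooth sX] {g : ℕ} (hdim : topologicalKrullDim X = (g : ℕ∞)) :
    Algebra.trdeg k X.functionField ≤ g := by
  obtain ⟨V, hV, hx, -⟩ := exists_isAffineOpen_mem_and_subset
    (TopologicalSpace.Opens.mem_top (genericPoint X))
  letI : Algebra Γ(X, V) X.functionField := (genHom V hx).toAlgebra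
  haveI : IsScalarTower k Γ(X, V) X.functionField := IsScalarTower.of_algebraMap_eq fun c =>
    (genHom_algebraMap sX hsec halg V hx c).symm
  haveI := isDomain_sections hx
  haveI := isFractionRing_genHom hV hx
  haveI : Algebra.Smooth k Γ(X, V) := smooth_sections sX hsec hV
  refine trdeg_le_of_isFractionRing (A := Γ(X, V)) ?_
  rw [← PrimeSpectrum.topologicalKrullDim_eq_ringKrullDim]
  have h := hV.fromSpec.isOpenEmbedding.isInducing.topologicalKrullDim_le
  rw [hdim] at h
  exact h

include hsec halg in
/-- The sections over an open with a basis of differentials have the full fraction field. -/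
theorem isFractionRing_of_basis [PerfectField k] [Smooth sX] {g : ℕ}
    (hdim : topologicalKrullDim X = (g : ℕ∞)) {U : X.Opens} (hU : genericPoint X ∈ U)
    (b : Module.Basis (Fin g) Γ(X, U) (Ω[Γ(X, U)⁄k])) :
    @IsFractionRing Γ(X, U) _ X.functionField _ (genHom U hU).toAlgebra := by
  letI : Algebra Γ(X, U) X.functionField := (genHom U hU).toAlgebra
  haveI : IsScalarTower k Γ(X, U) X.functionField := IsScalarTower.of_algebraMap_eq fun c =>
    (genHom_algebraMap sX hsec halg U hU c).symm
  haveI := isDomain_sections hU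
  haveI : FaithfulSMul Γ(X, U) X.functionField :=
    (faithfulSMul_iff_algebraMap_injective _ _).2 (genHom_injective U hU)
  have halg' := isAlgebraic_of_basis b (trdeg_functionField_le sX hsec halg hdim)
  refine IsFractionRing.of_field _ _ fun y => ?_
  obtain ⟨a, ha, hay⟩ := (halg'.isAlgebraic y).exists_integral_multiple
  have ha0 : algebraMap Γ(X, U) X.functionField a ≠ 0 := by
    rwa [Ne, FaithfulSMul.algebraMap_eq_zero_iff]
  obtain ⟨s, hs⟩ : a • y ∈ (genHom U hU).range := by
    refine mem_range_genHom hU fun x hx => ?_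
    obtain ⟨V, hV, hxV, hVU⟩ := exists_isAffineOpen_mem_and_subset hx
    have hηV := genericPoint_mem_opens hxV
    refine ⟨V, hVU, hxV, hηV, ?_⟩
    haveI : Algebra.Smooth k Γ(X, V) := smooth_sections sX hsec hV
    haveI := isDomain_sections hηV
    letI : Algebra Γ(X, V) X.functionField := (genHom V hηV).toAlgebra
    haveI : IsFractionRing Γ(X, V) X.functionField := isFractionRing_genHom hV hηV
    have hcl : IsIntegrallyClosed Γ(X, V) := isIntegrallyClosed_of_smooth (k := k)
    refine (isIntegrallyClosed_iff X.functionField).1 hcl ?_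
    letI : Algebra Γ(X, U) Γ(X, V) := (sres X hVU).toAlgebra
    haveI : IsScalarTower Γ(X, U) Γ(X, V) X.functionField :=
      IsScalarTower.of_algebraMap_eq fun c => (germHom_sres hVU hηV c).symm
    exact hay.tower_top
  refine ⟨s, a, ?_⟩
  rw [eq_div_iff ha0, mul_comm, ← Algebra.smul_def]
  exact hs.symm

end Sections

lemma isProper_toSpecZero {σ : Type*} {A : Type u} [CommRing A] [SetLike σ A]
    [AddSubgroupClass σ A] (𝒜 : ℕ → σ) [GradedRing 𝒜] [Algebra.FiniteType (𝒜 0) A] :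
    IsProper (Proj.toSpecZero 𝒜) :=
  inferInstance

lemma isProper_of_isProjectiveVariety {k : Type u} [Field k] {X : Scheme.{u}}
    {sX : X ⟶ Spec (CommRingCat.of k)} (hX : IsProjectiveVariety sX) : IsProper sX := by
  obtain ⟨-, N, ι, hι, rfl⟩ := hX
  have hsurj : Function.Surjective (degreeZeroInclusion k N) := fun ⟨p, hp⟩ => by
    exact ⟨p.coeff 0, Subtype.ext (MvPolynomial.totalDegree_eq_zero_iff_eq_C.1
      ((MvPolynomial.totalDegree_zero_iff_isHomogeneous _).2 hp)).symm⟩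
  haveI : IsClosedImmersion (Spec.map (CommRingCat.ofHom (degreeZeroInclusion k N))) :=
    IsClosedImmersion.spec_of_surjective _ hsurj
  haveI : Algebra.FiniteType (MvPolynomial.homogeneousSubmodule (Fin (N + 1)) k 0)
      (MvPolynomial (Fin (N + 1)) k) := by
    have h : (algebraMap k (MvPolynomial (Fin (N + 1)) k)).FiniteType :=
      RingHom.finiteType_algebraMap.2 inferInstance
    exact RingHom.finiteType_algebraMap.1
      (RingHom.FiniteType.of_comp_finiteType (f := degreeZeroInclusion k N) h)
  haveI : IsProper (ProjSpace.str k N) := by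
    refine MorphismProperty.comp_mem @IsProper _ _ ?_ inferInstance
    exact isProper_toSpecZero _
  infer_instance

section Pluricanonical

variable {X : Scheme.{u}} [IsIntegral X] {k : Type u} [Field k] (sX : X ⟶ Spec (CommRingCat.of k))

omit [IsIntegral X] in
lemma exists_section_of_secSubmodule_ne_bot {L : LineBundle X} (h : secSubmodule sX L ≠ ⊥) :
    ∃ s : ∀ i, Γ(X, L.U i), s ≠ 0 ∧ ∀ i j, sres X inf_le_left (s i) =
      (L.t i j : Γ(X, L.U i ⊓ L.U j)) * sres X inf_le_right (s j) := by
  letI : ∀ i, Module k Γ(X, L.U i) := fun i => (toSections sX (L.U i)).toModule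
  obtain ⟨s, hs, hs0⟩ := Submodule.exists_mem_ne_zero_of_ne_bot h
  exact ⟨s, hs0, hs⟩

section Abstract

variable [∀ V : X.Opens, Algebra k Γ(X, V)] [Algebra k X.functionField]
  (hsec : ∀ (V : X.Opens) (c : k), algebraMap k Γ(X, V) c = toSections sX V c)
  (halg : ∀ c, algebraMap k X.functionField c = stalkConst sX (genericPoint X) c)

lemma diffMap_genHom_mem {V : X.Opens} {x : X} (hx : x ∈ V) (hV : genericPoint X ∈ V)
    (w : Ω[Γ(X, V)⁄k]) :
    diffMap k (genHom V hV) (genHom_algebraMap sX hsec halg V hV) w ∈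
      diffLattice (KaehlerDifferential.D k X.functionField) (locRing x) := by
  induction w using kaehlerDifferential_induction with
  | hD a =>
    rw [diffMap_D]
    exact Submodule.subset_span ⟨_, genHom_mem_locRing hx hV a, rfl⟩
  | h_zero => exact (map_zero (diffMap k (genHom V hV) _)).symm ▸ zero_mem _
  | h_add y z hy hz => exact (map_add (diffMap k (genHom V hV) _) y z).symm ▸ add_mem hy hz
  | h_smul a y hy =>
    rw [diffMap_smul]
    exact Submodule.smul_mem _ (⟨_, genHom_mem_locRing hx hV a⟩ : locRing x) hy

omit [IsIntegral X] [Algebra k X.functionField] in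
include hsec in
lemma sres_algebraMap {U V : X.Opens} (h : V ≤ U) (c : k) :
    sres X h (algebraMap k Γ(X, U) c) = algebraMap k Γ(X, V) c := by
  rw [hsec, hsec]
  exact sres_toSections sX h c

lemma diffMap_sres {U V : X.Opens} (h : V ≤ U) (hV : genericPoint X ∈ V) (w : Ω[Γ(X, U)⁄k]) :
    diffMap k (genHom V hV) (genHom_algebraMap sX hsec halg V hV)
      (diffMap k (sres X h) (sres_algebraMap sX hsec h) w) =
    diffMap k (genHom U (h hV)) (genHom_algebraMap sX hsec halg U (h hV)) w :=
  diffMap_diffMap _ _ _ _ _ _ (fun a => germHom_sres h hV a) w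

include halg in
/-- A nonzero section of a power of the canonical bundle, written in a basis of the differentials
of the function field. -/
theorem exists_pluricanonical_of_basis [PerfectField k] [Smooth sX] {g : ℕ}
    (hdim : topologicalKrullDim X = (g : ℕ∞)) (ω : LineBundle X)
    (e : ∀ i : ω.ι, Module.Basis (Fin g) Γ(X, ω.U i) (Ω[Γ(X, ω.U i)⁄k]))
    (he : ∀ i j, ∃ M : Matrix (Fin g) (Fin g) Γ(X, ω.U i ⊓ ω.U j),
      (∀ a, diffMap k (sres X inf_le_right) (sres_algebraMap sX hsec inf_le_right) (e j a) =
        ∑ b, M a b •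
          diffMap k (sres X inf_le_left) (sres_algebraMap sX hsec inf_le_left) (e i b)) ∧
        (ω.t i j : Γ(X, ω.U i ⊓ ω.U j)) = M.det)
    {n : ℕ} (hn : secSubmodule sX (ω.pow n) ≠ ⊥) :
    ∃ θ : Module.Basis (Fin g) X.functionField (Ω[X.functionField⁄k]),
      ∃ q : X.functionField, q ≠ 0 ∧ ∀ x (v : Fin g → Ω[X.functionField⁄k]),
        IsFrame (KaehlerDifferential.D k X.functionField) (locRing x) v →
          q / θ.det v ^ n ∈ locRing x := by
  obtain ⟨s, hs0, hs⟩ : ∃ s : ∀ i, Γ(X, ω.U i), s ≠ 0 ∧ ∀ i j,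
      sres X (inf_le_left : ω.U i ⊓ ω.U j ≤ ω.U i) (s i) =
        (ω.t i j : Γ(X, ω.U i ⊓ ω.U j)) ^ n *
          sres X (inf_le_right : ω.U i ⊓ ω.U j ≤ ω.U j) (s j) :=
    exists_section_of_secSubmodule_ne_bot sX hn
  obtain ⟨i₀, hi₀⟩ := Function.ne_iff.1 hs0
  have hη₀ : genericPoint X ∈ ω.U i₀ := by
    by_contra h
    have h1 : ω.U i₀ = ⊥ := by
      ext x
      exact ⟨fun hx => h (genericPoint_mem_opens hx), fun hx => hx.elim⟩
    have h2 : Subsingleton Γ(X, ω.U i₀) := by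
      rw [h1]
      exact CommRingCat.subsingleton_of_isTerminal X.sheaf.isTerminalOfEmpty
    exact hi₀ (h2.elim _ _)
  letI : Algebra Γ(X, ω.U i₀) X.functionField := (genHom (ω.U i₀) hη₀).toAlgebra
  haveI : IsScalarTower k Γ(X, ω.U i₀) X.functionField := IsScalarTower.of_algebraMap_eq fun c =>
    (genHom_algebraMap sX hsec halg (ω.U i₀) hη₀ c).symm
  haveI : IsFractionRing Γ(X, ω.U i₀) X.functionField :=
    isFractionRing_of_basis sX hsec halg hdim hη₀ (e i₀)
  let θ : Module.Basis (Fin g) X.functionField (Ω[X.functionField⁄k]) :=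
    (e i₀).ofIsLocalizedModule X.functionField (nonZeroDivisors Γ(X, ω.U i₀))
      (KaehlerDifferential.map k k Γ(X, ω.U i₀) X.functionField)
  have hθ : ∀ a, θ a = diffMap k (genHom (ω.U i₀) hη₀)
      (genHom_algebraMap sX hsec halg (ω.U i₀) hη₀) (e i₀ a) := fun a =>
    Module.Basis.ofIsLocalizedModule_apply _ _ _ _ _
  refine ⟨θ, genHom (ω.U i₀) hη₀ (s i₀), ?_, fun x v hv => ?_⟩
  · exact (map_ne_zero_iff _ (genHom_injective _ hη₀)).2 hi₀
  have hx : x ∈ iSup ω.U := ω.covers ▸ TopologicalSpace.Opens.mem_top x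
  obtain ⟨i, hi⟩ := TopologicalSpace.Opens.mem_iSup.1 hx
  have hηi := genericPoint_mem_opens hi
  have hη : genericPoint X ∈ ω.U i₀ ⊓ ω.U i := ⟨hη₀, hηi⟩
  obtain ⟨M, hM, hMt⟩ := he i₀ i
  let w : Fin g → Ω[X.functionField⁄k] := fun a =>
    diffMap k (genHom (ω.U i) hηi) (genHom_algebraMap sX hsec halg (ω.U i) hηi) (e i a)
  have hw : ∀ a, w a = ∑ b, (M.map (genHom _ hη)) a b • θ b := fun a => by
    refine (diffMap_sres sX hsec halg inf_le_right hη (e i a)).symm.trans ?_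
    rw [hM, map_sum]
    refine Finset.sum_congr rfl fun b _ => ?_
    rw [diffMap_smul, diffMap_sres sX hsec halg inf_le_left hη, hθ]
    rfl
  have hdet : θ.det w = genHom _ hη (ω.t i₀ i : Γ(X, ω.U i₀ ⊓ ω.U i)) := by
    rw [det_eq_mul_det θ _ hw, θ.det_self, mul_one, hMt, RingHom.map_det]
    rfl
  have hq : genHom (ω.U i₀) hη₀ (s i₀) = θ.det w ^ n * genHom (ω.U i) hηi (s i) := by
    have h1 := congrArg (genHom _ hη) (hs i₀ i)
    rw [map_mul, map_pow, ← hdet] at h1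
    refine (germHom_sres inf_le_left hη (s i₀)).symm.trans (h1.trans ?_)
    exact congrArg (θ.det w ^ n * ·) (germHom_sres inf_le_right hη (s i))
  rw [hq, mul_div_right_comm, ← div_pow]
  exact mul_mem (pow_mem (hv.div_mem (fun a => diffMap_genHom_mem sX hsec halg hi hηi (e i a)) θ) n)
    (genHom_mem_locRing hi hηi _)

end Abstract

end Pluricanonical

end Proof

/-- Let `X` be a smooth projective variety over an algebraically closed
field, `φ : X → X` a separable morphism and `L` an ample line bundle with
`φ*(L) ≅ L^{⊗d}`, `d > 1`. If the Kodaira dimension of `X` is `≥ 0`, then `X` contains no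
positive dimensional closed subvariety with finite algebraic fundamental group. -/
theorem stmt_12 {k : Type u} [Field k] [IsAlgClosed k] {X : Scheme.{u}} [IsIntegral X]
    (sX : X ⟶ Spec (CommRingCat.of k)) (hX : IsProjectiveVariety sX) (hsm : IsSmooth sX)
    (φ : X ⟶ X) (hφ : φ ≫ sX = sX) (hsep : IsSeparableSelfMap φ)
    (L : LineBundle X) (hL : L.IsAmple) (d : ℕ) (hd : 1 < d)
    (hpull : (LineBundle.pullbackLB φ L).EquivLB (L.pow d))
    (g : ℕ) (hdim : topologicalKrullDim X = (g : ℕ∞))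
    (ω : LineBundle X) (hω : IsCanonicalBundle sX g ω)
    (hkod : ∃ n : ℕ, 0 < n ∧ LineBundle.secSubmodule sX (ω.pow n) ≠ ⊥) :
    ∀ (Y : Scheme.{u}) (j : Y ⟶ X), IsClosedImmersion j → IsIntegral Y →
      0 < topologicalKrullDim Y → ¬ HasFiniteAlgebraicPi1 Y := by
  intro Y j _ _ hY
  obtain ⟨hη, hsep⟩ := hsep
  obtain ⟨n, hn, hsec⟩ := hkod
  have : Smooth sX := hsm
  have : IsProper sX := isProper_of_isProjectiveVariety hX
  obtain ⟨N, P, hP⟩ := exists_projData L hL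
  let _ : ∀ V : X.Opens, Algebra k Γ(X, V) := fun V => (LineBundle.toSections sX V).toAlgebra
  let _ : Algebra k X.functionField := (stalkConst sX (genericPoint X)).toAlgebra
  obtain ⟨e, he⟩ := hω
  obtain ⟨θ, q, hq0, hq⟩ := exists_pluricanonical_of_basis sX (fun _ _ => rfl) (fun _ => rfl)
    hdim ω e he hsec
  have : Etale φ := etale_of_pluricanonical sX φ hη (fun _ _ => rfl) (fun _ => rfl) P hφ hsep θ
    hn hq0 hq
  exact not_hasFiniteAlgebraicPi1 sX P hφ hd (hP φ d hpull) j hY
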